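/- There exist a finite tile set U of 3-dimensional tile types and a constant c > 0 such that for every 3D aTAM system 𝒯 = (T, σ, τ) with |T| ≥ 2 and τ ≥ 2, there are a valid macrotile representation function R, a finite seed assembly σ_𝒯 over U, and a scale factor m ∈ ℕ with m ≤ c·|T|²·log₂(|T|·τ), such that 𝒰_𝒯 = (U, σ_𝒯, 2) (a temperature-2 system) simulates 𝒯 at scale m under R. In particular, the 3D aTAM is intrinsically universal at temperature 2 with scale factor O(|T|² log(|T|τ)). -/

import Mathlib

open scoped Classical

noncomputable section

namespace ATAM

/-- A glue: a label (a finite string over the alphabet) together with a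
nonnegative integer strength. -/
abbrev Glue : Type := String × ℕ

/-- A `d`-dimensional tile type: for each of the `d` axes, a glue on the
positive face and a glue on the negative face (`2d` glues in total). -/
abbrev TileType (d : ℕ) : Type := Fin d → Glue × Glue

/-- Points of the integer lattice `ℤ^d`. -/
abbrev Pt (d : ℕ) : Type := Fin d → ℤ

/-- A configuration: a partial placement of tile types on `ℤ^d`. -/
abbrev Config (d : ℕ) : Type := Pt d → Option (TileType d)

variable {d : ℕ}

/-- The domain of a configuration. -/
def dom (α : Config d) : Set (Pt d) := {p | α p ≠ none}

/-- Grid-graph adjacency on `ℤ^d` (Euclidean, equivalently `ℓ¹`, distance one). -/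
def adj (p q : Pt d) : Prop := (∑ i, |p i - q i|) = 1

/-- A set of lattice points is connected in the grid graph of `ℤ^d`. -/
def ConnectedSet (S : Set (Pt d)) : Prop :=
  ∀ p ∈ S, ∀ q ∈ S,
    Relation.ReflTransGen (fun a b => adj a b ∧ a ∈ S ∧ b ∈ S) p q

/-- The strength with which a tile of type `t` at `p` and a tile of type `t'`
at `q` interact: nonzero only if `p` and `q` are adjacent and the abutting
glues are equal (in label and strength) with positive strength. -/
def bond (t t' : TileType d) (p q : Pt d) : ℕ :=
  ∑ i : Fin d,
    ((if q = Function.update p i (p i + 1) ∧ (t i).1 = (t' i).2 ∧ 0 < (t i).1.2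
        then (t i).1.2 else 0) +
     (if p = Function.update q i (q i + 1) ∧ (t i).2 = (t' i).1 ∧ 0 < (t i).2.2
        then (t i).2.2 else 0))

/-- The strength of the bond between positions `p` and `q` in configuration `α`. -/
def bondAt (α : Config d) (p q : Pt d) : ℕ :=
  match α p, α q with
  | some t, some t' => bond t t' p q
  | _, _ => 0

/-- `α` is `τ`-stable: every cut of its binding graph has weight at least `τ`. -/
def Stable (τ : ℕ) (α : Config d) : Prop :=
  ∀ A B : Set (Pt d), A.Nonempty → B.Nonempty → Disjoint A B → A ∪ B = dom α →
    ∃ F : Finset (Pt d × Pt d),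
      (∀ e ∈ F, e.1 ∈ A ∧ e.2 ∈ B) ∧ τ ≤ ∑ e ∈ F, bondAt α e.1 e.2

/-- `β` extends `α`, i.e. `α` is a subassembly of `β` (`α ⊑ β`). -/
def Extends (α β : Config d) : Prop := ∀ p t, α p = some t → β p = some t

/-- A `d`-dimensional tile assembly system `(T, σ, τ)`: a finite tile set, a
finite `τ`-stable seed assembly over the tile set, and a temperature `τ ≥ 1`. -/
structure TAS (d : ℕ) where
  tileset : Finset (TileType d)
  seed : Config d
  temp : ℕ
  temp_pos : 0 < temp
  seed_nonempty : (dom seed).Nonempty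
  seed_connected : ConnectedSet (dom seed)
  seed_finite : (dom seed).Finite
  seed_tiles : ∀ p t, seed p = some t → t ∈ tileset
  seed_stable : Stable temp seed

/-- One step of the (unrestricted) aTAM: a single tile of the tile set
`τ`-stably attaches at an empty location. -/
def Attach (T : TAS d) (α β : Config d) : Prop :=
  ∃ p t, p ∉ dom α ∧ t ∈ T.tileset ∧
    β = Function.update α p (some t) ∧ Stable T.temp β

/-- `q` lies outside the minimal bounding box of `α`. -/
def OutsideBBox (α : Config d) (q : Pt d) : Prop :=
  ∃ i : Fin d, (∀ p ∈ dom α, q i < p i) ∨ (∀ p ∈ dom α, p i < q i)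

/-- There is a diffusion path for `p` with respect to `α`: a path in the grid
graph of `ℤ^d` from `p` to a point outside the minimal bounding box of `α`,
none of whose points lies in `dom α`. -/
def HasDiffusionPath (α : Config d) (p : Pt d) : Prop :=
  ∃ (k : ℕ) (x : ℕ → Pt d), x 0 = p ∧ (∀ j < k, adj (x j) (x (j + 1))) ∧
    (∀ j ≤ k, x j ∉ dom α) ∧ OutsideBBox α (x k)

/-- One step of the diffusion-restricted aTAM: additionally the attachment
location must admit a diffusion path. -/
def AttachD (T : TAS d) (α β : Config d) : Prop :=
  ∃ p t, p ∉ dom α ∧ t ∈ T.tileset ∧ HasDiffusionPath α p ∧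
    β = Function.update α p (some t) ∧ Stable T.temp β

/-- A (possibly stuttering) chain of single-tile attachment steps with respect
to the attachment relation `A`. -/
def Chain (A : Config d → Config d → Prop) (f : ℕ → Config d) : Prop :=
  ∀ n, f n = f (n + 1) ∨ A (f n) (f (n + 1))

/-- `β` is the (limiting) result of the sequence `f`. -/
def Limit (f : ℕ → Config d) (β : Config d) : Prop :=
  ∀ p t, β p = some t ↔ ∃ n, f n p = some t

/-- `β` is producible from `α` by zero or more (possibly infinitely many)
single-tile attachment steps, with respect to the attachment relation `A`. -/
def ProducesFrom (A : Config d → Config d → Prop) (α β : Config d) : Prop :=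
  ∃ f : ℕ → Config d, f 0 = α ∧ Chain A f ∧ Limit f β

/-- `α` admits no attachment step: it is terminal. -/
def Terminal (A : Config d → Config d → Prop) (α : Config d) : Prop :=
  ∀ β, ¬ A α β

/-- The system with seed `σ` and attachment relation `A` is directed: it has
exactly one producible terminal assembly. -/
def DirectedSys (A : Config d → Config d → Prop) (σ : Config d) : Prop :=
  ∃! α, ProducesFrom A σ α ∧ Terminal A α

/-- The `m`-block macrotile of `α` at block position `x`. -/
def mblock (m : ℕ) (α : Config d) (x : Pt d) : Config d :=
  fun y => if ∀ i, 0 ≤ y i ∧ y i < (m : ℤ) then α (fun i => (m : ℤ) * x i + y i) else none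

/-- A (partial) macrotile representation function. -/
abbrev RepFn (d : ℕ) : Type := Config d → Option (TileType d)

/-- `R` is a valid macrotile representation function into the tile set `Tset`:
it is monotone with respect to the subassembly relation on macrotiles, and its
values are tile types of `Tset`. -/
def ValidRep (Tset : Finset (TileType d)) (R : RepFn d) : Prop :=
  (∀ γ γ', Extends γ γ' → ∀ t, R γ = some t → R γ' = some t) ∧
  (∀ γ t, R γ = some t → t ∈ Tset)

/-- The induced assembly representation function `R*`. -/
def repStar (R : RepFn d) (m : ℕ) (α' : Config d) : Config d :=
  fun x => R (mblock m α' x)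

/-- Block position `x` holds a nonempty `m`-block of `α'`. -/
def NonemptyBlock (m : ℕ) (α' : Config d) (x : Pt d) : Prop :=
  ∃ y, mblock m α' x y ≠ none

/-- `α'` maps cleanly to `R*(α')`: every nonempty block position lies in the
domain of `R*(α')` or is (non-diagonally) adjacent to a point of that domain,
or `α'` has at most one nonempty block. -/
def MapsCleanly (R : RepFn d) (m : ℕ) (α' : Config d) : Prop :=
  (∀ x, NonemptyBlock m α' x →
      repStar R m α' x ≠ none ∨ ∃ u, adj x u ∧ repStar R m α' u ≠ none) ∨
  (∃ x₀, ∀ x, NonemptyBlock m α' x → x = x₀)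

/-- The system with attachment relation `A_S` and seed `σ_S` simulates the
system with attachment relation `A_T` and seed `σ_T` at scale `m` under the
representation function `R`: they have equivalent productions, the simulated
system follows the simulator, and the simulator models the simulated system. -/
structure SimulatesVia (A_T : Config d → Config d → Prop) (σ_T : Config d)
    (A_S : Config d → Config d → Prop) (σ_S : Config d)
    (R : RepFn d) (m : ℕ) : Prop where
  /-- `{R*(α') : α' ∈ 𝒜[𝒮]} = 𝒜[𝒯]` -/
  prod_eq : ∀ α, ProducesFrom A_T σ_T α ↔
      ∃ α', ProducesFrom A_S σ_S α' ∧ repStar R m α' = α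
  /-- `{R*(α') : α' ∈ 𝒜□[𝒮]} = 𝒜□[𝒯]` -/
  term_eq : ∀ α, (ProducesFrom A_T σ_T α ∧ Terminal A_T α) ↔
      ∃ α', (ProducesFrom A_S σ_S α' ∧ Terminal A_S α') ∧ repStar R m α' = α
  /-- every producible assembly of the simulator maps cleanly -/
  clean : ∀ α', ProducesFrom A_S σ_S α' → MapsCleanly R m α'
  /-- `𝒯` follows `𝒮` -/
  follows : ∀ α' β', ProducesFrom A_S σ_S α' → ProducesFrom A_S σ_S β' →
      ProducesFrom A_S α' β' →
      ProducesFrom A_T (repStar R m α') (repStar R m β')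
  /-- `𝒮` models `𝒯` -/
  models : ∀ α, ProducesFrom A_T σ_T α → ∃ Ps : Set (Config d),
      (∀ α' ∈ Ps, ProducesFrom A_S σ_S α' ∧ repStar R m α' = α) ∧
      ∀ β, ProducesFrom A_T σ_T β → ProducesFrom A_T α β →
        (∀ α' ∈ Ps, ∃ β', ProducesFrom A_S α' β' ∧ repStar R m β' = β) ∧
        (∀ α'' β', ProducesFrom A_S σ_S α'' → repStar R m α'' = α →
            ProducesFrom A_S α'' β' → repStar R m β' = β →
            ∃ α' ∈ Ps, ProducesFrom A_S α' α'')

/-- `US` simulates `T` at scale `m` under `R`, both with the standard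
(unrestricted) aTAM dynamics. -/
def Simulates (US T : TAS d) (R : RepFn d) (m : ℕ) : Prop :=
  SimulatesVia (Attach T) T.seed (Attach US) US.seed R m

/-- `US` simulates `T` at scale `m` under `R`, both with the
diffusion-restricted dynamics. -/
def SimulatesD (US T : TAS d) (R : RepFn d) (m : ℕ) : Prop :=
  SimulatesVia (AttachD T) T.seed (AttachD US) US.seed R m

end ATAM

open ATAM

namespace IU

/-! ## Generic growth systems -/

abbrev St (X V : Type) := X → Option V

def Le {X V : Type} (s s' : St X V) : Prop := ∀ x v, s x = some v → s' x = some v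

structure GS (X V : Type) where
  rule : X → V → Finset (X × V) → Prop

variable {X V : Type}

theorem Le.refl (s : St X V) : Le s s := fun _ _ h => h
theorem Le.trans {a b c : St X V} (h : Le a b) (h' : Le b c) : Le a c :=
  fun x v hx => h' x v (h x v hx)
theorem Le.ne {a b : St X V} (h : Le a b) {x} (hx : a x ≠ none) : b x ≠ none := by
  obtain ⟨v, hv⟩ := Option.ne_none_iff_exists'.1 hx
  rw [h x v hv]; simp
theorem Le.antisymm {a b : St X V} (h : Le a b) (h' : ∀ x, b x ≠ none → a x ≠ none) : a = b := by
  funext x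
  cases hb : b x with
  | none =>
    by_contra hc
    exact absurd hb (h.ne hc)
  | some v =>
    have := h' x (by simp [hb])
    obtain ⟨w, hw⟩ := Option.ne_none_iff_exists'.1 this
    rw [hw, ← hb, h x w hw]
theorem Le.eq_of {a b : St X V} (h : Le a b) {x v} (hb : b x = some v) (hx : a x ≠ none) :
    a x = some v := by
  obtain ⟨w, hw⟩ := Option.ne_none_iff_exists'.1 hx
  rw [hw, ← hb, h x w hw]

namespace GS
variable (G : GS X V)

inductive Supp (s0 s : St X V) : X → Prop
  | base {x} : s0 x ≠ none → Supp s0 s x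
  | step {x v H} : s x = some v → G.rule x v H → (∀ h ∈ H, s h.1 = some h.2) →
      (∀ h ∈ H, Supp s0 s h.1) → Supp s0 s x

def Reach (s0 s : St X V) : Prop := Le s0 s ∧ ∀ x, s x ≠ none → G.Supp s0 s x

def En (s : St X V) (x : X) (v : V) : Prop := ∃ H, G.rule x v H ∧ ∀ h ∈ H, s h.1 = some h.2

def Term (s : St X V) : Prop := ∀ x v, s x = none → ¬ G.En s x v

variable {G}

theorem Supp.mono {s0 s s' : St X V} (hs : Le s s') {x} (h : G.Supp s0 s x) : G.Supp s0 s' x := by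
  induction h with
  | base h => exact .base h
  | step hv hr hH _ ih => exact .step (hs _ _ hv) hr (fun h hh => hs _ _ (hH h hh)) ih

theorem Supp.trans {s0 s1 s : St X V} (h1 : ∀ x, s1 x ≠ none → G.Supp s0 s x) {x}
    (h : G.Supp s1 s x) : G.Supp s0 s x := by
  induction h with
  | base h => exact h1 _ h
  | step hv hr hH _ ih => exact .step hv hr hH ih

theorem Supp.ne {s0 s : St X V} (h0 : Le s0 s) {x} (h : G.Supp s0 s x) : s x ≠ none := by
  cases h with
  | base h => exact h0.ne h
  | step hv _ _ _ => simp [hv]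

theorem En.mono {s s' : St X V} (h : Le s s') {x v} (he : G.En s x v) : G.En s' x v := by
  obtain ⟨H, hr, hH⟩ := he
  exact ⟨H, hr, fun k hk => h _ _ (hH k hk)⟩

theorem Reach.refl (s : St X V) : G.Reach s s := ⟨Le.refl s, fun _ h => .base h⟩

theorem Reach.trans {a b c : St X V} (h : G.Reach a b) (h' : G.Reach b c) : G.Reach a c :=
  ⟨h.1.trans h'.1, fun x hx => Supp.trans (fun y hy => (h.2 y hy).mono h'.1) (h'.2 x hx)⟩

theorem Reach.mid {a b c : St X V} (h : G.Reach a c) (hab : Le a b) (hbc : Le b c) :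
    G.Reach b c :=
  ⟨hbc, fun x hx => Supp.trans (fun _ hy => .base (hab.ne hy)) (h.2 x hx)⟩

theorem Reach.update {s : St X V} {x v} (hx : s x = none) (he : G.En s x v) :
    G.Reach s (Function.update s x (some v)) := by
  have hle : Le s (Function.update s x (some v)) := by
    intro y w hy
    by_cases h : y = x
    · subst h; rw [hx] at hy; cases hy
    · rw [Function.update_of_ne h]; exact hy
  refine ⟨hle, fun y hy => ?_⟩
  by_cases h : y = x
  · subst h
    obtain ⟨H, hr, hH⟩ := he
    exact .step (by simp) hr (fun k hk => hle _ _ (hH k hk))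
      (fun k hk => .base (by rw [hH k hk]; simp))
  · rw [Function.update_of_ne h] at hy; exact .base hy

theorem Term.eq_of_reach {s s' : St X V} (ht : G.Term s) (h : G.Reach s s') : s' = s := by
  symm
  refine h.1.antisymm (fun x hx => ?_)
  have := h.2 x hx
  clear hx
  induction this with
  | base h => exact h
  | @step x v H hv hr hH _ ih =>
    intro hc
    exact ht x v hc ⟨H, hr, fun k hk => h.1.eq_of (hH k hk) (ih k hk)⟩

end GS

/-- union of a sequence of states -/
def seqUnion (f : ℕ → St X V) : St X V :=
  fun x => if h : ∃ n, f n x ≠ none then f (Classical.choose h) x else none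

theorem seqUnion_spec {f : ℕ → St X V} (hf : ∀ n, Le (f n) (f (n+1))) (x v) :
    seqUnion f x = some v ↔ ∃ n, f n x = some v := by
  have hm : ∀ n k, Le (f n) (f (n+k)) := by
    intro n k
    induction k with
    | zero => exact Le.refl _
    | succ k ih => exact ih.trans (hf _)
  unfold seqUnion
  constructor
  · intro h
    split_ifs at h with hc
    exact ⟨_, h⟩
  · rintro ⟨n, hn⟩
    have hc : ∃ n, f n x ≠ none := ⟨n, by simp [hn]⟩
    rw [dif_pos hc]
    obtain ⟨w, hw⟩ := Option.ne_none_iff_exists'.1 (Classical.choose_spec hc)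
    rw [hw]
    have h1 := hm n (Classical.choose hc) x v hn
    have h2 := hm (Classical.choose hc) n x w hw
    rw [add_comm] at h2
    rw [h1] at h2
    exact h2.symm

theorem seq_le {f : ℕ → St X V} (hf : ∀ n, Le (f n) (f (n+1))) {n m} (h : n ≤ m) :
    Le (f n) (f m) := by
  induction h with
  | refl => exact Le.refl _
  | step _ ih => exact ih.trans (hf _)

theorem seq_finset {f : ℕ → St X V} (hf : ∀ n, Le (f n) (f (n+1))) (H : Finset (X × V))
    (hH : ∀ h ∈ H, ∃ n, f n h.1 = some h.2) : ∃ n, ∀ h ∈ H, f n h.1 = some h.2 := by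
  induction H using Finset.induction_on with
  | empty => exact ⟨0, by simp⟩
  | insert a H ha ih =>
    obtain ⟨n, hn⟩ := ih (fun h hh => hH h (Finset.mem_insert_of_mem hh))
    obtain ⟨k, hk⟩ := hH a (Finset.mem_insert_self _ _)
    refine ⟨max n k, fun h hh => ?_⟩
    rcases Finset.mem_insert.1 hh with rfl | hh
    · exact seq_le hf (le_max_right _ _) _ _ hk
    · exact seq_le hf (le_max_left _ _) _ _ (hn h hh)

namespace GS
variable (G : GS X V)

/-- greedy sequence -/
def greedy (allowed : X → V → Prop) (e : ℕ → X) (s : St X V) : ℕ → St X V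
  | 0 => s
  | n+1 =>
    let f := greedy allowed e s n
    if h : f (e n) = none ∧ ∃ v, G.En f (e n) v ∧ allowed (e n) v then
      Function.update f (e n) (some (Classical.choose h.2))
    else f

theorem greedy_step (allowed : X → V → Prop) (e : ℕ → X) (s : St X V) (n : ℕ) :
    G.greedy allowed e s (n+1) = G.greedy allowed e s n ∨
    ∃ x v, G.greedy allowed e s n x = none ∧ G.En (G.greedy allowed e s n) x v ∧ allowed x v ∧
      G.greedy allowed e s (n+1) = Function.update (G.greedy allowed e s n) x (some v) := by
  by_cases h : G.greedy allowed e s n (e n) = none ∧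
      ∃ v, G.En (G.greedy allowed e s n) (e n) v ∧ allowed (e n) v
  · right
    exact ⟨e n, Classical.choose h.2, h.1, (Classical.choose_spec h.2).1,
      (Classical.choose_spec h.2).2, by rw [greedy]; simp only [dif_pos h]⟩
  · left; rw [greedy]; simp only [dif_neg h]

theorem greedy_reach (allowed : X → V → Prop) (e : ℕ → X) (s : St X V) (n : ℕ) :
    G.Reach (G.greedy allowed e s n) (G.greedy allowed e s (n+1)) := by
  rcases G.greedy_step allowed e s n with h | ⟨x, v, h1, h2, _, h4⟩
  · rw [h]; exact Reach.refl _
  · rw [h4]; exact Reach.update h1 h2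

theorem reach_seqUnion {f : ℕ → St X V} (hf : ∀ n, G.Reach (f n) (f (n+1))) :
    G.Reach (f 0) (seqUnion f) := by
  have hle := fun n => (hf n).1
  have h0 : ∀ n, G.Reach (f 0) (f n) := by
    intro n
    induction n with
    | zero => exact Reach.refl _
    | succ n ih => exact ih.trans (hf n)
  have hl : ∀ n, Le (f n) (seqUnion f) := fun n x v h => (seqUnion_spec hle x v).2 ⟨n, h⟩
  refine ⟨hl 0, fun x hx => ?_⟩
  obtain ⟨v, hv⟩ := Option.ne_none_iff_exists'.1 hx
  obtain ⟨n, hn⟩ := (seqUnion_spec hle x v).1 hv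
  exact ((h0 n).2 x (by simp [hn])).mono (hl n)

theorem greedy_closed (allowed : X → V → Prop) (e : ℕ → X) (s : St X V)
    (he : ∀ x N, ∃ n, N ≤ n ∧ e n = x) {x v}
    (hx : seqUnion (G.greedy allowed e s) x = none)
    (hen : G.En (seqUnion (G.greedy allowed e s)) x v) : ¬ allowed x v := by
  intro hal
  have hle := fun n => (G.greedy_reach allowed e s n).1
  obtain ⟨H, hr, hH⟩ := hen
  obtain ⟨N, hN⟩ := seq_finset hle H (fun h hh => (seqUnion_spec hle _ _).1 (hH h hh))
  obtain ⟨n, hn, hex⟩ := he x N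
  have hno : ∀ k, G.greedy allowed e s k x = none := by
    intro k
    by_contra hc
    obtain ⟨w, hw⟩ := Option.ne_none_iff_exists'.1 hc
    rw [(seqUnion_spec hle x w).2 ⟨k, hw⟩] at hx
    cases hx
  have hc : G.greedy allowed e s n (e n) = none ∧
      ∃ v, G.En (G.greedy allowed e s n) (e n) v ∧ allowed (e n) v := by
    rw [hex]
    exact ⟨hno n, v, ⟨H, hr, fun h hh => seq_le hle hn _ _ (hN h hh)⟩, hal⟩
  have := hno (n+1)
  rw [greedy] at this
  simp only [dif_pos hc] at this
  have h2 := Function.update_self (e n) (some (Classical.choose hc.2)) (G.greedy allowed e s n)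
  rw [← hex] at this
  rw [h2] at this
  simp at this

theorem exists_enum (X : Type) [Countable X] [Nonempty X] :
    ∃ e : ℕ → X, ∀ x N, ∃ n, N ≤ n ∧ e n = x := by
  obtain ⟨g, hg⟩ := exists_surjective_nat X
  refine ⟨fun n => g (Nat.unpair n).1, fun x N => ?_⟩
  obtain ⟨k, rfl⟩ := hg x
  exact ⟨Nat.pair k N, Nat.right_le_pair _ _, by simp⟩

theorem exists_sat [Countable X] [Nonempty X] (s : St X V) : ∃ s', G.Reach s s' ∧ G.Term s' := by
  obtain ⟨e, he⟩ := exists_enum X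
  exact ⟨_, G.reach_seqUnion (G.greedy_reach (fun _ _ => True) e s),
    fun x v hx hen => G.greedy_closed (fun _ _ => True) e s he hx hen trivial⟩

theorem exists_seq [Countable X] [Nonempty X] {s s' : St X V} (h : G.Reach s s') :
    ∃ f : ℕ → St X V, f 0 = s ∧ (∀ n, f n = f (n+1) ∨ ∃ x v, f n x = none ∧ G.En (f n) x v ∧
      f (n+1) = Function.update (f n) x (some v)) ∧ seqUnion f = s' ∧ ∀ n, Le (f n) (f (n+1)) := by
  obtain ⟨e, he⟩ := exists_enum X
  let al : X → V → Prop := fun x v => s' x = some v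
  have hle := fun n => (G.greedy_reach al e s n).1
  refine ⟨G.greedy al e s, rfl, fun n => ?_, ?_, hle⟩
  · rcases G.greedy_step al e s n with h | ⟨x, v, h1, h2, _, h4⟩
    · exact .inl h.symm
    · exact .inr ⟨x, v, h1, h2, h4⟩
  · have h1 : ∀ n, Le (G.greedy al e s n) s' := by
      intro n
      induction n with
      | zero => exact h.1
      | succ n ih =>
        rcases G.greedy_step al e s n with h | ⟨x, v, _, _, h3, h4⟩
        · rw [h]; exact ih
        · rw [h4]
          intro y w hy
          by_cases hyx : y = x
          · subst hyx
            rw [Function.update_self] at hy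
            cases hy
            exact h3
          · rw [Function.update_of_ne hyx] at hy; exact ih _ _ hy
    have h2 : Le (seqUnion (G.greedy al e s)) s' := by
      intro x v hx
      obtain ⟨n, hn⟩ := (seqUnion_spec hle x v).1 hx
      exact h1 n x v hn
    refine h2.antisymm (fun x hx => ?_)
    have := h.2 x hx
    clear hx
    induction this with
    | @base x h =>
      obtain ⟨w, hw⟩ := Option.ne_none_iff_exists'.1 h
      rw [(seqUnion_spec hle x w).2 ⟨0, hw⟩]
      simp
    | @step x v H hv hr hH _ ih =>
      intro hc
      exact G.greedy_closed al e s he hc ⟨H, hr, fun k hk => h2.eq_of (hH k hk) (ih k hk)⟩ hv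

end GS

/-! ## TAS as growth systems -/
section TASGS
variable {d : ℕ}

theorem bond_symm (t t' : TileType d) (p q : Pt d) : bond t t' p q = bond t' t q p := by
  unfold bond
  refine Finset.sum_congr rfl (fun i _ => ?_)
  rw [add_comm]
  congr 1
  · by_cases h : p = Function.update q i (q i + 1) ∧ (t i).2 = (t' i).1 ∧ 0 < (t i).2.2
    · rw [if_pos h, if_pos ⟨h.1, h.2.1.symm, by rw [← h.2.1]; exact h.2.2⟩, h.2.1]
    · rw [if_neg h, if_neg]
      rintro ⟨a, b, c⟩
      exact h ⟨a, b.symm, by rw [← b]; exact c⟩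
  · by_cases h : q = Function.update p i (p i + 1) ∧ (t i).1 = (t' i).2 ∧ 0 < (t i).1.2
    · rw [if_pos h, if_pos ⟨h.1, h.2.1.symm, by rw [← h.2.1]; exact h.2.2⟩, h.2.1]
    · rw [if_neg h, if_neg]
      rintro ⟨a, b, c⟩
      exact h ⟨a, b.symm, by rw [← b]; exact c⟩

/-- growth system of a tile set at a temperature -/
def tgs (Ts : Finset (TileType d)) (τ : ℕ) : GS (Pt d) (TileType d) where
  rule p t H := t ∈ Ts ∧ τ ≤ ∑ h ∈ H, bond t h.2 p h.1

theorem bondAt_mono {α β : Config d} (h : Le α β) (p q) : bondAt α p q ≤ bondAt β p q := by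
  unfold bondAt
  cases hp : α p with
  | none => simp
  | some t =>
    cases hq : α q with
    | none => simp
    | some t' => simp [h _ _ hp, h _ _ hq]

theorem bondAt_some {α : Config d} {p q t t'} (hp : α p = some t) (hq : α q = some t') :
    bondAt α p q = bond t t' p q := by
  simp [bondAt, hp, hq]

theorem bondAt_symm (α : Config d) (p q) : bondAt α p q = bondAt α q p := by
  unfold bondAt
  cases hp : α p <;> cases hq : α q <;> simp [bond_symm]

theorem le_update {α : Config d} {p} (hp : α p = none) (v) : Le α (Function.update α p v) := by
  intro y w hy
  by_cases h : y = p
  · subst h; rw [hp] at hy; cases hy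
  · rw [Function.update_of_ne h]; exact hy

theorem dom_update (α : Config d) (p t) : dom (Function.update α p (some t)) = insert p (dom α) := by
  ext y
  by_cases h : y = p
  · subst h; simp [dom]
  · simp [dom, h]

theorem stable_update {τ : ℕ} {α : Config d} (hne : (dom α).Nonempty) (hst : Stable τ α)
    {p t} {Ts : Finset (TileType d)} (ht : t ∈ Ts) (hp : α p = none) :
    Stable τ (Function.update α p (some t)) ↔ (tgs Ts τ).En α p t := by
  have hpd : p ∉ dom α := by simp [dom, hp]
  constructor
  · intro h
    obtain ⟨F, hF, hs⟩ := h {p} (dom α) ⟨p, rfl⟩ hne (by simpa using hpd)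
      (by rw [dom_update]; rfl)
    let g : Pt d × Pt d → Pt d × TileType d := fun e => (e.2, (α e.2).getD t)
    have hval : ∀ e ∈ F, α e.2 = some ((α e.2).getD t) := by
      intro e he
      have := (hF e he).2
      obtain ⟨w, hw⟩ := Option.ne_none_iff_exists'.1 this
      rw [hw]; rfl
    refine ⟨F.image g, ⟨ht, ?_⟩, ?_⟩
    · rw [Finset.sum_image]
      · refine hs.trans (le_of_eq (Finset.sum_congr rfl (fun e he => ?_)))
        have h1 : e.1 = p := (hF e he).1
        rw [bondAt_some (t := t) (t' := (α e.2).getD t)]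
        · simp only [g]; rw [h1]
        · rw [h1]; simp
        · rw [Function.update_of_ne]
          · exact hval e he
          · rintro h2
            apply hpd; rw [← h2]; exact (hF e he).2
      · intro e he e' he' heq
        have h1 : e.1 = p := (hF e he).1
        have h2 : e'.1 = p := (hF e' he').1
        have h3 : e.2 = e'.2 := congrArg Prod.fst heq
        exact Prod.ext (h1.trans h2.symm) h3
    · intro h hh
      obtain ⟨e, he, rfl⟩ := Finset.mem_image.1 hh
      exact hval e he
  · rintro ⟨H, ⟨_, hs⟩, hH⟩
    have hHp : ∀ h ∈ H, h.1 ≠ p := by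
      intro h hh hc
      have := hH h hh
      rw [hc, hp] at this; cases this
    have hinj : ∀ h ∈ H, ∀ h' ∈ H, h.1 = h'.1 → h = h' := by
      intro h hh h' hh' he
      have h1 := hH h hh
      have h2 := hH h' hh'
      rw [he, h2] at h1
      exact Prod.ext he (Option.some.inj h1).symm
    have hle := le_update hp (some t)
    have key : ∑ h ∈ H, bond t h.2 p h.1 =
        ∑ h ∈ H, bondAt (Function.update α p (some t)) p h.1 := by
      refine Finset.sum_congr rfl (fun h hh => ?_)
      rw [bondAt_some (t := t) (t' := h.2) (by simp)]
      exact hle _ _ (hH h hh)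
    have hmem : ∀ h ∈ H, h.1 ∈ dom α := by
      intro h hh; simp [dom, hH h hh]
    intro A B hA hB hdis hun
    rw [dom_update] at hun
    have main : ∀ A B : Set (Pt d), A.Nonempty → B.Nonempty → Disjoint A B →
        A ∪ B = insert p (dom α) → p ∈ A → ∃ F : Finset (Pt d × Pt d),
        (∀ e ∈ F, e.1 ∈ A ∧ e.2 ∈ B) ∧
        τ ≤ ∑ e ∈ F, bondAt (Function.update α p (some t)) e.1 e.2 := by
      intro A B hA hB hdis hun hpA
      have hpB : p ∉ B := fun h => (Set.disjoint_left.1 hdis) hpA h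
      by_cases hA' : (A \ {p}).Nonempty
      · obtain ⟨F, hF, hs'⟩ := hst (A \ {p}) B hA' hB
          (hdis.mono_left Set.sdiff_subset) (by
            ext y
            constructor
            · rintro (⟨hy, hy'⟩ | hy)
              · have : y ∈ A ∪ B := Or.inl hy
                rw [hun] at this
                rcases this with rfl | h
                · exact absurd rfl hy'
                · exact h
              · have : y ∈ A ∪ B := Or.inr hy
                rw [hun] at this
                rcases this with rfl | h
                · exact absurd hy hpB
                · exact h
            · intro hy
              have : y ∈ A ∪ B := by rw [hun]; exact Or.inr hy
              rcases this with h | h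
              · exact Or.inl ⟨h, fun hc => hpd (by rw [← (hc : y = p)]; exact hy)⟩
              · exact Or.inr h)
        exact ⟨F, fun e he => ⟨(hF e he).1.1, (hF e he).2⟩,
          hs'.trans (Finset.sum_le_sum (fun e _ => bondAt_mono hle _ _))⟩
      · have hAp : ∀ y ∈ A, y = p := by
          intro y hy
          by_contra hc
          exact hA' ⟨y, hy, hc⟩
        refine ⟨H.image (fun h => (p, h.1)), ?_, ?_⟩
        · intro e he
          obtain ⟨h, hh, rfl⟩ := Finset.mem_image.1 he
          refine ⟨hpA, ?_⟩
          have : h.1 ∈ A ∪ B := by rw [hun]; exact Or.inr (hmem h hh)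
          rcases this with h' | h'
          · exact absurd (hAp _ h') (hHp h hh)
          · exact h'
        · rw [Finset.sum_image (fun h hh h' hh' heq =>
            hinj h hh h' hh' (congrArg Prod.snd heq)), ← key]
          exact hs
    have hpu : p ∈ A ∪ B := by rw [hun]; exact Or.inl rfl
    rcases hpu with hpA | hpB
    · exact main A B hA hB hdis hun hpA
    · obtain ⟨F, hF, hs'⟩ := main B A hB hA hdis.symm (by rw [Set.union_comm]; exact hun) hpB
      refine ⟨F.image Prod.swap, ?_, ?_⟩
      · intro e he
        obtain ⟨e', he', rfl⟩ := Finset.mem_image.1 he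
        exact ⟨(hF e' he').2, (hF e' he').1⟩
      · rw [Finset.sum_image (fun _ _ _ _ h => Prod.swap_injective h)]
        refine hs'.trans (le_of_eq (Finset.sum_congr rfl (fun e _ => ?_)))
        exact bondAt_symm _ _ _

theorem dom_nonempty_mono {α β : Config d} (h : Le α β) (hα : (dom α).Nonempty) :
    (dom β).Nonempty := by
  obtain ⟨p, hp⟩ := hα
  exact ⟨p, h.ne hp⟩

theorem attach_iff (T : TAS d) {α β : Config d} (hne : (dom α).Nonempty) (hst : Stable T.temp α) :
    Attach T α β ↔ ∃ p t, α p = none ∧ (tgs T.tileset T.temp).En α p t ∧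
      β = Function.update α p (some t) := by
  constructor
  · rintro ⟨p, t, hp, ht, rfl, hs⟩
    have hp' : α p = none := by simpa [dom] using hp
    exact ⟨p, t, hp', (stable_update hne hst ht hp').1 hs, rfl⟩
  · rintro ⟨p, t, hp, hen, rfl⟩
    have ht : t ∈ T.tileset := by obtain ⟨H, hr, _⟩ := hen; exact hr.1
    exact ⟨p, t, by simp [dom, hp], ht, rfl, (stable_update hne hst ht hp).2 hen⟩

theorem term_iff (T : TAS d) {α : Config d} (hne : (dom α).Nonempty) (hst : Stable T.temp α) :
    Terminal (Attach T) α ↔ (tgs T.tileset T.temp).Term α := by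
  constructor
  · intro h p t hp hen
    exact h _ ((attach_iff T hne hst).2 ⟨p, t, hp, hen, rfl⟩)
  · intro h β hβ
    obtain ⟨p, t, hp, hen, _⟩ := (attach_iff T hne hst).1 hβ
    exact h p t hp hen

theorem limit_eq {f : ℕ → Config d} {β} (hf : ∀ n, Le (f n) (f (n+1))) (h : Limit f β) :
    β = seqUnion f := by
  funext x
  apply Option.ext
  intro v
  exact (h x v).trans (seqUnion_spec hf x v).symm

theorem stable_seqUnion {τ} {f : ℕ → Config d} (hf : ∀ n, Le (f n) (f (n+1)))
    (hst : ∀ n, Stable τ (f n)) : Stable τ (seqUnion f) := by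
  intro A B ⟨a, ha⟩ ⟨b, hb⟩ hdis hun
  have hl : ∀ n, Le (f n) (seqUnion f) := fun n x v h => (seqUnion_spec hf x v).2 ⟨n, h⟩
  have hex : ∀ x ∈ A ∪ B, ∃ n, f n x ≠ none := by
    intro x hx
    rw [hun] at hx
    obtain ⟨v, hv⟩ := Option.ne_none_iff_exists'.1 hx
    obtain ⟨n, hn⟩ := (seqUnion_spec hf x v).1 hv
    exact ⟨n, by simp [hn]⟩
  obtain ⟨n, hn⟩ := hex a (Or.inl ha)
  obtain ⟨k, hk⟩ := hex b (Or.inr hb)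
  let N := max n k
  obtain ⟨F, hF, hs⟩ := hst N (A ∩ dom (f N)) (B ∩ dom (f N))
    ⟨a, ha, (seq_le hf (le_max_left n k)).ne hn⟩
    ⟨b, hb, (seq_le hf (le_max_right n k)).ne hk⟩
    (hdis.mono Set.inter_subset_left Set.inter_subset_left)
    (by
      rw [← Set.union_inter_distrib_right, hun]
      exact Set.inter_eq_right.2 (fun x hx => (hl N).ne hx))
  exact ⟨F, fun e he => ⟨(hF e he).1.1, (hF e he).2.1⟩,
    hs.trans (Finset.sum_le_sum (fun e _ => bondAt_mono (hl N) _ _))⟩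

theorem produces_iff (T : TAS d) {α β : Config d} (hne : (dom α).Nonempty)
    (hst : Stable T.temp α) :
    ProducesFrom (Attach T) α β ↔ (tgs T.tileset T.temp).Reach α β := by
  constructor
  · rintro ⟨f, rfl, hc, hl⟩
    have key : ∀ n, (dom (f n)).Nonempty ∧ Stable T.temp (f n) := by
      intro n
      induction n with
      | zero => exact ⟨hne, hst⟩
      | succ n ih =>
        rcases hc n with h | h
        · rw [← h]; exact ih
        · obtain ⟨p, t, hp, ht, he, hs⟩ := h
          refine ⟨?_, hs⟩
          rw [he, dom_update]; exact Set.insert_nonempty _ _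
    have hstep : ∀ n, (tgs T.tileset T.temp).Reach (f n) (f (n+1)) := by
      intro n
      rcases hc n with h | h
      · rw [← h]; exact GS.Reach.refl _
      · obtain ⟨p, t, hp, hen, he⟩ := (attach_iff T (key n).1 (key n).2).1 h
        rw [he]; convert GS.Reach.update hp hen
    rw [limit_eq (fun n => (hstep n).1) hl]
    exact GS.reach_seqUnion _ hstep
  · intro h
    have : Nonempty (Pt d) := ⟨fun _ => 0⟩
    obtain ⟨f, h0, hs, hu, hle⟩ := GS.exists_seq _ h
    have key : ∀ n, (dom (f n)).Nonempty ∧ Stable T.temp (f n) := by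
      intro n
      induction n with
      | zero => rw [h0]; exact ⟨hne, hst⟩
      | succ n ih =>
        rcases hs n with h | ⟨p, t, hp, hen, he⟩
        · rw [← h]; exact ih
        · have := (attach_iff T ih.1 ih.2 (β := f (n+1))).2 ⟨p, t, hp, hen, by convert he⟩
          obtain ⟨p, t, hp, ht, he, hs⟩ := this
          refine ⟨?_, hs⟩
          rw [he, dom_update]; exact Set.insert_nonempty _ _
    refine ⟨f, h0, fun n => ?_, ?_⟩
    · rcases hs n with h | ⟨p, t, hp, hen, he⟩
      · exact .inl h
      · exact .inr ((attach_iff T (key n).1 (key n).2).2 ⟨p, t, hp, hen, by convert he⟩)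
    · intro p t
      rw [← hu]
      exact seqUnion_spec hle p t

theorem reach_stable (T : TAS d) {α β : Config d} (hne : (dom α).Nonempty)
    (hst : Stable T.temp α) (h : (tgs T.tileset T.temp).Reach α β) : Stable T.temp β := by
  obtain ⟨f, h0, hc, hl⟩ := (produces_iff T hne hst).2 h
  subst h0
  have key : ∀ n, Stable T.temp (f n) ∧ Le (f n) (f (n+1)) := by
    intro n
    induction n with
    | zero =>
      refine ⟨hst, ?_⟩
      rcases hc 0 with h | ⟨p, t, hp, ht, he, hs⟩
      · rw [← h]; exact Le.refl _
      · rw [he]; exact le_update (by simpa [dom] using hp) _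
    | succ n ih =>
      refine ⟨?_, ?_⟩
      · rcases hc n with h | ⟨p, t, hp, ht, he, hs⟩
        · rw [← h]; exact ih.1
        · exact hs
      · rcases hc (n+1) with h | ⟨p, t, hp, ht, he, hs⟩
        · rw [← h]; exact Le.refl _
        · rw [he]; exact le_update (by simpa [dom] using hp) _
  rw [limit_eq (fun n => (key n).2) hl]
  exact stable_seqUnion (fun n => (key n).2) (fun n => (key n).1)

end TASGS
end IU

namespace IU

/-! ## Directions -/

abbrev Dir := Fin 3 × Bool

def sg (b : Bool) : ℤ := if b then 1 else -1

def dv (δ : Dir) : Pt 3 := fun i => if i = δ.1 then sg δ.2 else 0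

def opp (δ : Dir) : Dir := (δ.1, !δ.2)

@[simp] theorem opp_opp (δ : Dir) : opp (opp δ) = δ := by simp [opp]
theorem opp_ne (δ : Dir) : opp δ ≠ δ := by
  intro h
  have := congrArg Prod.snd h
  simp [opp] at this
theorem dv_opp (δ : Dir) : dv (opp δ) = - dv δ := by
  funext i
  rcases δ with ⟨a, b⟩
  cases b <;> by_cases h : i = a <;> simp [dv, opp, sg, h]

theorem dv_inj {δ δ' : Dir} (h : dv δ = dv δ') : δ = δ' := by
  rcases δ with ⟨a, b⟩
  rcases δ' with ⟨a', b'⟩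
  have h1 := congrFun h a
  by_cases ha : a = a'
  · subst ha
    cases b <;> cases b' <;> simp [dv, sg] at h1 ⊢
  · simp only [dv, if_true, if_neg ha] at h1
    cases b <;> simp [sg] at h1

theorem dv_ne_zero (δ : Dir) : dv δ ≠ 0 := by
  intro h
  have := congrFun h δ.1
  rcases δ with ⟨a, b⟩
  cases b <;> simp [dv, sg] at this

def face (t : TileType 3) (δ : Dir) : Glue := if δ.2 then (t δ.1).1 else (t δ.1).2

theorem upd_eq (p : Pt 3) (i : Fin 3) : Function.update p i (p i + 1) = p + dv (i, true) := by
  funext j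
  by_cases h : j = i
  · subst h; simp [dv, sg]
  · simp [dv, h]

theorem bond_eq_sum (t t' : TileType 3) (p q : Pt 3) :
    bond t t' p q = ∑ δ : Dir, if q = p + dv δ ∧ face t δ = face t' (opp δ) ∧ 0 < (face t δ).2
      then (face t δ).2 else 0 := by
  unfold bond
  rw [Fintype.sum_prod_type]
  refine Finset.sum_congr rfl (fun i _ => ?_)
  rw [Fintype.sum_bool, upd_eq, upd_eq]
  congr 1
  have : p = q + dv (i, true) ↔ q = p + dv (i, false) := by
    have h1 : dv (i, false) = - dv (i, true) := dv_opp (i, true)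
    rw [h1]
    constructor
    · rintro rfl; abel
    · rintro rfl; abel
  by_cases hp : p = q + dv (i, true)
  · have hq := this.1 hp
    by_cases hr : (t i).2 = (t' i).1 ∧ 0 < (t i).2.2
    · rw [if_pos ⟨hp, hr⟩]
      exact (if_pos (⟨hq, hr⟩ : q = p + dv (i, false) ∧ face t (i, false) =
        face t' (opp (i, false)) ∧ 0 < (face t (i, false)).2)).symm
    · rw [if_neg (fun h => hr h.2)]
      exact (if_neg (fun h : q = p + dv (i, false) ∧ face t (i, false) =
        face t' (opp (i, false)) ∧ 0 < (face t (i, false)).2 => hr h.2)).symm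
  · have hq : ¬ q = p + dv (i, false) := fun h => hp (this.2 h)
    rw [if_neg (fun h => hp h.1), if_neg (fun h => hq h.1)]

theorem bond_dir (t t' : TileType 3) (p : Pt 3) (δ : Dir) :
    bond t t' p (p + dv δ) = if face t δ = face t' (opp δ) then (face t δ).2 else 0 := by
  rw [bond_eq_sum, Finset.sum_eq_single δ]
  · by_cases h : face t δ = face t' (opp δ)
    · by_cases h2 : 0 < (face t δ).2
      · rw [if_pos ⟨rfl, h, h2⟩, if_pos h]
      · rw [if_neg (fun hc => h2 hc.2.2), if_pos h]; omega
    · rw [if_neg (fun hc => h hc.2.1), if_neg h]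
  · intro δ' _ hne
    rw [if_neg]
    rintro ⟨h, _⟩
    exact hne (dv_inj (add_left_cancel h)).symm
  · simp

theorem bond_ne_zero {t t' : TileType 3} {p q : Pt 3} (h : bond t t' p q ≠ 0) :
    ∃ δ, q = p + dv δ ∧ face t δ = face t' (opp δ) ∧ 0 < (face t δ).2 := by
  rw [bond_eq_sum] at h
  obtain ⟨δ, _, hδ⟩ := Finset.exists_ne_zero_of_sum_ne_zero h
  refine ⟨δ, ?_⟩
  by_contra hc
  exact hδ (if_neg hc)

theorem adj_dv (p : Pt 3) (δ : Dir) : adj p (p + dv δ) := by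
  rcases δ with ⟨a, b⟩
  fin_cases a <;> cases b <;> simp [adj, dv, sg, Fin.sum_univ_three]

theorem exists_dv_of_adj {p q : Pt 3} (h : adj p q) : ∃ δ, q = p + dv δ := by
  unfold adj at h
  rw [Fin.sum_univ_three] at h
  have h0 := abs_nonneg (p 0 - q 0)
  have h1 := abs_nonneg (p 1 - q 1)
  have h2 := abs_nonneg (p 2 - q 2)
  have key : ∀ a b : ℤ, |a - b| = 0 → b = a := fun a b h => by
    have := abs_eq_zero.1 h; omega
  have key1 : ∀ a b : ℤ, |a - b| = 1 → b = a + 1 ∨ b = a - 1 := fun a b h => by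
    rcases (abs_eq (by norm_num)).1 h with h | h <;> omega
  have hc : (|p 0 - q 0| = 1 ∧ |p 1 - q 1| = 0 ∧ |p 2 - q 2| = 0) ∨
      (|p 0 - q 0| = 0 ∧ |p 1 - q 1| = 1 ∧ |p 2 - q 2| = 0) ∨
      (|p 0 - q 0| = 0 ∧ |p 1 - q 1| = 0 ∧ |p 2 - q 2| = 1) := by omega
  rcases hc with ⟨a, b, c⟩ | ⟨a, b, c⟩ | ⟨a, b, c⟩
  · rcases key1 _ _ a with a | a
    · exact ⟨(0, true), by funext i; fin_cases i <;> simp [dv, sg, a, key _ _ b, key _ _ c]⟩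
    · exact ⟨(0, false), by funext i; fin_cases i <;> simp [dv, sg, a, key _ _ b, key _ _ c]; ring⟩
  · rcases key1 _ _ b with b | b
    · exact ⟨(1, true), by funext i; fin_cases i <;> simp [dv, sg, b, key _ _ a, key _ _ c]⟩
    · exact ⟨(1, false), by funext i; fin_cases i <;> simp [dv, sg, b, key _ _ a, key _ _ c]; ring⟩
  · rcases key1 _ _ c with c | c
    · exact ⟨(2, true), by funext i; fin_cases i <;> simp [dv, sg, c, key _ _ b, key _ _ a]⟩
    · exact ⟨(2, false), by funext i; fin_cases i <;> simp [dv, sg, c, key _ _ b, key _ _ a]; ring⟩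

/-! ## Local rule systems -/

structure LRS (F Rl Q : Type) where
  f1 : Rl → F
  f2 : Rl → F
  tgt : Rl → F
  off : Rl → Option Dir
  rel : Rl → Q → Q → Q → Prop
  iF : F → ℕ
  iR : Rl → ℕ
  iF_inj : Function.Injective iF
  iR_inj : Function.Injective iR
  iF_lt : ∀ f, iF f < 100
  iR_lt : ∀ r, iR r < 500

def ov : Option Dir → Pt 3
  | none => 0
  | some δ => dv δ

variable {F Rl Q : Type} (S : LRS F Rl Q)

namespace LRS

def fb (r : Rl) (b : Bool) : F := if b then S.f2 r else S.f1 r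

def gs : GS (Pt 3 × F) Q where
  rule x q H := ∃ r p a b, x = (p + ov (S.off r), S.tgt r) ∧ S.rel r a b q ∧
    H = {((p, S.f1 r), a), ((p, S.f2 r), b)}

/-! ### Geometry -/

def pX (f : F) : ℕ := 3 * S.iF f + 2
def pW (r : Rl) : ℕ := 3 * S.iR r + 3
def pD (r : Rl) : ℕ := 402 + 2 * S.iR r

end LRS

def mk3 (u v w : ℤ) : Pt 3 := ![u, v, w]

abbrev Seg := Dir × ℕ

def wpos : List Seg → ℕ → Pt 3 → Pt 3
  | [], _, z => z
  | (δ, n) :: l, j, z => if j ≤ n then z + (j : ℤ) • dv δ else wpos l (j - n) (z + (n : ℤ) • dv δ)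

def wlen : List Seg → ℕ
  | [] => 0
  | (_, n) :: l => n + wlen l

theorem wpos_zero (l : List Seg) (z : Pt 3) : wpos l 0 z = z := by
  cases l with
  | nil => rfl
  | cons a l => simp [wpos]

theorem wpos_succ (l : List Seg) : ∀ (j : ℕ) (z : Pt 3), j < wlen l →
    ∃ δ, wpos l (j+1) z = wpos l j z + dv δ := by
  induction l with
  | nil => intro j z h; simp [wlen] at h
  | cons a l ih =>
    intro j z h
    obtain ⟨δ, n⟩ := a
    simp only [wlen] at h
    simp only [wpos]
    by_cases h1 : j + 1 ≤ n
    · rw [if_pos h1, if_pos (by omega)]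
      refine ⟨δ, ?_⟩
      push_cast
      rw [add_smul, one_smul, add_assoc]
    · by_cases h2 : j ≤ n
      · have hj : j = n := by omega
        subst hj
        rw [if_neg h1, if_pos h2]
        have : j + 1 - j = 0 + 1 := by omega
        rw [this]
        obtain ⟨δ', h'⟩ := ih 0 (z + (j : ℤ) • dv δ) (by omega)
        rw [wpos_zero] at h'
        exact ⟨δ', h'⟩
      · rw [if_neg h1, if_neg h2]
        have : j + 1 - n = (j - n) + 1 := by omega
        rw [this]
        exact ih _ _ (by omega)

/-- the route from a gate to the arms; `X` is the column of the target bus -/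
def route (X D : ℕ) : Option Dir → List Seg
  | none => [((1, false), 3), ((0, false), 399 - X), ((1, true), 1)]
  | some (0, true) => [((1, false), 3), ((0, true), 3601 + X), ((1, true), 1)]
  | some (0, false) => [((1, true), 1), ((0, false), 3999), ((1, false), 4), ((0, false), 400 - X),
      ((1, true), 1)]
  | some (1, true) => [((1, true), 3997), ((0, false), 399 - X), ((1, true), 1)]
  | some (1, false) => [((1, false), 3999), ((0, false), 1), ((1, false), 4), ((0, false), 398 - X),
      ((1, true), 1)]
  | some (2, b) => [((1, true), 1), ((0, true), D - 400), ((1, true), 1), ((2, b), 3999),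
      ((0, true), 1), ((2, b), 1), ((1, false), 5), ((0, false), D - X), ((1, true), 1)]

inductive Nd (F Rl : Type)
  | bus (f : F) (w : ℕ)
  | off (f : F)
  | tr (f : F) (w : ℕ)
  | pr (r : Rl) (b : Bool) (u : ℕ)
  | gate (r : Rl)
  | out (r : Rl) (j : ℕ)
  | arm (r : Rl) (b : Bool)
  | rod (u v w : ℕ)

namespace LRS

def rt (r : Rl) : List Seg := route (S.pX (S.tgt r)) (S.pD r) (S.off r)

def len (r : Rl) : ℕ := wlen (S.rt r)

def fin (r : Rl) : Pt 3 := mk3 (S.pX (S.tgt r) + 1) 2 (S.pW r) + (4000 : ℤ) • ov (S.off r)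

def abs : Nd F Rl → Pt 3
  | .bus f w => mk3 (S.pX f) 3 w
  | .off f => mk3 (S.pX f + 1) 3 1
  | .tr f w => mk3 (S.pX f + 2) 3 w
  | .pr r b u => mk3 u 4 (if b then S.pW r + 1 else S.pW r - 1)
  | .gate r => mk3 400 4 (S.pW r)
  | .out r j => wpos (S.rt r) (j+1) (mk3 400 4 (S.pW r))
  | .arm r b => S.fin r + (if b then mk3 0 1 0 else mk3 (-1) 0 0)
  | .rod u v w => mk3 u v w

def ok : Nd F Rl → Prop
  | .bus _ w => 1 ≤ w ∧ w < 1600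
  | .off _ => True
  | .tr _ w => 1 ≤ w ∧ w < 1600
  | .pr r b u => S.pX (S.fb r b) + 2 ≤ u ∧ u ≤ 400
  | .gate _ => True
  | .out r j => j < S.len r
  | .arm _ _ => True
  | .rod u v w => u < 4000 ∧ v < 4000 ∧ w < 4000 ∧ ((w = 0 ∧ v ≤ 3) ∨ (u = 0 ∧ v = 0) ∨ (u = 0 ∧ w = 0))

def loc (n : Pt 3 × Nd F Rl) : Pt 3 := (4000 : ℤ) • n.1 + S.abs n.2

end LRS

end IU

namespace IU

theorem wpos_cons (δ : Dir) (n : ℕ) (l : List Seg) (j : ℕ) (z : Pt 3) :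
    wpos ((δ, n) :: l) j z =
      if j ≤ n then z + (j : ℤ) • dv δ else wpos l (j - n) (z + (n : ℤ) • dv δ) := rfl

/-- linear description of route cells -/
def cellSpec (X D : ℕ) (W : ℤ) (o : Option Dir) (j : ℕ) (u v w : ℤ) : Prop :=
  match o with
  | none => (j ≤ 3 ∧ u = 400 ∧ v = 4 - j ∧ w = W) ∨
      (3 < j ∧ j + X ≤ 402 ∧ u = 403 - j ∧ v = 1 ∧ w = W) ∨
      (j + X = 403 ∧ u = X + 1 ∧ v = 2 ∧ w = W)
  | some (0, true) => (j ≤ 3 ∧ u = 400 ∧ v = 4 - j ∧ w = W) ∨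
      (3 < j ∧ j ≤ 3604 + X ∧ u = 397 + j ∧ v = 1 ∧ w = W) ∨
      (j = 3605 + X ∧ u = 4001 + X ∧ v = 2 ∧ w = W)
  | some (0, false) => (j ≤ 1 ∧ u = 400 ∧ v = 4 + j ∧ w = W) ∨
      (1 < j ∧ j ≤ 4000 ∧ u = 401 - j ∧ v = 5 ∧ w = W) ∨
      (4000 < j ∧ j ≤ 4004 ∧ u = -3599 ∧ v = 4005 - j ∧ w = W) ∨
      (4004 < j ∧ j + X ≤ 4404 ∧ u = 405 - j ∧ v = 1 ∧ w = W) ∨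
      (j + X = 4405 ∧ u = X - 3999 ∧ v = 2 ∧ w = W)
  | some (1, true) => (j ≤ 3997 ∧ u = 400 ∧ v = 4 + j ∧ w = W) ∨
      (3997 < j ∧ j + X ≤ 4396 ∧ u = 4397 - j ∧ v = 4001 ∧ w = W) ∨
      (j + X = 4397 ∧ u = X + 1 ∧ v = 4002 ∧ w = W)
  | some (1, false) => (j ≤ 3999 ∧ u = 400 ∧ v = 4 - j ∧ w = W) ∨
      (j = 4000 ∧ u = 399 ∧ v = -3995 ∧ w = W) ∨
      (4000 < j ∧ j ≤ 4004 ∧ u = 399 ∧ v = 5 - j ∧ w = W) ∨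
      (4004 < j ∧ j + X ≤ 4402 ∧ u = 4403 - j ∧ v = -3999 ∧ w = W) ∨
      (j + X = 4403 ∧ u = X + 1 ∧ v = -3998 ∧ w = W)
  | some (2, b) => (j ≤ 1 ∧ u = 400 ∧ v = 4 + j ∧ w = W) ∨
      (1 < j ∧ j ≤ D - 399 ∧ u = 399 + j ∧ v = 5 ∧ w = W) ∨
      (j = D - 398 ∧ u = D ∧ v = 6 ∧ w = W) ∨
      (D - 398 < j ∧ j ≤ D + 3601 ∧ u = D ∧ v = 6 ∧
        ((b = true ∧ w = W + (j - (D - 398))) ∨ (b = false ∧ w = W - (j - (D - 398))))) ∨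
      (j = D + 3602 ∧ u = D + 1 ∧ v = 6 ∧
        ((b = true ∧ w = W + 3999) ∨ (b = false ∧ w = W - 3999))) ∨
      (D + 3602 < j ∧ j ≤ D + 3608 ∧ u = D + 1 ∧ v = 6 - (j - (D + 3603)) ∧
        ((b = true ∧ w = W + 4000) ∨ (b = false ∧ w = W - 4000))) ∨
      (D + 3608 < j ∧ j ≤ 2 * D + 3608 - X ∧ u = 2 * D + 3609 - j ∧ v = 1 ∧
        ((b = true ∧ w = W + 4000) ∨ (b = false ∧ w = W - 4000))) ∨
      (j = 2 * D + 3609 - X ∧ u = X + 1 ∧ v = 2 ∧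
        ((b = true ∧ w = W + 4000) ∨ (b = false ∧ w = W - 4000)))

theorem mk3_0t (u v w n : ℤ) : mk3 u v w + n • dv (0, true) = mk3 (u + n) v w := by
  funext i; fin_cases i <;> simp [mk3, dv, sg]
theorem mk3_0f (u v w n : ℤ) : mk3 u v w + n • dv (0, false) = mk3 (u - n) v w := by
  funext i; fin_cases i <;> simp [mk3, dv, sg]; ring
theorem mk3_1t (u v w n : ℤ) : mk3 u v w + n • dv (1, true) = mk3 u (v + n) w := by
  funext i; fin_cases i <;> simp [mk3, dv, sg]
theorem mk3_1f (u v w n : ℤ) : mk3 u v w + n • dv (1, false) = mk3 u (v - n) w := by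
  funext i; fin_cases i <;> simp [mk3, dv, sg]; ring
theorem mk3_2t (u v w n : ℤ) : mk3 u v w + n • dv (2, true) = mk3 u v (w + n) := by
  funext i; fin_cases i <;> simp [mk3, dv, sg]
theorem mk3_2f (u v w n : ℤ) : mk3 u v w + n • dv (2, false) = mk3 u v (w - n) := by
  funext i; fin_cases i <;> simp [mk3, dv, sg]; ring
theorem mk3_zero (u v w : ℤ) : mk3 u v w 0 = u := rfl
theorem mk3_one (u v w : ℤ) : mk3 u v w 1 = v := rfl
theorem mk3_two (u v w : ℤ) : mk3 u v w 2 = w := rfl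
theorem mk3_add (u v w u' v' w' : ℤ) : mk3 u v w + mk3 u' v' w' = mk3 (u+u') (v+v') (w+w') := by
  funext i; fin_cases i <;> simp [mk3]
theorem mk3_ext {z z' : Pt 3} (h0 : z 0 = z' 0) (h1 : z 1 = z' 1) (h2 : z 2 = z' 2) : z = z' := by
  funext i; fin_cases i <;> assumption

theorem odir_cases (o : Option Dir) : o = none ∨ o = some (0, true) ∨ o = some (0, false) ∨
    o = some (1, true) ∨ o = some (1, false) ∨ o = some (2, true) ∨ o = some (2, false) := by
  revert o; decide

theorem wpos_cons_eq (δ : Dir) (n : ℕ) (l : List Seg) (j : ℕ) (z y : Pt 3) :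
    wpos ((δ, n) :: l) j z = y ↔ (j ≤ n ∧ z + (j : ℤ) • dv δ = y) ∨
      (n < j ∧ wpos l (j - n) (z + (n : ℤ) • dv δ) = y) := by
  rw [wpos_cons]
  split_ifs with h
  · simp [h, Nat.not_lt.2 h]
  · simp [h, Nat.not_le.1 h]

theorem wpos_nil (j : ℕ) (z : Pt 3) : wpos [] j z = z := rfl

theorem mk3_eq (u v w : ℤ) (y : Pt 3) : mk3 u v w = y ↔ y 0 = u ∧ y 1 = v ∧ y 2 = w := by
  constructor
  · rintro rfl; exact ⟨rfl, rfl, rfl⟩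
  · rintro ⟨h0, h1, h2⟩; exact mk3_ext h0.symm h1.symm h2.symm

theorem cellSpec_wpos (X D : ℕ) (W : ℤ) (o : Option Dir) (j : ℕ) (hX : X ≤ 300) (hD : 402 ≤ D)
    (hj : j ≤ wlen (route X D o)) (y : Pt 3) (hy : wpos (route X D o) j (mk3 400 4 W) = y) :
    cellSpec X D W o j (y 0) (y 1) (y 2) := by
  rcases odir_cases o with rfl | rfl | rfl | rfl | rfl | rfl | rfl <;>
  simp only [route, wlen] at hj <;>
  simp only [route, wpos_cons_eq, wpos_nil, mk3_0t, mk3_0f, mk3_1t, mk3_1f, mk3_2t, mk3_2f,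
    mk3_eq] at hy <;>
  generalize y 0 = y0 at * <;> generalize y 1 = y1 at * <;> generalize y 2 = y2 at * <;>
  simp only [cellSpec, true_and, false_and, or_false, false_or, reduceCtorEq] <;>
  revert hy <;> simp only [or_imp, and_imp] <;> (repeat' first | apply And.intro | intro _) <;>
  (repeat first | (refine Or.inl ?_; omega) | refine Or.inr ?_) <;> omega

theorem wlen_route (X D : ℕ) (o : Option Dir) (hX : X ≤ 300) (hD : 402 ≤ D) (W : ℤ) :
    wpos (route X D o) (wlen (route X D o)) (mk3 400 4 W) =
      mk3 (X + 1) 2 W + (4000 : ℤ) • ov o := by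
  have h := cellSpec_wpos X D W o _ hX hD le_rfl _ rfl
  revert h
  generalize wpos (route X D o) (wlen (route X D o)) (mk3 400 4 W) = z
  rcases odir_cases o with rfl | rfl | rfl | rfl | rfl | rfl | rfl <;>
  simp only [route, wlen, cellSpec, ov, mk3_0t, mk3_0f, mk3_1t, mk3_1f, mk3_2t, mk3_2f] <;>
  intro h <;> refine mk3_ext ?_ ?_ ?_ <;>
  simp only [mk3_zero, mk3_one, mk3_two, true_and, false_and, or_false, false_or,
    reduceCtorEq, smul_zero, add_zero] at h ⊢ <;> omega

end IU

namespace IU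

/-- residue summary of route cells -/
def OutSum (X D W : ℕ) (u v w : ℤ) : Prop :=
  ∃ k0 k1 k2 u' v' w' : ℤ, u = 4000 * k0 + u' ∧ v = 4000 * k1 + v' ∧ w = 4000 * k2 + w' ∧
    0 ≤ u' ∧ u' < 4000 ∧ 0 ≤ v' ∧ v' < 4000 ∧ 0 ≤ w' ∧ w' < 4000 ∧
    ((w' = W ∧ (v' = 0 → 399 ≤ u') ∧ (v' = 2 → 399 ≤ u' ∨ u' = X + 1) ∧ (v' = 3 → 399 ≤ u') ∧
      (v' = 4 → u' = 399 ∨ u' = 401 ∨ 403 ≤ u') ∧ (v' = 6 → u' = 400 ∨ u' = D ∨ u' = D + 1)) ∨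
     (v' = 6 ∧ (u' = D ∨ u' = D + 1)))

theorem outSum_of_cell (X D W : ℕ) (o : Option Dir) (j : ℕ) (hX : X ≤ 300) (hD : 402 ≤ D)
    (hD' : D ≤ 1402) (hW : 3 ≤ W) (hW' : W ≤ 1500) (hj : 1 ≤ j) (u v w : ℤ)
    (h : cellSpec X D W o j u v w) : OutSum X D W u v w := by
  refine ⟨u / 4000, v / 4000, w / 4000, u % 4000, v % 4000, w % 4000, by omega, by omega, by omega,
    by omega, by omega, by omega, by omega, by omega, by omega, ?_⟩
  rcases odir_cases o with rfl | rfl | rfl | rfl | rfl | rfl | rfl <;>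
  simp only [cellSpec, true_and, false_and, or_false, false_or, reduceCtorEq] at h <;>
  revert h <;> simp only [or_imp, and_imp] <;> (repeat' first | apply And.intro | intro _) <;>
  first
  | (refine Or.inl ⟨by omega, by omega, by omega, by omega, by omega, by omega⟩)
  | (refine Or.inr ⟨by omega, by omega⟩)

theorem cell_inj (X D : ℕ) (W : ℤ) (o : Option Dir) (j j' : ℕ) (hX : X ≤ 300) (hD : 402 ≤ D)
    (hD' : D ≤ 1402) (u v w u' v' w' k0 k1 k2 : ℤ)
    (h : cellSpec X D W o j u v w) (h' : cellSpec X D W o j' u' v' w')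
    (e0 : u = u' + 4000 * k0) (e1 : v = v' + 4000 * k1) (e2 : w = w' + 4000 * k2) : j = j' := by
  rcases odir_cases o with rfl | rfl | rfl | rfl | rfl | rfl | rfl <;>
  simp only [cellSpec, true_and, false_and, or_false, false_or, reduceCtorEq] at h h' <;>
  revert h <;> simp only [or_imp, and_imp] <;> (repeat' first | apply And.intro | intro _) <;>
  revert h' <;> simp only [or_imp, and_imp] <;> (repeat' first | apply And.intro | intro _) <;>
  omega

namespace LRS
variable {F Rl Q : Type} (S : LRS F Rl Q)

theorem pX_le (f : F) : S.pX f ≤ 299 := by have := S.iF_lt f; unfold pX; omega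
theorem pD_ge (r : Rl) : 402 ≤ S.pD r := by unfold pD; omega
theorem pD_le (r : Rl) : S.pD r ≤ 1402 := by have := S.iR_lt r; unfold pD; omega
theorem pW_ge (r : Rl) : 3 ≤ S.pW r := by unfold pW; omega
theorem pW_le (r : Rl) : S.pW r ≤ 1500 := by have := S.iR_lt r; unfold pW; omega

theorem out_cell (r : Rl) (j : ℕ) (hj : j < S.len r) :
    cellSpec (S.pX (S.tgt r)) (S.pD r) (S.pW r) (S.off r) (j+1) (S.abs (.out r j) 0)
      (S.abs (.out r j) 1) (S.abs (.out r j) 2) :=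
  cellSpec_wpos _ _ _ _ _ (by have := S.pX_le (S.tgt r); omega) (S.pD_ge r) hj _ rfl

theorem out_sum (r : Rl) (j : ℕ) (hj : j < S.len r) :
    OutSum (S.pX (S.tgt r)) (S.pD r) (S.pW r) (S.abs (.out r j) 0)
      (S.abs (.out r j) 1) (S.abs (.out r j) 2) :=
  outSum_of_cell _ _ _ _ _ (by have := S.pX_le (S.tgt r); omega) (S.pD_ge r) (S.pD_le r)
    (S.pW_ge r) (S.pW_le r) (by omega) _ _ _ (S.out_cell r j hj)

/-- residue summary for route cells -/
def OutRes (X D W : ℕ) (u' v' w' : ℤ) : Prop :=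
  ((w' = W ∧ (v' = 0 → 399 ≤ u') ∧ (v' = 2 → 399 ≤ u' ∨ u' = X + 1) ∧ (v' = 3 → 399 ≤ u') ∧
      (v' = 4 → u' = 399 ∨ u' = 401 ∨ 403 ≤ u') ∧ (v' = 6 → u' = 400 ∨ u' = D ∨ u' = D + 1)) ∨
     (v' = 6 ∧ (u' = D ∨ u' = D + 1)))

/-- residue specification of nodes -/
def nspec : Nd F Rl → ℤ → ℤ → ℤ → Prop
  | .bus f w => fun a b c => a = S.pX f ∧ b = 3 ∧ c = w
  | .off f => fun a b c => a = S.pX f + 1 ∧ b = 3 ∧ c = 1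
  | .tr f w => fun a b c => a = S.pX f + 2 ∧ b = 3 ∧ c = w
  | .pr r b' u => fun a b c => a = u ∧ b = 4 ∧ ((b' = true ∧ c = S.pW r + 1) ∨ (b' = false ∧ c = S.pW r - 1))
  | .gate r => fun a b c => a = 400 ∧ b = 4 ∧ c = S.pW r
  | .out r _ => fun a b c => OutRes (S.pX (S.tgt r)) (S.pD r) (S.pW r) a b c
  | .arm r b' => fun a b c => c = S.pW r ∧
      ((b' = true ∧ a = S.pX (S.tgt r) + 1 ∧ b = 3) ∨
      (b' = false ∧ a = S.pX (S.tgt r) ∧ b = 2))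
  | .rod u v w => fun a b c => a = u ∧ b = v ∧ c = w

theorem nspec_abs (x : Nd F Rl) (hx : S.ok x) :
    S.nspec x (S.abs x 0 % 4000) (S.abs x 1 % 4000) (S.abs x 2 % 4000) := by
  cases x with
  | bus f w =>
    have := S.pX_le f
    simp only [ok] at hx
    simp only [nspec, abs, mk3_zero, mk3_one, mk3_two]; omega
  | off f =>
    have := S.pX_le f
    simp only [nspec, abs, mk3_zero, mk3_one, mk3_two]; omega
  | tr f w =>
    have := S.pX_le f
    simp only [ok] at hx
    simp only [nspec, abs, mk3_zero, mk3_one, mk3_two]; omega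
  | pr r b u =>
    have := S.pW_le r
    have := S.pW_ge r
    simp only [ok] at hx
    cases b <;> simp [nspec, abs, mk3_zero, mk3_one, mk3_two] <;> omega
  | gate r =>
    have := S.pW_le r
    simp only [nspec, abs, mk3_zero, mk3_one, mk3_two]; omega
  | out r j =>
    obtain ⟨a0, a1, a2, u, v, w, h0, h1, h2, _, _, _, _, _, _, h⟩ := S.out_sum r j hx
    have q0 : S.abs (Nd.out r j) 0 % 4000 = u := by omega
    have q1 : S.abs (Nd.out r j) 1 % 4000 = v := by omega
    have q2 : S.abs (Nd.out r j) 2 % 4000 = w := by omega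
    simp only [nspec, q0, q1, q2]
    exact h
  | arm r b =>
    have := S.pW_le r
    have := S.pX_le (S.tgt r)
    cases b <;> simp [abs, fin, nspec, mk3_zero, mk3_one, mk3_two] <;> omega
  | rod u v w =>
    simp only [ok] at hx
    simp only [nspec, abs, mk3_zero, mk3_one, mk3_two]; omega

theorem pX_inj {f g : F} (h : S.pX f = S.pX g) : f = g :=
  S.iF_inj (by unfold pX at h; omega)
theorem pW_inj {f g : Rl} (h : S.pW f = S.pW g) : f = g :=
  S.iR_inj (by unfold pW at h; omega)

/-- arithmetic bounds attached to a node -/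
def bnd : Nd F Rl → Prop
  | .bus f _ => S.pX f = 3 * S.iF f + 2 ∧ S.iF f < 100
  | .off f => S.pX f = 3 * S.iF f + 2 ∧ S.iF f < 100
  | .tr f _ => S.pX f = 3 * S.iF f + 2 ∧ S.iF f < 100
  | .pr r b _ => S.pW r = 3 * S.iR r + 3 ∧ S.iR r < 500 ∧ 2 ≤ S.pX (S.fb r b)
  | .gate r => S.pW r = 3 * S.iR r + 3 ∧ S.iR r < 500
  | .out r _ => S.pW r = 3 * S.iR r + 3 ∧ S.iR r < 500 ∧ S.pD r = 402 + 2 * S.iR r ∧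
      S.pX (S.tgt r) = 3 * S.iF (S.tgt r) + 2 ∧ S.iF (S.tgt r) < 100
  | .arm r _ => S.pW r = 3 * S.iR r + 3 ∧ S.iR r < 500 ∧
      S.pX (S.tgt r) = 3 * S.iF (S.tgt r) + 2 ∧ S.iF (S.tgt r) < 100
  | .rod _ _ _ => True

theorem bnd_all (x : Nd F Rl) : S.bnd x := by
  have h1 := S.iF_lt
  have h2 := S.iR_lt
  cases x <;> simp only [bnd, pX, pW, pD, h1, h2, and_true, true_and] <;> first | omega | trivial

def agree : Nd F Rl → Nd F Rl → Prop
  | .bus f w, .bus f' w' => S.iF f = S.iF f' ∧ w = w'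
  | .off f, .off f' => S.iF f = S.iF f'
  | .tr f w, .tr f' w' => S.iF f = S.iF f' ∧ w = w'
  | .pr r b u, .pr r' b' u' => S.iR r = S.iR r' ∧ b.toNat = b'.toNat ∧ u = u'
  | .gate r, .gate r' => S.iR r = S.iR r'
  | .arm r b, .arm r' b' => S.iR r = S.iR r' ∧ b.toNat = b'.toNat
  | .rod u v w, .rod u' v' w' => u = u' ∧ v = v' ∧ w = w'
  | _, _ => False

theorem agree_eq {x y : Nd F Rl} (h : S.agree x y) : x = y := by
  have hb : ∀ b b' : Bool, b.toNat = b'.toNat → b = b' := by decide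
  cases x <;> cases y <;> simp only [agree] at h
  · rw [S.iF_inj h.1, h.2]
  · rw [S.iF_inj h]
  · rw [S.iF_inj h.1, h.2]
  · rw [S.iR_inj h.1, hb _ _ h.2.1, h.2.2]
  · rw [S.iR_inj h]
  · rw [S.iR_inj h.1, hb _ _ h.2]
  · rw [h.1, h.2.1, h.2.2]

set_option maxHeartbeats 1000000 in
theorem abs_inj {x y : Nd F Rl} (hx : S.ok x) (hy : S.ok y) {k0 k1 k2 : ℤ}
    (e0 : S.abs x 0 = S.abs y 0 + 4000 * k0) (e1 : S.abs x 1 = S.abs y 1 + 4000 * k1)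
    (e2 : S.abs x 2 = S.abs y 2 + 4000 * k2) : x = y := by
  have sx := S.nspec_abs x hx
  have sy := S.nspec_abs y hy
  by_cases hout : ∃ r i r' j, x = .out r i ∧ y = .out r' j
  · obtain ⟨r, i, r', j, rfl, rfl⟩ := hout
    have hr : r = r' := by
      obtain ⟨a0, a1, a2, u, v, w, h0, h1, h2, _, _, _, _, _, _, h⟩ := S.out_sum r i hx
      obtain ⟨b0, b1, b2, u', v', w', h0', h1', h2', _, _, _, _, _, _, h'⟩ := S.out_sum r' j hy
      have q0 : u = u' := by omega
      have q1 : v = v' := by omega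
      have q2 : w = w' := by omega
      subst q0 q1 q2
      apply S.iR_inj
      have := S.pD_ge r
      have := S.pD_ge r'
      simp only [pW, pD] at *
      omega
    subst hr
    have := cell_inj _ _ _ _ _ _ (by have := S.pX_le (S.tgt r); omega) (S.pD_ge r) (S.pD_le r)
      _ _ _ _ _ _ k0 k1 k2 (S.out_cell r i hx) (S.out_cell r j hy) e0 e1 e2
    have : i = j := by omega
    rw [this]
  · rw [show S.abs x 0 % 4000 = S.abs y 0 % 4000 by omega,
      show S.abs x 1 % 4000 = S.abs y 1 % 4000 by omega,
      show S.abs x 2 % 4000 = S.abs y 2 % 4000 by omega] at sx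
    clear e0 e1 e2
    generalize S.abs y 0 % 4000 = y0 at *
    generalize S.abs y 1 % 4000 = y1 at *
    generalize S.abs y 2 % 4000 = y2 at *
    have bx := S.bnd_all x
    have bY := S.bnd_all y
    apply S.agree_eq
    rcases x with ⟨f, w⟩ | f | ⟨f, w⟩ | ⟨r, b, u⟩ | r | ⟨r, j⟩ | ⟨r, b⟩ | ⟨u, v, w⟩ <;>
    rcases y with ⟨f', w'⟩ | f' | ⟨f', w'⟩ | ⟨r', b', u'⟩ | r' | ⟨r', j'⟩ | ⟨r', b'⟩ | ⟨u', v', w'⟩ <;>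
    first
    | exact absurd ⟨_, _, _, _, rfl, rfl⟩ hout
    | (clear hout
       try cases b
       all_goals try cases b'
       all_goals
         simp only [nspec, ok, OutRes, bnd, agree, Bool.toNat_true, Bool.toNat_false, true_and, false_and, false_or, or_false, reduceCtorEq] at sx sy hx hy bx bY ⊢
         revert sx sy
         simp only [and_imp, or_imp, forall_exists_index]
         (repeat' first | apply And.intro | intro _)
         all_goals omega)

/-- node locations are injective -/
theorem loc_inj {p q : Pt 3} {x y : Nd F Rl} (hx : S.ok x) (hy : S.ok y)
    (h : S.loc (p, x) = S.loc (q, y)) : p = q ∧ x = y := by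
  have e : ∀ i, S.abs x i = S.abs y i + 4000 * (q i - p i) := by
    intro i
    have := congrFun h i
    simp only [loc, Pi.add_apply, Pi.smul_apply, smul_eq_mul] at this
    linarith
  have hxy := S.abs_inj hx hy (e 0) (e 1) (e 2)
  subst hxy
  refine ⟨?_, rfl⟩
  funext i
  have := e i
  omega

end LRS
end IU

namespace IU

theorem cell_cube (X D W : ℕ) (o : Option Dir) (j : ℕ) (hX : X ≤ 300) (hD : 402 ≤ D)
    (hD' : D ≤ 1402) (hW : 3 ≤ W) (hW' : W ≤ 1500) (u v w : ℤ)
    (h : cellSpec X D W o j u v w) :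
    (u / 4000 = 0 ∧ v / 4000 = 0 ∧ w / 4000 = 0) ∨
    (u / 4000 = ov o 0 ∧ v / 4000 = ov o 1 ∧ w / 4000 = ov o 2) := by
  rcases odir_cases o with rfl | rfl | rfl | rfl | rfl | rfl | rfl <;>
  simp [cellSpec, ov, dv, sg] at h ⊢ <;>
  revert h <;> simp only [or_imp, and_imp] <;> (repeat' first | apply And.intro | intro _) <;>
  omega

theorem wlen_le (X D : ℕ) (o : Option Dir) (hX : X ≤ 300) (hD' : D ≤ 1402) :
    wlen (route X D o) < 8000 ∧ 0 < wlen (route X D o) := by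
  rcases odir_cases o with rfl | rfl | rfl | rfl | rfl | rfl | rfl <;>
  simp only [route, wlen] <;> omega

namespace LRS
variable {F Rl Q : Type} (S : LRS F Rl Q)

theorem len_lt (r : Rl) : S.len r < 8000 :=
  (wlen_le _ _ _ (by have := S.pX_le (S.tgt r); omega) (S.pD_le r)).1
theorem len_pos (r : Rl) : 0 < S.len r :=
  (wlen_le _ _ _ (by have := S.pX_le (S.tgt r); omega) (S.pD_le r)).2

/-- whether the node belongs to the transport part of rule `r` -/
def isTrans (x : Nd F Rl) (r : Rl) : Prop := (∃ j, x = .out r j) ∨ ∃ b, x = .arm r b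

theorem cube_abs (x : Nd F Rl) (hx : S.ok x) :
    (∀ i, S.abs x i / 4000 = 0) ∨ ∃ r, isTrans x r ∧ ∀ i, S.abs x i / 4000 = ov (S.off r) i := by
  have h3 : ∀ (P : Fin 3 → Prop), P 0 → P 1 → P 2 → ∀ i, P i := by
    intro P h0 h1 h2 i; fin_cases i <;> assumption
  have hb := S.bnd_all x
  cases x with
  | out r j =>
    have := cell_cube _ _ _ _ _ (by have := S.pX_le (S.tgt r); omega) (S.pD_ge r) (S.pD_le r)
      (S.pW_ge r) (S.pW_le r) _ _ _ (S.out_cell r j hx)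
    rcases this with h | h
    · exact Or.inl (h3 _ h.1 h.2.1 h.2.2)
    · exact Or.inr ⟨r, Or.inl ⟨j, rfl⟩, h3 _ h.1 h.2.1 h.2.2⟩
  | arm r b =>
    refine Or.inr ⟨r, Or.inr ⟨b, rfl⟩, h3 _ ?_ ?_ ?_⟩ <;>
    cases b <;> simp [abs, fin, bnd, mk3_zero, mk3_one, mk3_two] at hb ⊢ <;> omega
  | _ =>
    left
    simp only [ok, bnd] at hx hb
    apply h3 <;> simp only [abs, mk3_zero, mk3_one, mk3_two] <;> try split_ifs
    all_goals omega

/-- unique strength-two predecessor -/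
def pred : Nd F Rl → Option (Nd F Rl)
  | .bus _ _ => none
  | .off f => some (.bus f 1)
  | .tr f w => some (if w ≤ 1 then .off f else .tr f (w - 1))
  | .pr r b u => some (if u = S.pX (S.fb r b) + 2 then
      .tr (S.fb r b) (if b then S.pW r + 1 else S.pW r - 1) else .pr r b (u - 1))
  | .gate _ => none
  | .out r j => some (if j = 0 then .gate r else .out r (j - 1))
  | .arm r _ => some (.out r (S.len r - 1))
  | .rod _ _ _ => none

def str (x y : Nd F Rl) : ℕ :=
  if S.pred y = some x then 2 else
  match x, y with
  | .pr r _ u, .gate r' => if r = r' ∧ u = 400 then 1 else 0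
  | .arm r _, .bus f w => if f = S.tgt r ∧ w = S.pW r then 1 else 0
  | .bus f w, .bus f' w' => if f = f' ∧ w' = w + 1 then 2 else 0
  | _, _ => 0

def shf (x y : Nd F Rl) : Pt 3 :=
  match x, y with
  | .arm r _, .bus _ _ => ov (S.off r)
  | _, _ => 0

theorem pred_adj {x y : Nd F Rl} (hy : S.ok y) (h : S.pred y = some x) :
    S.ok x ∧ ∃ δ, S.abs x + dv δ = S.abs y := by
  have hb := S.bnd_all y
  have e0 : ∀ (u v w : ℤ), mk3 u v w + dv (0, true) = mk3 (u + 1) v w := fun u v w => by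
    simpa using mk3_0t u v w 1
  have e1 : ∀ (u v w : ℤ), mk3 u v w + dv (1, true) = mk3 u (v + 1) w := fun u v w => by
    simpa using mk3_1t u v w 1
  have e2 : ∀ (u v w : ℤ), mk3 u v w + dv (2, true) = mk3 u v (w + 1) := fun u v w => by
    simpa using mk3_2t u v w 1
  cases y with
  | bus f w => simp [pred] at h
  | gate r => simp [pred] at h
  | rod u v w => simp [pred] at h
  | off f =>
    simp only [pred, Option.some.injEq] at h
    subst h
    refine ⟨by simp [ok], (0, true), ?_⟩
    simp [abs, e0]
  | tr f w =>
    simp only [pred, Option.some.injEq] at h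
    simp only [ok] at hy
    subst h
    split_ifs with hw
    · have : w = 1 := by omega
      subst this
      refine ⟨by simp [ok], (0, true), ?_⟩
      simp only [abs, e0]; norm_num [add_assoc]
    · refine ⟨by simp only [ok]; omega, (2, true), ?_⟩
      simp only [abs, e2]; congr 1; omega
  | pr r b u =>
    simp only [pred, Option.some.injEq] at h
    simp only [ok, bnd] at hy hb
    subst h
    split_ifs with hu hbb hbb
    · subst hbb
      refine ⟨by simp only [ok]; omega, (1, true), ?_⟩
      simp only [abs, e1, if_true, hu]; push_cast; rfl
    · refine ⟨by simp only [ok]; omega, (1, true), ?_⟩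
      simp only [abs, e1, if_neg hbb, hu]; push_cast
      rw [Nat.cast_sub (by omega)]; rfl
    · refine ⟨by simp only [ok]; omega, (0, true), ?_⟩
      simp only [abs, e0]; congr 1; omega
  | out r j =>
    simp only [pred, Option.some.injEq] at h
    simp only [ok] at hy
    subst h
    split_ifs with hj
    · subst hj
      obtain ⟨δ, hδ⟩ := wpos_succ (S.rt r) 0 (mk3 400 4 (S.pW r)) hy
      rw [wpos_zero] at hδ
      exact ⟨trivial, δ, hδ.symm⟩
    · obtain ⟨k, rfl⟩ : ∃ k, j = k + 1 := ⟨j - 1, by omega⟩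
      obtain ⟨δ, hδ⟩ := wpos_succ (S.rt r) (k+1) (mk3 400 4 (S.pW r)) hy
      exact ⟨by simp only [ok]; omega, δ, hδ.symm⟩
  | arm r b =>
    simp only [pred, Option.some.injEq] at h
    subst h
    have hl := S.len_pos r
    refine ⟨by simp only [ok]; omega, ?_⟩
    have hfin : S.abs (.out r (S.len r - 1)) = S.fin r := by
      simp only [abs]
      rw [show S.len r - 1 + 1 = S.len r by omega]
      exact wlen_route _ _ _ (by have := S.pX_le (S.tgt r); omega) (S.pD_ge r) _
    rw [hfin]
    cases b
    · refine ⟨(0, false), ?_⟩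
      simp only [abs]
      congr 1
      funext i; fin_cases i <;> simp [dv, sg, mk3]
    · refine ⟨(1, true), ?_⟩
      simp only [abs]
      congr 1
      funext i; fin_cases i <;> simp [dv, sg, mk3]

theorem str_cases {x y : Nd F Rl} (h : 0 < S.str x y) :
    (S.pred y = some x ∧ S.str x y = 2 ∧ S.shf x y = 0) ∨
    (∃ r b, x = .pr r b 400 ∧ y = .gate r ∧ S.str x y = 1 ∧ S.shf x y = 0) ∨
    (∃ r b, x = .arm r b ∧ y = .bus (S.tgt r) (S.pW r) ∧ S.str x y = 1 ∧ S.shf x y = ov (S.off r)) ∨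
    (∃ f w, x = .bus f w ∧ y = .bus f (w+1) ∧ S.str x y = 2 ∧ S.shf x y = 0) := by
  by_cases hp : S.pred y = some x
  · left
    refine ⟨hp, by simp [str, hp], ?_⟩
    cases y <;> simp [pred] at hp <;> (cases x <;> rfl)
  · right
    unfold str at h ⊢
    simp only [if_neg hp] at h ⊢
    cases x <;> cases y <;> simp only [lt_self_iff_false] at h <;> split_ifs at h with hh <;> try exact absurd h (lt_irrefl 0)
    · obtain ⟨rfl, rfl⟩ := hh
      right; right
      exact ⟨_, _, rfl, rfl, by simp, rfl⟩
    · obtain ⟨rfl, rfl⟩ := hh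
      left
      exact ⟨_, _, rfl, rfl, by simp, rfl⟩
    · obtain ⟨rfl, rfl⟩ := hh
      right; left
      exact ⟨_, _, rfl, rfl, by simp, rfl⟩

theorem str_pred {x y : Nd F Rl} (h : S.pred y = some x) : S.str x y = 2 := by simp [str, h]
theorem str_gate (r : Rl) (b : Bool) : S.str (.pr r b 400) (.gate r) = 1 := by simp [str, pred]
theorem str_arm (r : Rl) (b : Bool) : S.str (.arm r b) (.bus (S.tgt r) (S.pW r)) = 1 := by
  simp [str, pred]
theorem str_bus (f : F) (w : ℕ) : S.str (.bus f w) (.bus f (w+1)) = 2 := by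
  simp [str, pred]

theorem str_adj {x y : Nd F Rl} (hy : S.ok y) (h : 0 < S.str x y) :
    ∃ δ, S.abs x + dv δ = S.loc (S.shf x y, y) := by
  rcases S.str_cases h with ⟨hp, _, hs⟩ | ⟨r, b, rfl, rfl, _, hs⟩ | ⟨r, b, rfl, rfl, _, hs⟩ |
    ⟨f, w, rfl, rfl, _, hs⟩
  · obtain ⟨_, δ, hδ⟩ := S.pred_adj hy hp
    exact ⟨δ, by simp [loc, hs, hδ]⟩
  · cases b
    · refine ⟨(2, true), ?_⟩
      simp only [loc, hs, smul_zero, zero_add]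
      funext i; fin_cases i <;> simp [abs, dv, sg, mk3]
    · refine ⟨(2, false), ?_⟩
      simp only [loc, hs, smul_zero, zero_add]
      funext i; fin_cases i <;> simp [abs, dv, sg, mk3]
  · cases b
    · refine ⟨(1, true), ?_⟩
      simp only [loc, hs]
      refine mk3_ext ?_ ?_ ?_ <;> simp [abs, fin, dv, sg, mk3_zero, mk3_one, mk3_two] <;> ring
    · refine ⟨(0, false), ?_⟩
      simp only [loc, hs]
      refine mk3_ext ?_ ?_ ?_ <;> simp [abs, fin, dv, sg, mk3_zero, mk3_one, mk3_two] <;> ring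
  · refine ⟨(2, true), ?_⟩
    simp only [loc, hs, smul_zero, zero_add]
    funext i; fin_cases i <;> simp [abs, dv, sg, mk3]

theorem str_asymm {x y : Nd F Rl} (hx : S.ok x) (hy : S.ok y) (h : 0 < S.str x y) : S.str y x = 0 := by
  by_contra hc
  have h2 : 0 < S.str y x := Nat.pos_of_ne_zero hc
  have bx := S.bnd_all x
  have bY := S.bnd_all y
  rcases S.str_cases h with ⟨hp, _, hs⟩ | ⟨r, b, rfl, rfl, _, hs⟩ | ⟨r, b, rfl, rfl, _, hs⟩ |
    ⟨f, w, rfl, rfl, _, hs⟩ <;>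
  rcases S.str_cases h2 with ⟨hp', _, hs'⟩ | ⟨r', b', e1, e2, _, hs'⟩ | ⟨r', b', e1, e2, _, hs'⟩ |
    ⟨f', w', e1, e2, _, hs'⟩ <;> try (first | (subst e1; subst e2; simp [pred] at hp; done) | (simp [pred] at hp'; done) | (cases e1; done) | (cases e2; done))
  · cases y <;> simp only [pred, Option.some.injEq, reduceCtorEq] at hp <;> (try split_ifs at hp) <;> subst hp <;>
      simp only [pred, Option.some.injEq, reduceCtorEq] at hp' <;> (try split_ifs at hp') <;>
      simp only [Nd.tr.injEq, Nd.pr.injEq, Nd.out.injEq, reduceCtorEq, ok] at * <;> omega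
  · subst e1; subst e2
    simp only [pred, Option.some.injEq] at hp
    split_ifs at hp
  · simp only [pred, Option.some.injEq] at hp'
    split_ifs at hp'
  · cases e1; simp at e2; omega

/-- the shift of an edge is determined by the geometry -/
theorem shf_unique {x y : Nd F Rl} (hy : S.ok y) (h : 0 < S.str x y) {sh δ}
    (e : S.abs x + dv δ = S.loc (sh, y)) : sh = S.shf x y := by
  obtain ⟨δ', e'⟩ := S.str_adj hy h
  funext i
  have h1 := congrFun e i
  have h2 := congrFun e' i
  have hd : ∀ δ : Dir, -1 ≤ dv δ i ∧ dv δ i ≤ 1 := by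
    intro δ
    simp only [dv, sg]
    split_ifs <;> simp
  have := hd δ
  have := hd δ'
  simp only [loc, Pi.add_apply, Pi.smul_apply, smul_eq_mul] at h1 h2
  omega

end LRS
end IU

namespace IU

inductive Val (Q : Type)
  | q (a : Q)
  | g (a b c : Q)
  | sd (a : Q) (fl : Dir → Bool)
  | rod (fl : Dir → Bool)

variable {F Rl Q : Type}

def qv : Val Q → Option Q
  | .q a => some a
  | .g _ _ c => some c
  | .sd a _ => some a
  | .rod _ => none

def vfl : Val Q → Dir → Bool
  | .q _ => fun _ => false
  | .g _ _ _ => fun _ => false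
  | .sd _ fl => fl
  | .rod fl => fl

def isSd : Val Q → Prop
  | .q _ => False
  | .g _ _ _ => False
  | .sd _ _ => True
  | .rod _ => True

theorem vfl_isSd {v : Val Q} {δ} (h : vfl v δ = true) : isSd v := by
  cases v <;> simp [vfl, isSd] at *

def inn (y : Nd F Rl) : Val Q → Option Q
  | .q a => some a
  | .g a b _ => match y with
    | .pr _ b' _ => some (if b' then b else a)
    | _ => none
  | .sd _ _ => none
  | .rod _ => none

theorem inn_not_sd {y : Nd F Rl} {v : Val Q} {a} (h : inn y v = some a) : ¬ isSd v := by
  cases v <;> simp [inn, isSd] at *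

namespace LRS
variable (S : LRS F Rl Q)

def valid (x : Nd F Rl) (v : Val Q) : Prop :=
  match x, v with
  | .gate r, .g a b c => S.rel r a b c
  | .off _, .q _ => True
  | .off _, .sd _ fl => fl (0, true) = false
  | .rod _ _ _, .rod _ => True
  | .bus _ _, .q _ => True
  | .tr _ _, .q _ => True
  | .pr _ _ _, .q _ => True
  | .out _ _, .q _ => True
  | .arm _ _, .q _ => True
  | _, _ => False

def code : Nd F Rl → List ℕ
  | .bus f w => [0, S.iF f, w]
  | .off f => [1, S.iF f]
  | .tr f w => [2, S.iF f, w]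
  | .pr r b u => [3, S.iR r, b.toNat, u]
  | .gate r => [4, S.iR r]
  | .out r j => [5, S.iR r, j]
  | .arm r b => [6, S.iR r, b.toNat]
  | .rod u v w => [7, u, v, w]

theorem code_inj : Function.Injective S.code := by
  have hb : ∀ b b' : Bool, b.toNat = b'.toNat → b = b' := by decide
  intro x y h
  cases x <;> cases y <;> simp [code] at h
  · rw [S.iF_inj h.1, h.2]
  · rw [S.iF_inj h]
  · rw [S.iF_inj h.1, h.2]
  · rw [S.iR_inj h.1, hb _ _ h.2.1, h.2.2]
  · rw [S.iR_inj h]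
  · rw [S.iR_inj h.1, h.2]
  · rw [S.iR_inj h.1, hb _ _ h.2]
  · rw [h.1, h.2.1, h.2.2]

theorem nd_countable (S : LRS F Rl Q) : Countable (Nd F Rl) := S.code_inj.countable

abbrev Lab (F Rl Q : Type) := Option (Nd F Rl × Nd F Rl × Dir × Q)

theorem exists_lenc (S : LRS F Rl Q) [Finite Q] : ∃ f : Lab F Rl Q → String, Function.Injective f := by
  haveI := S.nd_countable
  obtain ⟨f, hf⟩ := exists_injective_nat (Lab F Rl Q)
  refine ⟨fun l => String.ofList (List.replicate (f l) default), fun a b h => hf ?_⟩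
  exact List.replicate_left_injective default (String.ofList_injective h)

variable [Finite Q]

def lenc (S : LRS F Rl Q) : Lab F Rl Q → String := Classical.choose S.exists_lenc
theorem lenc_inj : Function.Injective S.lenc := Classical.choose_spec S.exists_lenc

def nb (x : Nd F Rl) (δ : Dir) : Option (Nd F Rl) :=
  if h : ∃ y sh, S.ok y ∧ S.abs x + dv δ = S.loc (sh, y) then some (Classical.choose h) else none

theorem nb_eq {x y : Nd F Rl} {δ sh} (hy : S.ok y) (e : S.abs x + dv δ = S.loc (sh, y)) :
    S.nb x δ = some y := by
  have h : ∃ y sh, S.ok y ∧ S.abs x + dv δ = S.loc (sh, y) := ⟨y, sh, hy, e⟩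
  obtain ⟨sh', h1, h2⟩ := Classical.choose_spec h
  unfold nb
  rw [dif_pos h]
  rw [(S.loc_inj hy h1 (e.symm.trans h2)).2]

theorem nb_some {x y : Nd F Rl} {δ} (h : S.nb x δ = some y) :
    S.ok y ∧ ∃ sh, S.abs x + dv δ = S.loc (sh, y) := by
  unfold nb at h
  split_ifs at h with hh
  obtain ⟨sh', h1, h2⟩ := Classical.choose_spec hh
  simp only [Option.some.injEq] at h
  rw [← h]
  exact ⟨h1, sh', h2⟩

def fc (x : Nd F Rl) (v : Val Q) (δ : Dir) : Glue :=
  if vfl v δ = true then (S.lenc none, 2) else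
  match S.nb x δ with
  | none => (S.lenc none, 0)
  | some y =>
    if 0 < S.str x y then
      match qv v with
      | some a => (S.lenc (some (x, y, δ, a)), S.str x y)
      | none => (S.lenc none, 0)
    else if 0 < S.str y x then
      match inn y v with
      | some a => (S.lenc (some (y, x, opp δ, a)), S.str y x)
      | none => (S.lenc none, 0)
    else (S.lenc none, 0)

theorem fc_pos {x : Nd F Rl} {v : Val Q} {δ} (h : 0 < (S.fc x v δ).2) :
    (vfl v δ = true ∧ S.fc x v δ = (S.lenc none, 2)) ∨
    (∃ y a, S.nb x δ = some y ∧ 0 < S.str x y ∧ qv v = some a ∧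
      S.fc x v δ = (S.lenc (some (x, y, δ, a)), S.str x y)) ∨
    (∃ y a, S.nb x δ = some y ∧ 0 < S.str y x ∧ inn y v = some a ∧
      S.fc x v δ = (S.lenc (some (y, x, opp δ, a)), S.str y x)) := by
  unfold fc at h ⊢
  split_ifs at h ⊢ with hv
  · exact Or.inl ⟨hv, rfl⟩
  · right
    cases hn : S.nb x δ with
    | none => simp [hn] at h
    | some y =>
      simp only [hn] at h ⊢
      split_ifs at h ⊢ with h1 h2
      · left
        cases hq : qv v with
        | none => simp [hq] at h
        | some a => exact ⟨y, a, rfl, h1, rfl, rfl⟩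
      · right
        cases hq : inn y v with
        | none => simp [hq] at h
        | some a => exact ⟨y, a, rfl, h2, hq, rfl⟩
      · simp at h

theorem fc_out {x y : Nd F Rl} {v : Val Q} {δ a} (hf : vfl v δ = false) (hn : S.nb x δ = some y)
    (hs : 0 < S.str x y) (hq : qv v = some a) :
    S.fc x v δ = (S.lenc (some (x, y, δ, a)), S.str x y) := by
  unfold fc
  rw [if_neg (by simp [hf]), hn]
  simp only [if_pos hs, hq]

theorem fc_in {x y : Nd F Rl} {v : Val Q} {δ a} (hx : S.ok x) (hf : vfl v δ = false)
    (hn : S.nb x δ = some y) (hs : 0 < S.str y x) (hq : inn y v = some a) :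
    S.fc x v δ = (S.lenc (some (y, x, opp δ, a)), S.str y x) := by
  unfold fc
  have h0 := S.str_asymm (S.nb_some hn).1 hx hs
  rw [if_neg (by simp [hf]), hn]
  simp only [h0, lt_irrefl, if_false, if_pos hs, hq]

theorem fc_sg {x : Nd F Rl} {v : Val Q} {δ} (hf : vfl v δ = true) :
    S.fc x v δ = (S.lenc none, 2) := by
  unfold fc; rw [if_pos hf]

def tile (x : Nd F Rl) (v : Val Q) : TileType 3 := fun i => (S.fc x v (i, true), S.fc x v (i, false))

@[simp] theorem face_tile (x : Nd F Rl) (v : Val Q) (δ : Dir) : face (S.tile x v) δ = S.fc x v δ := by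
  obtain ⟨i, b⟩ := δ
  cases b <;> rfl

theorem loc_add (p p' : Pt 3) (x : Nd F Rl) : S.loc (p + p', x) = (4000 : ℤ) • p + S.loc (p', x) := by
  simp only [loc, smul_add, add_assoc]

/-- reversed adjacency -/
theorem adj_rev {x y : Nd F Rl} {δ sh} (e : S.abs x + dv δ = S.loc (sh, y)) :
    S.abs y + dv (opp δ) = S.loc (-sh, x) := by
  simp only [loc, dv_opp] at e ⊢
  have : S.abs x = (4000 : ℤ) • sh + S.abs y - dv δ := by rw [← e]; abel
  rw [this, smul_neg]; abel

theorem bond_fwd {x y : Nd F Rl} {v w : Val Q} {δ a} {p : Pt 3} (hx : S.ok x) (hy : S.ok y)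
    (hs : 0 < S.str y x) (e : S.abs y + dv δ = S.loc (S.shf y x, x)) (hw : vfl w δ = false)
    (hv : vfl v (opp δ) = false) (hq : qv w = some a) (hi : inn y v = some a) :
    bond (S.tile x v) (S.tile y w) (S.loc (p + S.shf y x, x)) (S.loc (p, y)) = S.str y x := by
  have e1 : S.loc (p, y) = S.loc (p + S.shf y x, x) + dv (opp δ) := by
    rw [loc_add, ← e, dv_opp]; simp only [loc]; abel
  rw [e1, bond_dir, face_tile, face_tile, opp_opp, S.fc_out hw (S.nb_eq hx e) hs hq,
    S.fc_in hx hv (S.nb_eq hy (S.adj_rev e)) hs hi, opp_opp]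
  simp

theorem bond_inv {x y : Nd F Rl} {v w : Val Q} {p z : Pt 3} (hx : S.ok x) (hy : S.ok y)
    (h : bond (S.tile x v) (S.tile y w) z (S.loc (p, y)) ≠ 0) :
    (∃ δ, vfl v δ = true ∧ vfl w (opp δ) = true ∧ z = S.loc (p, y) + dv (opp δ)) ∨
    (∃ a, 0 < S.str y x ∧ z = S.loc (p + S.shf y x, x) ∧ qv w = some a ∧ inn y v = some a ∧
      bond (S.tile x v) (S.tile y w) z (S.loc (p, y)) = S.str y x) ∨
    (∃ a p', 0 < S.str x y ∧ p = p' + S.shf x y ∧ z = S.loc (p', x) ∧ inn x w = some a ∧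
      qv v = some a ∧ bond (S.tile x v) (S.tile y w) z (S.loc (p, y)) = S.str x y) := by
  obtain ⟨δ, hz, hf, hpos⟩ := bond_ne_zero h
  have hb : bond (S.tile x v) (S.tile y w) z (S.loc (p, y)) = (S.fc x v δ).2 := by
    rw [hz, bond_dir, if_pos hf, face_tile]
  rw [face_tile, face_tile] at hf
  rw [face_tile] at hpos
  have hz' : z = S.loc (p, y) + dv (opp δ) := by rw [hz, dv_opp]; abel
  have hpos' : 0 < (S.fc y w (opp δ)).2 := by rw [← hf]; exact hpos
  rcases S.fc_pos hpos with ⟨h1, e1⟩ | ⟨y1, a, n1, s1, q1, e1⟩ | ⟨y1, a, n1, s1, q1, e1⟩ <;>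
  rcases S.fc_pos hpos' with ⟨h2, e2⟩ | ⟨y2, b, n2, s2, q2, e2⟩ | ⟨y2, b, n2, s2, q2, e2⟩ <;>
  rw [e1, e2] at hf <;> have hl := S.lenc_inj (congrArg Prod.fst hf) <;>
  simp only [Option.some.injEq, Prod.mk.injEq, reduceCtorEq, opp_opp] at hl
  · exact Or.inl ⟨δ, h1, h2, hz'⟩
  · exact absurd hl.2.2.1.symm (opp_ne δ)
  · obtain ⟨rfl, rfl, _, rfl⟩ := hl
    right; right
    obtain ⟨_, sh, e⟩ := S.nb_some n1
    have hsh := S.shf_unique hy s1 e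
    subst hsh
    have hzz : z = S.loc (p - S.shf x y1, x) := by
      rw [hz']
      have := S.adj_rev e
      simp only [loc] at this ⊢
      rw [add_assoc, this, ← add_assoc, ← smul_add]; congr 2
    exact ⟨a, p - S.shf x y1, s1, by abel, hzz, q2, q1, by rw [hb, e1]⟩
  · obtain ⟨rfl, rfl, _, rfl⟩ := hl
    right; left
    obtain ⟨_, sh, e⟩ := S.nb_some n2
    have hsh := S.shf_unique hx s1 e
    subst hsh
    refine ⟨a, s1, ?_, q2, q1, by rw [hb, e1]⟩
    rw [hz', loc_add, ← e]; simp only [loc]; abel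
  · exact absurd hl.2.2.1 (opp_ne δ)

theorem sd_valid {x : Nd F Rl} {v : Val Q} (h : S.valid x v) (hs : isSd v) :
    (∃ f, x = .off f) ∨ ∃ a b c, x = .rod a b c := by
  cases x <;> cases v <;> simp [valid, isSd] at h hs ⊢

theorem valid_q {x : Nd F Rl} {v : Val Q} (h : S.valid x v) (hs : ¬ isSd v) (hg : ∀ r, x ≠ .gate r) :
    ∃ a, v = .q a := by
  cases x <;> cases v <;> simp [valid, isSd] at h hs hg ⊢

theorem valid_gate {r : Rl} {v : Val Q} (h : S.valid (.gate r : Nd F Rl) v) :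
    ∃ a b c, v = .g a b c ∧ S.rel r a b c := by
  cases v <;> simp [valid] at h ⊢
  exact h

/-! ### injectivity of tiles -/

theorem tile_inj {x : Nd F Rl} {v v' : Val Q} (hx : S.ok x) (hv : S.valid x v) (hv' : S.valid x v')
    (h : S.tile x v = S.tile x v') : v = v' := by
  have hf : ∀ δ, S.fc x v δ = S.fc x v' δ := by
    intro δ
    rw [← face_tile, ← face_tile, h]
  have hfl : ∀ δ, vfl v δ = vfl v' δ := by
    intro δ
    have key : ∀ v v' : Val Q, S.fc x v δ = S.fc x v' δ → vfl v δ = true → vfl v' δ = true := by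
      intro v v' hf h1
      have e := S.fc_sg (x := x) h1
      rw [hf] at e
      rcases S.fc_pos (x := x) (v := v') (δ := δ) (by rw [e]; simp) with h2 | ⟨y, a, _, _, _, h2⟩ | ⟨y, a, _, _, _, h2⟩
      · exact h2.1
      · rw [e] at h2; have := S.lenc_inj (congrArg Prod.fst h2); simp at this
      · rw [e] at h2; have := S.lenc_inj (congrArg Prod.fst h2); simp at this
    have h1 := key v v' (hf δ)
    have h2 := key v' v (hf δ).symm
    cases h3 : vfl v δ <;> cases h4 : vfl v' δ <;> simp_all
  -- information from an outgoing edge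
  have hout : ∀ y, S.ok y → 0 < S.str x y → (∀ δ, vfl v δ = false) → ∀ a a', qv v = some a →
      qv v' = some a' → a = a' := by
    intro y hy hs hvf a a' ha ha'
    obtain ⟨δ, e⟩ := S.str_adj hy hs
    have hn := S.nb_eq hy e
    have h1 := S.fc_out (hvf δ) hn hs ha
    have h2 := S.fc_out (v := v') (by rw [← hfl]; exact hvf δ) hn hs ha'
    rw [hf δ, h2] at h1
    have := S.lenc_inj (congrArg Prod.fst h1)
    simp at this
    exact this.symm
  have hin : ∀ y, S.ok y → 0 < S.str y x → (∀ δ, vfl v δ = false) → ∀ a a', inn y v = some a →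
      inn y v' = some a' → a = a' := by
    intro y hy hs hvf a a' ha ha'
    obtain ⟨δ, e⟩ := S.str_adj hx hs
    have hn := S.nb_eq hy (S.adj_rev e)
    have h1 := S.fc_in hx (hvf _) hn hs ha
    have h2 := S.fc_in (v := v') hx (by rw [← hfl]; exact hvf _) hn hs ha'
    rw [hf _, h2] at h1
    have := S.lenc_inj (congrArg Prod.fst h1)
    simp at this
    exact this.symm
  have hpred : ∀ y, S.pred x = some y → ∀ a a', v = .q a → v' = .q a' → v = v' := by
    rintro y hp a a' rfl rfl
    rw [hin y (S.pred_adj hx hp).1 (by rw [S.str_pred hp]; simp) (fun _ => rfl) a a' rfl rfl]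
  cases x with
  | bus f w =>
    cases v <;> cases v' <;> simp [valid] at hv hv'
    rename_i a a'
    simp only [ok] at hx
    by_cases hw : w = 1
    · subst hw
      rw [hout (.bus f 2) (by simp [ok]) (by rw [S.str_bus f 1]; simp) (fun _ => rfl) a a' rfl rfl]
    · obtain ⟨k, rfl⟩ : ∃ k, w = k + 1 := ⟨w - 1, by omega⟩
      rw [hin (.bus f k) (by simp only [ok]; omega) (by rw [S.str_bus f k]; simp) (fun _ => rfl) a a' rfl rfl]
  | off f =>
    have hs : S.pred (.tr f 1 : Nd F Rl) = some (.off f) := by simp [pred]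
    have ho : S.ok (.tr f 1) := by simp [ok]
    have key : ∀ (a b : Q) (fl : Dir → Bool), S.fc (.off f) (.q a) = S.fc (.off f) (.sd b fl) →
        False := by
      intro a b fl hff
      have hp : S.pred (.off f : Nd F Rl) = some (.bus f 1) := rfl
      have hstr : 0 < S.str (.bus f 1) (.off f : Nd F Rl) := by rw [S.str_pred hp]; simp
      obtain ⟨δ, e⟩ := S.str_adj hx hstr
      have hn := S.nb_eq (S.pred_adj hx hp).1 (S.adj_rev e)
      have h1 := S.fc_in (v := .q a) hx rfl hn hstr rfl
      rw [hff] at h1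
      rcases S.fc_pos (x := .off f) (v := .sd b fl) (δ := opp δ) (by rw [h1]; exact hstr) with
        h2 | ⟨y, c, hy, s, _, _⟩ | ⟨y, a, _, _, h3, _⟩
      · rw [h1] at h2; have := S.lenc_inj (congrArg Prod.fst h2.2); simp at this
      · rw [hn] at hy
        cases hy
        rw [S.str_asymm (S.pred_adj hx hp).1 hx hstr] at s
        exact lt_irrefl _ s
      · simp [inn] at h3
    cases v <;> cases v' <;> simp [valid] at hv hv'
    · rename_i a a'
      rw [hout _ ho (by rw [S.str_pred hs]; simp) (fun _ => rfl) a a' rfl rfl]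
    · exact (key _ _ _ (funext hf)).elim
    · exact (key _ _ _ (funext hf).symm).elim
    · rename_i a fl a' fl'
      have e1 : fl = fl' := funext hfl
      subst e1
      -- direction towards the trunk
      have e : S.abs (.off f) + dv (0, true) = S.loc (0, .tr f 1) := by
        simp only [loc, smul_zero, zero_add]
        refine mk3_ext ?_ ?_ ?_ <;> simp [abs, dv, sg, mk3_zero, mk3_one, mk3_two]
        ring
      have hn := S.nb_eq ho e
      have h1 := S.fc_out (v := .sd a fl) (δ := (0, true)) hv hn (by rw [S.str_pred hs]; simp) rfl
      have h2 := S.fc_out (v := .sd a' fl) (δ := (0, true)) hv hn (by rw [S.str_pred hs]; simp) rfl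
      rw [hf _, h2] at h1
      have := S.lenc_inj (congrArg Prod.fst h1)
      simp at this
      rw [this]
  | tr f w =>
    cases v <;> cases v' <;> simp [valid] at hv hv'
    exact hpred _ rfl _ _ rfl rfl
  | pr r b u =>
    cases v <;> cases v' <;> simp [valid] at hv hv'
    exact hpred _ rfl _ _ rfl rfl
  | out r j =>
    cases v <;> cases v' <;> simp [valid] at hv hv'
    exact hpred _ rfl _ _ rfl rfl
  | arm r b =>
    cases v <;> cases v' <;> simp [valid] at hv hv'
    exact hpred _ rfl _ _ rfl rfl
  | gate r =>
    cases v <;> cases v' <;> simp [valid] at hv hv'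
    rename_i a b c a' b' c'
    have okp : ∀ b, S.ok (.pr r b 400 : Nd F Rl) := by
      intro b
      have := S.pX_le (S.fb r b)
      simp only [ok]; omega
    have h1 := hin (.pr r false 400) (okp _) (by rw [S.str_gate]; simp) (fun _ => rfl) a a' rfl rfl
    have h2 := hin (.pr r true 400) (okp _) (by rw [S.str_gate]; simp) (fun _ => rfl) b b' rfl rfl
    have hp : S.pred (.out r 0 : Nd F Rl) = some (.gate r) := by simp [pred]
    have h3 := hout (.out r 0) (S.len_pos r) (by rw [S.str_pred hp]; simp) (fun _ => rfl) c c' rfl rfl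
    rw [h1, h2, h3]
  | rod a b c =>
    cases v <;> cases v' <;> simp [valid] at hv hv'
    rename_i fl fl'
    rw [show fl = fl' from funext hfl]

end LRS
end IU

namespace IU
variable {F Rl Q : Type}

namespace LRS
variable (S : LRS F Rl Q)

/-! ## Node growth system -/

inductive NRule : Pt 3 × Nd F Rl → Val Q → Finset ((Pt 3 × Nd F Rl) × Val Q) → Prop
  | wire (p x y w a) : S.ok x → S.pred x = some y → qv w = some a →
      NRule (p, x) (.q a) {((p, y), w)}
  | gate (p r a b c) : S.rel r a b c →
      NRule (p, .gate r) (.g a b c) {((p, .pr r false 400), .q a), ((p, .pr r true 400), .q b)}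
  | busA (p r a) : NRule (p + ov (S.off r), .bus (S.tgt r) (S.pW r)) (.q a)
      {((p, .arm r false), .q a), ((p, .arm r true), .q a)}
  | busU (p f w a) : 1 ≤ w → w + 1 < 1600 → NRule (p, .bus f (w+1)) (.q a) {((p, .bus f w), .q a)}
  | busD (p f w a) : 1 ≤ w → w + 1 < 1600 → NRule (p, .bus f w) (.q a) {((p, .bus f (w+1)), .q a)}

def ngs : GS (Pt 3 × Nd F Rl) (Val Q) := ⟨S.NRule⟩

abbrev NSt (F Rl Q : Type) := St (Pt 3 × Nd F Rl) (Val Q)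

/-- well-formed node states -/
def WF (ν : NSt F Rl Q) : Prop := ∀ p x v, ν (p, x) = some v → S.ok x ∧ S.valid x v

def SeedOk (ν0 : NSt F Rl Q) : Prop := ∀ p x v, ν0 (p, x) = some v → S.ok x ∧ S.valid x v ∧ isSd v ∧
  ∀ δ, vfl v δ = true ↔ ∃ n', ν0 n' ≠ none ∧ S.loc n' = S.loc (p, x) + dv δ

theorem NRule.ok_not_sd {n v H} (h : S.NRule n v H) : S.ok n.2 ∧ ¬ isSd v ∧ S.valid n.2 v := by
  cases h with
  | wire p x y w a h1 h2 h3 =>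
    refine ⟨h1, id, ?_⟩
    cases x <;> simp [pred, valid] at h2 ⊢
  | gate p r a b c h => exact ⟨trivial, id, h⟩
  | busA p r a =>
    have := S.pW_ge r
    have := S.pW_le r
    exact ⟨by simp only [ok]; omega, id, trivial⟩
  | busU p f w a h1 h2 => exact ⟨by simp only [ok]; omega, id, trivial⟩
  | busD p f w a h1 h2 => exact ⟨by simp only [ok]; omega, id, trivial⟩

theorem SeedOk.wf {ν0 : NSt F Rl Q} (h : S.SeedOk ν0) : S.WF ν0 := fun p x v hv =>
  ⟨(h p x v hv).1, (h p x v hv).2.1⟩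

theorem Reach.wf {ν ν' : NSt F Rl Q} (h : S.WF ν) (hr : S.ngs.Reach ν ν') : S.WF ν' := by
  intro p x v hv
  have hs := hr.2 (p, x) (by simp [hv])
  cases hs with
  | base h0 => exact h p x v (hr.1.eq_of hv h0)
  | step hv' hrule _ _ =>
    rw [hv] at hv'; cases hv'
    have := hrule.ok_not_sd
    exact ⟨this.1, this.2.2⟩

theorem sd_base {ν ν' : NSt F Rl Q} (hle : Le ν ν') {n v} (hs : S.ngs.Supp ν ν' n) (hv : ν' n = some v)
    (hsd : isSd v) : ν n = some v := by
  cases hs with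
  | base h0 => exact hle.eq_of hv h0
  | step hv' hrule _ _ =>
    rw [hv] at hv'; cases hv'
    exact absurd hsd hrule.ok_not_sd.2.1

/-! ## The universal tile set -/
variable [Finite Q]

theorem finite_ok : {x : Nd F Rl | S.ok x}.Finite := by
  let C : Set (List ℕ) := Set.range (fun t : Fin 3 × Fin 8 × Fin 8000 × Fin 8000 × Fin 8000 =>
    if t.1 = 0 then [t.2.1.val, t.2.2.1.val] else if t.1 = 1 then [t.2.1.val, t.2.2.1.val, t.2.2.2.1.val]
    else [t.2.1.val, t.2.2.1.val, t.2.2.2.1.val, t.2.2.2.2.val])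
  refine Set.Finite.of_finite_image (f := S.code) ?_ S.code_inj.injOn
  refine (Set.finite_range _ : C.Finite).subset ?_
  rintro _ ⟨x, hx, rfl⟩
  have key : ∀ a b c d, a < 8 → b < 8000 → c < 8000 → d < 8000 → ∀ l : List ℕ,
    (l = [a, b] ∨ l = [a,b,c] ∨ l = [a,b,c,d]) → l ∈ C := by
    intro a b c d ha hb hc hd l hl
    rcases hl with rfl | rfl | rfl
    · exact ⟨(0, ⟨a, ha⟩, ⟨b, hb⟩, ⟨c, hc⟩, ⟨d, hd⟩), by simp⟩
    · exact ⟨(1, ⟨a, ha⟩, ⟨b, hb⟩, ⟨c, hc⟩, ⟨d, hd⟩), by simp⟩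
    · exact ⟨(2, ⟨a, ha⟩, ⟨b, hb⟩, ⟨c, hc⟩, ⟨d, hd⟩), by simp⟩
  have kb : ∀ b : Bool, b.toNat < 8000 := by intro b; cases b <;> simp
  show S.code x ∈ C
  cases x with
  | bus f w =>
    have := S.iF_lt f; simp only [Set.mem_setOf_eq, ok] at hx
    exact key 0 (S.iF f) w 0 (by omega) (by omega) (by omega) (by omega) _ (by simp [code])
  | off f =>
    have := S.iF_lt f
    exact key 1 (S.iF f) 0 0 (by omega) (by omega) (by omega) (by omega) _ (by simp [code])
  | tr f w =>
    have := S.iF_lt f; simp only [Set.mem_setOf_eq, ok] at hx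
    exact key 2 (S.iF f) w 0 (by omega) (by omega) (by omega) (by omega) _ (by simp [code])
  | pr r b u =>
    have := S.iR_lt r; simp only [Set.mem_setOf_eq, ok] at hx
    exact key 3 (S.iR r) b.toNat u (by omega) (by omega) (kb b) (by omega) _ (by simp [code])
  | gate r =>
    have := S.iR_lt r
    exact key 4 (S.iR r) 0 0 (by omega) (by omega) (by omega) (by omega) _ (by simp [code])
  | out r j =>
    have := S.iR_lt r; have := S.len_lt r; simp only [Set.mem_setOf_eq, ok] at hx
    exact key 5 (S.iR r) j 0 (by omega) (by omega) (by omega) (by omega) _ (by simp [code])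
  | arm r b =>
    have := S.iR_lt r
    exact key 6 (S.iR r) b.toNat 0 (by omega) (by omega) (kb b) (by omega) _ (by simp [code])
  | rod u v w =>
    simp only [Set.mem_setOf_eq, ok] at hx
    exact key 7 u v w (by omega) (by omega) (by omega) (by omega) _ (by simp [code])

theorem finite_val : Finite (Val Q) := by
  let f : Val Q → (Q ⊕ (Q × Q × Q)) ⊕ ((Q × (Dir → Bool)) ⊕ (Dir → Bool))
    | .q a => .inl (.inl a)
    | .g a b c => .inl (.inr (a, b, c))
    | .sd a fl => .inr (.inl (a, fl))
    | .rod fl => .inr (.inr fl)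
  refine Finite.of_injective f ?_
  intro x y h
  cases x <;> cases y <;> simp [f] at h ⊢ <;> exact h

def tset : Set (TileType 3) := {t | ∃ x v, S.ok x ∧ S.valid x v ∧ t = S.tile x v}

theorem tset_finite : S.tset.Finite := by
  haveI := finite_val (Q := Q)
  refine ((S.finite_ok.prod (Set.finite_univ (α := Val Q))).image (fun n => S.tile n.1 n.2)).subset ?_
  rintro t ⟨x, v, hx, _, rfl⟩
  exact ⟨(x, v), ⟨hx, trivial⟩, rfl⟩

def U : Finset (TileType 3) := S.tset_finite.toFinset

theorem mem_U {t} : t ∈ S.U ↔ ∃ x v, S.ok x ∧ S.valid x v ∧ t = S.tile x v := by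
  simp [U, tset]

def realize (ν : NSt F Rl Q) : Config 3 := fun z =>
  if h : ∃ n v, S.ok n.2 ∧ ν n = some v ∧ z = S.loc n then
    some (S.tile (Classical.choose h).2 (Classical.choose (Classical.choose_spec h))) else none

theorem realize_some {ν : NSt F Rl Q} {p x v} (hx : S.ok x) (h : ν (p, x) = some v) :
    S.realize ν (S.loc (p, x)) = some (S.tile x v) := by
  have hh : ∃ n v, S.ok n.2 ∧ ν n = some v ∧ S.loc (p, x) = S.loc n := ⟨(p, x), v, hx, h, rfl⟩
  unfold realize
  rw [dif_pos hh]
  have h1 := Classical.choose_spec (Classical.choose_spec hh)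
  generalize Classical.choose (Classical.choose_spec hh) = v' at h1 ⊢
  generalize Classical.choose hh = n at h1 ⊢
  obtain ⟨p', x'⟩ := n
  obtain ⟨rfl, rfl⟩ := S.loc_inj hx h1.1 h1.2.2
  have h4 := h1.2.1
  rw [h] at h4
  cases h4
  rfl

theorem realize_inv {ν : NSt F Rl Q} {z t} (h : S.realize ν z = some t) :
    ∃ p x v, S.ok x ∧ ν (p, x) = some v ∧ z = S.loc (p, x) ∧ t = S.tile x v := by
  unfold realize at h
  split_ifs at h with hh
  have h1 := Classical.choose_spec (Classical.choose_spec hh)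
  simp only [Option.some.injEq] at h
  exact ⟨_, _, _, h1.1, h1.2.1, h1.2.2, h.symm⟩

def absn (α : Config 3) : NSt F Rl Q := fun n =>
  if h : ∃ v, S.ok n.2 ∧ S.valid n.2 v ∧ α (S.loc n) = some (S.tile n.2 v) then
    some (Classical.choose h) else none

theorem absn_iff {α : Config 3} {p x v} : S.absn α (p, x) = some v ↔
    S.ok x ∧ S.valid x v ∧ α (S.loc (p, x)) = some (S.tile x v) := by
  unfold absn
  constructor
  · intro h
    split_ifs at h with hh
    simp only [Option.some.injEq] at h
    rw [← h]
    exact Classical.choose_spec hh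
  · intro h
    have hh : ∃ v, S.ok x ∧ S.valid x v ∧ α (S.loc (p, x)) = some (S.tile x v) := ⟨v, h⟩
    rw [dif_pos hh]
    have h1 := Classical.choose_spec hh
    simp only [Option.some.injEq]
    refine S.tile_inj h.1 h1.2.1 h.2.1 ?_
    have := h1.2.2.symm.trans h.2.2
    simpa using this

theorem absn_realize {ν : NSt F Rl Q} (hν : S.WF ν) : S.absn (S.realize ν) = ν := by
  refine (Le.antisymm (a := ν) ?_ ?_).symm
  · rintro ⟨p, x⟩ v h
    exact S.absn_iff.2 ⟨(hν _ _ _ h).1, (hν _ _ _ h).2, S.realize_some (hν _ _ _ h).1 h⟩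
  · rintro ⟨p, x⟩ h
    obtain ⟨v, hv⟩ := Option.ne_none_iff_exists'.1 h
    rw [absn_iff] at hv
    obtain ⟨p', x', v', h1, h2, h3, h4⟩ := S.realize_inv hv.2.2
    obtain ⟨rfl, rfl⟩ := S.loc_inj hv.1 h1 h3
    simp [h2]

theorem absn_mono {α β : Config 3} (h : Le α β) : Le (S.absn α) (S.absn β) := by
  rintro ⟨p, x⟩ v hv
  rw [absn_iff] at hv ⊢
  exact ⟨hv.1, hv.2.1, h _ _ hv.2.2⟩

theorem realize_mono {ν ν' : NSt F Rl Q} (h : Le ν ν') : Le (S.realize ν) (S.realize ν') := by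
  intro z t hz
  obtain ⟨p, x, v, h1, h2, rfl, rfl⟩ := S.realize_inv hz
  exact S.realize_some h1 (h _ _ h2)

theorem realize_le {ν ν' : NSt F Rl Q} (hν : S.WF ν) (hν' : S.WF ν')
    (h : Le (S.realize ν) (S.realize ν')) : Le ν ν' := by
  have := S.absn_mono h
  rwa [S.absn_realize hν, S.absn_realize hν'] at this

/-! ### bonds along edges -/

theorem vfl_not_sd {v : Val Q} (h : ¬ isSd v) (δ : Dir) : vfl v δ = false := by
  cases h1 : vfl v δ
  · rfl
  · exact absurd (vfl_isSd h1) h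

theorem bond_edge {x y : Nd F Rl} {v w : Val Q} {a} (p : Pt 3) (hx : S.ok x) (hy : S.ok y)
    (hs : 0 < S.str y x) (hv : ¬ isSd v) (hw : S.valid y w) (hq : qv w = some a) (hi : inn y v = some a) :
    bond (S.tile x v) (S.tile y w) (S.loc (p + S.shf y x, x)) (S.loc (p, y)) = S.str y x := by
  obtain ⟨δ, e⟩ := S.str_adj hx hs
  refine S.bond_fwd hx hy hs e ?_ (vfl_not_sd hv _) hq hi
  by_cases hsd : isSd w
  · rcases S.sd_valid hw hsd with ⟨f, rfl⟩ | ⟨u, v', w', rfl⟩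
    · have hd : δ = (0, true) := by
        rcases S.str_cases hs with ⟨hp, _, hsh⟩ | ⟨r, b, e1, _⟩ | ⟨r, b, e1, _⟩ | ⟨f', w', e1, _⟩
        · cases x with
          | tr f' k =>
            simp only [pred, Option.some.injEq, ok] at hp hx
            split_ifs at hp with hk
            · cases hp
              have hk1 : k = 1 := by omega
              subst hk1
              rw [hsh] at e
              refine dv_inj (add_left_cancel (a := S.abs (.off f)) (e.trans ?_))
              simp only [loc, smul_zero, zero_add]
              refine mk3_ext ?_ ?_ ?_ <;> simp [abs, dv, sg, mk3_zero, mk3_one, mk3_two]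
              ring
          | pr r b u =>
            simp only [pred, Option.some.injEq] at hp
            split_ifs at hp
          | out r j =>
            simp only [pred, Option.some.injEq] at hp
            split_ifs at hp
          | _ => simp [pred] at hp
        · cases e1
        · cases e1
        · cases e1
      subst hd
      cases w <;> simp [valid, isSd, vfl] at hw hsd ⊢
      exact hw
    · cases w <;> simp [valid, qv] at hw hq
  · exact vfl_not_sd hsd _

/-! ### U1 -/

theorem u1_supp {ν0 ν ν' : NSt F Rl Q} (hν : S.WF ν) {n}
    (h : S.ngs.Supp ν0 ν n) (hν0 : S.WF ν0) : (tgs S.U 2).Supp (S.realize ν0) (S.realize ν) (S.loc n) := by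
  induction h with
  | @base n h0 =>
    obtain ⟨p, x⟩ := n
    obtain ⟨v, hv⟩ := Option.ne_none_iff_exists'.1 h0
    exact .base (by rw [S.realize_some (hν0 _ _ _ hv).1 hv]; simp)
  | @step n v H hv hr hH hS ih =>
    obtain ⟨p, x⟩ := n
    have hov := NRule.ok_not_sd S hr
    have hz := S.realize_some hov.1 hv
    -- one premise
    have one : ∀ y w, ((p, y), w) ∈ H → 2 ≤ bond (S.tile x v) (S.tile y w) (S.loc (p, x)) (S.loc (p, y)) →
        (tgs S.U 2).Supp (S.realize ν0) (S.realize ν) (S.loc (p, x)) := by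
      intro y w hm hb
      refine .step (H := {(S.loc (p, y), S.tile y w)}) hz ⟨S.mem_U.2 ⟨x, v, hov.1, hov.2.2, rfl⟩, ?_⟩ ?_ ?_
      · rw [Finset.sum_singleton]; exact hb
      · intro h hh
        rw [Finset.mem_singleton] at hh; subst hh
        exact S.realize_some (hν _ _ _ (hH _ hm)).1 (hH _ hm)
      · intro h hh
        rw [Finset.mem_singleton] at hh; subst hh
        exact ih _ hm
    have two : ∀ p' y1 w1 y2 w2, ((p', y1), w1) ∈ H → ((p', y2), w2) ∈ H → y1 ≠ y2 →
        1 ≤ bond (S.tile x v) (S.tile y1 w1) (S.loc (p, x)) (S.loc (p', y1)) →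
        1 ≤ bond (S.tile x v) (S.tile y2 w2) (S.loc (p, x)) (S.loc (p', y2)) →
        (tgs S.U 2).Supp (S.realize ν0) (S.realize ν) (S.loc (p, x)) := by
      intro p' y1 w1 y2 w2 hm1 hm2 hne hb1 hb2
      have o1 := (hν _ _ _ (hH _ hm1)).1
      have o2 := (hν _ _ _ (hH _ hm2)).1
      refine .step (H := {(S.loc (p', y1), S.tile y1 w1), (S.loc (p', y2), S.tile y2 w2)}) hz
        ⟨S.mem_U.2 ⟨x, v, hov.1, hov.2.2, rfl⟩, ?_⟩ ?_ ?_
      · rw [Finset.sum_pair]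
        · exact Nat.add_le_add hb1 hb2
        · intro he
          exact hne (S.loc_inj o1 o2 (congrArg Prod.fst he)).2
      · intro h hh
        rw [Finset.mem_insert, Finset.mem_singleton] at hh
        rcases hh with rfl | rfl
        · exact S.realize_some o1 (hH _ hm1)
        · exact S.realize_some o2 (hH _ hm2)
      · intro h hh
        rw [Finset.mem_insert, Finset.mem_singleton] at hh
        rcases hh with rfl | rfl
        · exact ih _ hm1
        · exact ih _ hm2
    cases hr with
    | wire p x y w a h1 h2 h3 =>
      have hm : ((p, y), w) ∈ ({((p, y), w)} : Finset ((Pt 3 × Nd F Rl) × Val Q)) := by simp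
      have hw := hν _ _ _ (hH _ hm)
      refine one y w hm ?_
      have hs := S.str_pred h2
      have hsh : S.shf y x = 0 := by
        rcases S.str_cases (by rw [hs]; simp : 0 < S.str y x) with h | ⟨_, _, _, _, h, _⟩ | ⟨_, _, _, _, h, _⟩ | ⟨_, _, rfl, rfl, _, h⟩
        · exact h.2.2
        · omega
        · omega
        · exact h
      have := S.bond_edge (v := .q a) p h1 hw.1 (by rw [hs]; simp) id hw.2 h3 rfl
      rw [hsh, add_zero] at this
      rw [this, hs]
    | gate p r a b c hrel =>
      have hm1 : ((p, .pr r false 400), .q a) ∈ ({((p, .pr r false 400), .q a), ((p, .pr r true 400), .q b)} : Finset ((Pt 3 × Nd F Rl) × Val Q)) := by simp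
      have hm2 : ((p, .pr r true 400), .q b) ∈ ({((p, .pr r false 400), .q a), ((p, .pr r true 400), .q b)} : Finset ((Pt 3 × Nd F Rl) × Val Q)) := by simp
      have hw1 := hν _ _ _ (hH _ hm1)
      have hw2 := hν _ _ _ (hH _ hm2)
      have e1 := S.bond_edge (v := .g a b c) p hov.1 hw1.1 (by rw [S.str_gate]; simp) id hw1.2 (a := a) rfl rfl
      have e2 := S.bond_edge (v := .g a b c) p hov.1 hw2.1 (by rw [S.str_gate]; simp) id hw2.2 (a := b) rfl rfl
      simp only [shf, add_zero, str_gate] at e1 e2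
      exact two p _ _ _ _ hm1 hm2 (by simp) e1.ge e2.ge
    | busA p r a =>
      have hm1 : ((p, .arm r false), .q a) ∈ ({((p, .arm r false), .q a), ((p, .arm r true), .q a)} : Finset ((Pt 3 × Nd F Rl) × Val Q)) := by simp
      have hm2 : ((p, .arm r true), .q a) ∈ ({((p, .arm r false), .q a), ((p, .arm r true), .q a)} : Finset ((Pt 3 × Nd F Rl) × Val Q)) := by simp
      have hw1 := hν _ _ _ (hH _ hm1)
      have hw2 := hν _ _ _ (hH _ hm2)
      have e1 := S.bond_edge (v := .q a) p hov.1 hw1.1 (by rw [S.str_arm]; simp) id hw1.2 (a := a) rfl rfl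
      have e2 := S.bond_edge (v := .q a) p hov.1 hw2.1 (by rw [S.str_arm]; simp) id hw2.2 (a := a) rfl rfl
      simp only [shf, str_arm] at e1 e2
      exact two p _ _ _ _ hm1 hm2 (by simp) e1.ge e2.ge
    | busU p f w a h1 h2 =>
      have hm : ((p, .bus f w), .q a) ∈ ({((p, .bus f w), .q a)} : Finset ((Pt 3 × Nd F Rl) × Val Q)) := by simp
      have hw := hν _ _ _ (hH _ hm)
      have e1 := S.bond_edge (v := .q a) p hov.1 hw.1 (by rw [S.str_bus]; simp) id hw.2 (a := a) rfl rfl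
      simp only [shf, add_zero, str_bus] at e1
      exact one _ _ hm e1.ge
    | busD p f w a h1 h2 =>
      have hm : ((p, .bus f (w+1)), .q a) ∈ ({((p, .bus f (w+1)), .q a)} : Finset ((Pt 3 × Nd F Rl) × Val Q)) := by simp
      have hw := hν _ _ _ (hH _ hm)
      have e1 := S.bond_edge (x := .bus f (w+1)) (v := .q a) (w := .q a) p hw.1 hov.1 (by rw [S.str_bus]; simp) id hov.2.2 (a := a) rfl rfl
      simp only [shf, add_zero, str_bus] at e1
      rw [bond_symm] at e1
      exact one _ _ hm e1.ge

theorem u1 {ν ν' : NSt F Rl Q} (hν : S.WF ν) (h : S.ngs.Reach ν ν') :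
    (tgs S.U 2).Reach (S.realize ν) (S.realize ν') := by
  refine ⟨S.realize_mono h.1, fun z hz => ?_⟩
  obtain ⟨t, ht⟩ := Option.ne_none_iff_exists'.1 hz
  obtain ⟨p, x, v, h1, h2, rfl, rfl⟩ := S.realize_inv ht
  exact S.u1_supp (ν' := ν') (Reach.wf S hν h) (h.2 _ (by simp [h2])) hν

end LRS
end IU

namespace IU
variable {F Rl Q : Type}

namespace LRS
variable (S : LRS F Rl Q) [Finite Q]

theorem u4 {ν : NSt F Rl Q} (hν : S.WF ν) (h : (tgs S.U 2).Term (S.realize ν)) : S.ngs.Term ν := by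
  rintro ⟨p, x⟩ v hn hE
  have hr := GS.Reach.update hn hE
  have h1 := h.eq_of_reach (S.u1 hν hr)
  have hw := Reach.wf S hν hr
  have h2 := (S.absn_realize hw).symm.trans (by rw [h1, S.absn_realize hν] : _ = ν)
  have := congrFun h2 (p, x)
  simp [hn] at this


/-- if the value of a supported node takes an input from `x`, then `x` is supported -/
theorem supp_inn {ν0 ν : NSt F Rl Q} (hle : Le ν0 ν) (h0 : S.SeedOk ν0) {p p' : Pt 3} {x y : Nd F Rl} {w : Val Q} {a}
    (hs : S.ngs.Supp ν0 ν (p, y)) (hy : ν (p, y) = some w) (hp : S.pred y = some x ∨ ∃ r b, x = .pr r b 400 ∧ y = .gate r)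
    (hi : inn x w = some a) : S.ngs.Supp ν0 ν (p, x) := by
  cases hs with
  | base hb =>
    have := hle.eq_of hy hb
    exact absurd (h0 _ _ _ this).2.2.1 (inn_not_sd hi)
  | @step _ v H hv hr hH hS =>
    rw [hy] at hv; cases hv
    rcases hp with hp | ⟨r, b, rfl, rfl⟩
    · cases hr with
      | wire p _ y' w' a' h1 h2 h3 =>
        rw [hp] at h2; cases h2
        exact hS ((p, x), w') (by simp)
      | _ => simp [pred] at hp
    · cases hr with
      | wire p _ y' w' a' h1 h2 h3 => simp [pred] at h2
      | gate p r a b' c hrel =>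
        cases b
        · exact hS ((p, .pr r false 400), .q a) (by simp)
        · exact hS ((p, .pr r true 400), .q b') (by simp)

theorem two_of_sum {ι : Type} {H : Finset ι} {f : ι → ℕ} (h : 2 ≤ ∑ i ∈ H, f i) :
    (∃ i ∈ H, 2 ≤ f i) ∨ ∃ i ∈ H, ∃ j ∈ H, i ≠ j ∧ f i = 1 ∧ f j = 1 := by
  by_contra hc
  push Not at hc
  obtain ⟨h1, h2⟩ := hc
  by_cases hz : ∀ i ∈ H, f i = 0
  · rw [Finset.sum_eq_zero hz] at h; omega
  · push Not at hz
    obtain ⟨i, hi, hne⟩ := hz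
    have e1 : f i = 1 := by have := h1 i hi; omega
    rw [Finset.sum_eq_single_of_mem i hi] at h
    · omega
    · intro j hj hji
      have := h1 j hj
      have := h2 i hi j hj hji.symm e1
      omega

theorem u2_supp {ν0 : NSt F Rl Q} (h0 : S.SeedOk ν0) {α : Config 3}
    (hle : Le (S.realize ν0) α) {z} (h : (tgs S.U 2).Supp (S.realize ν0) α z) :
    ∃ p x v, z = S.loc (p, x) ∧ S.absn α (p, x) = some v ∧ S.ngs.Supp ν0 (S.absn α) (p, x) := by
  have hle' : Le ν0 (S.absn α) := by
    have := S.absn_mono hle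
    rwa [S.absn_realize (SeedOk.wf S h0)] at this
  have base : ∀ p x, ν0 (p, x) ≠ none →
      ∃ p' x' v, S.loc (p, x) = S.loc (p', x') ∧ S.absn α (p', x') = some v ∧ S.ngs.Supp ν0 (S.absn α) (p', x') := by
    intro p x hx
    obtain ⟨v, hv⟩ := Option.ne_none_iff_exists'.1 hx
    exact ⟨p, x, v, rfl, hle' _ _ hv, .base hx⟩
  induction h with
  | @base z hz =>
    obtain ⟨t, ht⟩ := Option.ne_none_iff_exists'.1 hz
    obtain ⟨p, x, v, h1, h2, rfl, rfl⟩ := S.realize_inv ht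
    exact base p x (by simp [h2])
  | @step z t H hz hr hH hS ih =>
    obtain ⟨htU, hsum⟩ := hr
    obtain ⟨x, v, hx, hv, rfl⟩ := S.mem_U.1 htU
    -- analysis of a single bond
    have ana : ∀ h ∈ H, 0 < bond (S.tile x v) h.2 z h.1 →
        (∃ p' x' v, z = S.loc (p', x') ∧ S.absn α (p', x') = some v ∧ S.ngs.Supp ν0 (S.absn α) (p', x')) ∨
        (bond (S.tile x v) h.2 z h.1 = 1 ∧
          ((∃ r b a p, x = .gate r ∧ z = S.loc (p, x) ∧ h.1 = S.loc (p, .pr r b 400) ∧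
            S.absn α (p, .pr r b 400) = some (.q a) ∧ S.ngs.Supp ν0 (S.absn α) (p, .pr r b 400) ∧
            inn (.pr r b 400 : Nd F Rl) v = some a) ∨
           (∃ r b a p, x = .bus (S.tgt r) (S.pW r) ∧ z = S.loc (p + ov (S.off r), x) ∧ h.1 = S.loc (p, .arm r b) ∧
            S.absn α (p, .arm r b) = some (.q a) ∧ S.ngs.Supp ν0 (S.absn α) (p, .arm r b) ∧ v = .q a) ∨
           (∃ r b p, x = .arm r b ∧ z = S.loc (p, x) ∧ h.1 = S.loc (p + ov (S.off r), .bus (S.tgt r) (S.pW r))))) := by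
      rintro ⟨z', t'⟩ hm hb
      obtain ⟨p, y, w, hz', hw, hsupp⟩ := ih _ hm
      dsimp only at hz' hb ⊢
      subst hz'
      have hw' := S.absn_iff.1 hw
      have := hH _ hm
      dsimp only at this
      rw [hw'.2.2] at this
      cases this
      rcases S.bond_inv hx hw'.1 (Nat.pos_iff_ne_zero.1 hb) with ⟨δ, f1, f2, e⟩ | ⟨a, hs, e, hq, hi, hbs⟩ |
        ⟨a, p', hs, hp', e, hi, hq, hbs⟩
      · left
        have hsd := vfl_isSd f2
        have hb0 := S.sd_base hle' hsupp hw hsd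
        obtain ⟨⟨p', x'⟩, hn', e'⟩ := ((h0 _ _ _ hb0).2.2.2 _).1 f2
        rw [e, ← e']
        exact base p' x' hn'
      · -- incoming
        have hxa : z = S.loc (p + S.shf y x, x) → S.absn α (p + S.shf y x, x) = some v := fun e =>
          S.absn_iff.2 ⟨hx, hv, by rw [← e]; exact hz⟩
        rcases S.str_cases hs with ⟨hp, _, hsh⟩ | ⟨r, b, rfl, rfl, hst, hsh⟩ | ⟨r, b, rfl, rfl, hst, hsh⟩ |
          ⟨f, k, rfl, rfl, hst, hsh⟩
        · left
          rw [hsh, add_zero] at e hxa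
          refine ⟨p, x, v, e, hxa e, ?_⟩
          obtain ⟨a', rfl⟩ := S.valid_q hv (inn_not_sd hi) (by rintro r rfl; simp [pred] at hp)
          simp only [inn, Option.some.injEq] at hi
          subst hi
          refine .step (hxa e) (NRule.wire p x y w a' hx hp hq) ?_ ?_
          · intro h hh; rw [Finset.mem_singleton] at hh; subst hh; exact hw
          · intro h hh; rw [Finset.mem_singleton] at hh; subst hh; exact hsupp
        · right
          refine ⟨by rw [hbs, hst], Or.inl ⟨r, b, a, p, rfl, by rw [e, hsh, add_zero], rfl, ?_, hsupp, hi⟩⟩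
          obtain ⟨a', rfl⟩ := S.valid_q hw'.2.1 (by
            intro hc; rcases S.sd_valid hw'.2.1 hc with ⟨_, h⟩ | ⟨_, _, _, h⟩ <;> cases h) (by rintro r h; cases h)
          simp only [qv, Option.some.injEq] at hq
          rw [hw, hq]
        · right
          refine ⟨by rw [hbs, hst], Or.inr (Or.inl ⟨r, b, a, p, rfl, by rw [e, hsh], rfl, ?_, hsupp, ?_⟩)⟩
          · obtain ⟨a', rfl⟩ := S.valid_q hw'.2.1 (by
              intro hc; rcases S.sd_valid hw'.2.1 hc with ⟨_, h⟩ | ⟨_, _, _, h⟩ <;> cases h) (by rintro r h; cases h)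
            simp only [qv, Option.some.injEq] at hq
            rw [hw, hq]
          · obtain ⟨a', rfl⟩ := S.valid_q hv (inn_not_sd hi) (by rintro r h; cases h)
            simp only [inn, Option.some.injEq] at hi
            rw [hi]
        · left
          rw [hsh, add_zero] at e hxa
          refine ⟨p, _, v, e, hxa e, ?_⟩
          obtain ⟨a', rfl⟩ := S.valid_q hv (inn_not_sd hi) (by rintro r h; cases h)
          simp only [inn, Option.some.injEq] at hi
          subst hi
          obtain ⟨b', rfl⟩ := S.valid_q hw'.2.1 (by
              intro hc; rcases S.sd_valid hw'.2.1 hc with ⟨_, h⟩ | ⟨_, _, _, h⟩ <;> cases h) (by rintro r h; cases h)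
          simp only [qv, Option.some.injEq] at hq
          subst hq
          have o1 := hw'.1
          simp only [ok] at o1 hx
          refine .step (hxa e) (NRule.busU p f k b' (by omega) (by omega)) ?_ ?_
          · intro h hh; rw [Finset.mem_singleton] at hh; subst hh; exact hw
          · intro h hh; rw [Finset.mem_singleton] at hh; subst hh; exact hsupp
      · -- outgoing
        have hxa : S.absn α (p', x) = some v := S.absn_iff.2 ⟨hx, hv, by rw [← e]; exact hz⟩
        rcases S.str_cases hs with ⟨hp, _, hsh⟩ | ⟨r, b, rfl, rfl, hst, hsh⟩ | ⟨r, b, rfl, rfl, hst, hsh⟩ |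
          ⟨f, k, rfl, rfl, hst, hsh⟩
        · left
          rw [hsh, add_zero] at hp'
          subst hp'
          exact ⟨p, x, v, e, hxa, S.supp_inn (p' := p) hle' h0 hsupp hw (Or.inl hp) hi⟩
        · left
          rw [hsh, add_zero] at hp'
          subst hp'
          exact ⟨p, _, v, e, hxa, S.supp_inn (p' := p) hle' h0 hsupp hw (Or.inr ⟨r, b, rfl, rfl⟩) hi⟩
        · right
          exact ⟨by rw [hbs, hst], Or.inr (Or.inr ⟨r, b, p', rfl, e, by rw [hp', hsh]⟩)⟩
        · left
          rw [hsh, add_zero] at hp'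
          subst hp'
          refine ⟨p, _, v, e, hxa, ?_⟩
          have nsd : ∀ {w : Val Q} {f k}, S.valid (.bus f k : Nd F Rl) w → ∃ a, w = .q a := by
            intro w f k hw
            exact S.valid_q hw (by
              intro hc; rcases S.sd_valid hw hc with ⟨_, h⟩ | ⟨_, _, _, h⟩ <;> cases h) (by rintro r h; cases h)
          obtain ⟨a', rfl⟩ := nsd hv
          obtain ⟨b', rfl⟩ := nsd hw'.2.1
          simp only [qv, inn, Option.some.injEq] at hq hi
          subst hq
          subst hi
          have o1 := hw'.1
          simp only [ok] at o1 hx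
          refine .step hxa (NRule.busD p f k b' (by omega) (by omega)) ?_ ?_
          · intro h hh; rw [Finset.mem_singleton] at hh; subst hh; exact hw
          · intro h hh; rw [Finset.mem_singleton] at hh; subst hh; exact hsupp
    rcases two_of_sum hsum with ⟨h, hm, hb⟩ | ⟨h, hm, h', hm', hne, hb, hb'⟩
    · rcases ana h hm (by omega) with hc | hc
      · exact hc
      · omega
    · have hne1 : h.1 ≠ h'.1 := by
        intro he
        have e1 := hH _ hm
        have e2 := hH _ hm'
        rw [he, e2] at e1
        exact hne (Prod.ext he (by simpa using e1.symm))
      rcases ana h hm (by omega) with hc | ⟨_, hc⟩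
      · exact hc
      rcases ana h' hm' (by omega) with hc' | ⟨_, hc'⟩
      · exact hc'
      rcases hc with ⟨r, b, a, p, rfl, ez, eh, q1, s1, i1⟩ | ⟨r, b, a, p, rfl, ez, eh, q1, s1, i1⟩ | ⟨r, b, p, rfl, ez, eh⟩ <;>
      rcases hc' with ⟨r', b', a', p', ex, ez', eh', q1', s1', i1'⟩ | ⟨r', b', a', p', ex, ez', eh', q1', s1', i1'⟩ | ⟨r', b', p', ex, ez', eh'⟩ <;>
      first | (cases ex; done) | skip
      · cases ex
        have hpp := (S.loc_inj hx hx (ez.symm.trans ez')).1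
        subst hpp
        obtain ⟨ga, gb, gc, rfl, hrel⟩ := S.valid_gate hv
        have hxa : S.absn α (p, .gate r) = some (.g ga gb gc) := S.absn_iff.2 ⟨hx, hv, by rw [← ez]; exact hz⟩
        have key : S.absn α (p, .pr r false 400) = some (.q ga) ∧ S.ngs.Supp ν0 (S.absn α) (p, .pr r false 400) ∧
          S.absn α (p, .pr r true 400) = some (.q gb) ∧ S.ngs.Supp ν0 (S.absn α) (p, .pr r true 400) := by
          simp only [inn, Option.some.injEq] at i1 i1'
          subst i1; subst i1'
          cases b <;> cases b'
          · exact absurd (eh.trans eh'.symm) hne1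
          · exact ⟨q1, s1, q1', s1'⟩
          · exact ⟨q1', s1', q1, s1⟩
          · exact absurd (eh.trans eh'.symm) hne1
        refine ⟨p, _, _, ez, hxa, .step hxa (NRule.gate p r ga gb gc hrel) ?_ ?_⟩
        · intro h hh
          rw [Finset.mem_insert, Finset.mem_singleton] at hh
          rcases hh with rfl | rfl
          · exact key.1
          · exact key.2.2.1
        · intro h hh
          rw [Finset.mem_insert, Finset.mem_singleton] at hh
          rcases hh with rfl | rfl
          · exact key.2.1
          · exact key.2.2.2
      · injection ex with e1 e2
        have hr : r = r' := S.pW_inj e2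
        subst hr
        have hpp := (S.loc_inj hx hx (ez.symm.trans ez')).1
        have hpp := add_right_cancel hpp
        subst hpp
        rw [i1] at i1'
        injection i1' with i2
        subst i2
        have hxa : S.absn α (p + ov (S.off r), .bus (S.tgt r) (S.pW r)) = some (.q a) := by
          rw [← i1]
          exact S.absn_iff.2 ⟨hx, hv, by rw [← ez]; exact hz⟩
        have key : S.absn α (p, .arm r false) = some (.q a) ∧ S.ngs.Supp ν0 (S.absn α) (p, .arm r false) ∧
          S.absn α (p, .arm r true) = some (.q a) ∧ S.ngs.Supp ν0 (S.absn α) (p, .arm r true) := by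
          cases b <;> cases b'
          · exact absurd (eh.trans eh'.symm) hne1
          · exact ⟨q1, s1, q1', s1'⟩
          · exact ⟨q1', s1', q1, s1⟩
          · exact absurd (eh.trans eh'.symm) hne1
        refine ⟨_, _, _, ez, hxa, .step hxa (NRule.busA p r a) ?_ ?_⟩
        · intro h hh
          rw [Finset.mem_insert, Finset.mem_singleton] at hh
          rcases hh with rfl | rfl
          · exact key.1
          · exact key.2.2.1
        · intro h hh
          rw [Finset.mem_insert, Finset.mem_singleton] at hh
          rcases hh with rfl | rfl
          · exact key.2.1
          · exact key.2.2.2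
      · cases ex
        have hpp := (S.loc_inj hx hx (ez.symm.trans ez')).1
        subst hpp
        exact absurd (eh.trans eh'.symm) hne1

theorem u2 {ν0 : NSt F Rl Q} (h0 : S.SeedOk ν0) {α : Config 3}
    (h : (tgs S.U 2).Reach (S.realize ν0) α) : ∃ ν, S.ngs.Reach ν0 ν ∧ S.realize ν = α := by
  have hle' : Le ν0 (S.absn α) := by
    have := S.absn_mono h.1
    rwa [S.absn_realize (SeedOk.wf S h0)] at this
  refine ⟨S.absn α, ⟨hle', ?_⟩, ?_⟩
  · rintro ⟨p, x⟩ hn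
    obtain ⟨v, hv⟩ := Option.ne_none_iff_exists'.1 hn
    have hv' := S.absn_iff.1 hv
    obtain ⟨p', x', v', e, h1, h2⟩ := S.u2_supp h0 h.1 (h.2 (S.loc (p, x)) (by rw [hv'.2.2]; simp))
    obtain ⟨rfl, rfl⟩ := S.loc_inj hv'.1 (S.absn_iff.1 h1).1 e
    exact h2
  · refine Le.antisymm ?_ ?_
    · intro z t hz
      obtain ⟨p, x, v, h1, h2, rfl, rfl⟩ := S.realize_inv hz
      exact (S.absn_iff.1 h2).2.2
    · intro z hz
      obtain ⟨p', x', v', e, h1, h2⟩ := S.u2_supp h0 h.1 (h.2 z hz)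
      rw [e, S.realize_some (S.absn_iff.1 h1).1 h1]
      simp

end LRS
end IU

namespace IU
variable {F Rl Q : Type}

theorem stable_of_connected {α : Config 3}
    (hb : ∀ a b, a ∈ dom α → b ∈ dom α → adj a b → 2 ≤ bondAt α a b)
    (hc : ConnectedSet (dom α)) : Stable 2 α := by
  intro A B hA hB hd hu
  obtain ⟨a, ha⟩ := hA
  obtain ⟨b, hb'⟩ := hB
  have had : a ∈ dom α := hu ▸ Or.inl ha
  have hbd : b ∈ dom α := hu ▸ Or.inr hb'
  have key : ∃ x y, x ∈ A ∧ y ∈ B ∧ adj x y := by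
    have h := hc a had b hbd
    by_contra hcon
    push Not at hcon
    have : b ∈ A := by
      clear hb' hbd
      induction h with
      | refl => exact ha
      | tail h1 h2 ih =>
        rename_i y z
        have hz : z ∈ A ∪ B := hu ▸ h2.2.2
        rcases hz with hz | hz
        · exact hz
        · exact absurd h2.1 (hcon _ _ ih hz)
    exact Set.disjoint_left.1 hd this hb'
  obtain ⟨x, y, hx, hy, hxy⟩ := key
  refine ⟨{(x, y)}, ?_, ?_⟩
  · intro e he
    rw [Finset.mem_singleton] at he
    subst he
    exact ⟨hx, hy⟩
  · rw [Finset.sum_singleton]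
    exact hb x y (hu ▸ Or.inl hx) (hu ▸ Or.inr hy) hxy

namespace LRS
variable (S : LRS F Rl Q) [Finite Q]

def pres (D : Set (Pt 3)) (s0 : St (Pt 3 × F) Q) (n : Pt 3 × Nd F Rl) : Prop :=
  match n.2 with
  | .off f => s0 (n.1, f) ≠ none
  | .rod u v w => n.1 ∈ D ∧ S.ok (.rod u v w)
  | _ => False

def sfl (D : Set (Pt 3)) (s0 : St (Pt 3 × F) Q) (n : Pt 3 × Nd F Rl) (δ : Dir) : Bool :=
  decide (∃ n', S.pres D s0 n' ∧ S.loc n' = S.loc n + dv δ)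

def seedN (D : Set (Pt 3)) (s0 : St (Pt 3 × F) Q) : NSt F Rl Q := fun n =>
  match n.2 with
  | .off f => (s0 (n.1, f)).map (fun a => .sd a (S.sfl D s0 n))
  | .rod u v w => if n.1 ∈ D ∧ S.ok (.rod u v w) then some (.rod (S.sfl D s0 n)) else none
  | _ => none

theorem seedN_ne (D : Set (Pt 3)) (s0 : St (Pt 3 × F) Q) (n) : S.seedN D s0 n ≠ none ↔ S.pres D s0 n := by
  obtain ⟨p, x⟩ := n
  cases x <;> simp [seedN, pres]

theorem pres_ok {D : Set (Pt 3)} {s0 : St (Pt 3 × F) Q} {n} (h : S.pres D s0 n) : S.ok n.2 := by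
  obtain ⟨p, x⟩ := n
  cases x <;> simp only [pres] at h
  · trivial
  · exact h.2

theorem seedN_val {D : Set (Pt 3)} {s0 : St (Pt 3 × F) Q} {n v} (h : S.seedN D s0 n = some v) :
    vfl v = S.sfl D s0 n ∧ isSd v := by
  obtain ⟨p, x⟩ := n
  cases x <;> simp [seedN] at h
  · obtain ⟨a, _, rfl⟩ := h
    exact ⟨rfl, trivial⟩
  · obtain ⟨_, rfl⟩ := h
    exact ⟨rfl, trivial⟩

theorem seedN_ok (D : Set (Pt 3)) (s0 : St (Pt 3 × F) Q) : S.SeedOk (S.seedN D s0) := by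
  intro p x v h
  have h1 := (S.seedN_ne D s0 (p, x)).1 (by simp [h])
  refine ⟨S.pres_ok h1, ?_, (S.seedN_val h).2, ?_⟩
  · cases x <;> simp [seedN] at h
    · rename_i f
      obtain ⟨a, _, rfl⟩ := h
      simp only [valid, sfl]
      rw [decide_eq_false_iff_not]
      rintro ⟨n', h2, h3⟩
      have e : S.loc (p, .tr f 1) = S.loc (p, .off f) + dv (0, true) := by
        simp only [loc, add_assoc]
        congr 1
        refine mk3_ext ?_ ?_ ?_ <;> simp [abs, dv, sg, mk3_zero, mk3_one, mk3_two]
        ring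
      have := S.loc_inj (p := n'.1) (x := n'.2) (q := p) (y := .tr f 1) (S.pres_ok h2) (by simp [ok]) (h3.trans e.symm)
      obtain ⟨p', x'⟩ := n'
      obtain ⟨rfl, rfl⟩ := this
      simp [pres] at h2
    · obtain ⟨_, rfl⟩ := h
      trivial
  · intro δ
    rw [(S.seedN_val h).1]
    simp only [sfl, decide_eq_true_eq, seedN_ne]

theorem dom_seed (D : Set (Pt 3)) (s0 : St (Pt 3 × F) Q) (z) :
    z ∈ dom (S.realize (S.seedN D s0)) ↔ ∃ n, S.pres D s0 n ∧ z = S.loc n := by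
  constructor
  · intro h
    obtain ⟨t, ht⟩ := Option.ne_none_iff_exists'.1 h
    obtain ⟨p, x, v, h1, h2, rfl, rfl⟩ := S.realize_inv ht
    exact ⟨(p, x), (S.seedN_ne D s0 _).1 (by simp [h2]), rfl⟩
  · rintro ⟨⟨p, x⟩, h, rfl⟩
    obtain ⟨v, hv⟩ := Option.ne_none_iff_exists'.1 ((S.seedN_ne D s0 _).2 h)
    show _ ≠ none
    rw [S.realize_some (S.pres_ok h) hv]; simp

theorem adj_symm {p q : Pt 3} (h : adj p q) : adj q p := by
  obtain ⟨δ, rfl⟩ := exists_dv_of_adj h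
  have := adj_dv (p + dv δ) (opp δ)
  rwa [dv_opp, add_neg_cancel_right] at this

theorem seed_conn (D : Set (Pt 3)) (s0 : St (Pt 3 × F) Q) (hs : ∀ p f, s0 (p, f) ≠ none → p ∈ D)
    (hD : ConnectedSet D) : ConnectedSet (dom (S.realize (S.seedN D s0))) := by
  set E := dom (S.realize (S.seedN D s0)) with hE
  let C := Relation.ReflTransGen (fun a b => adj a b ∧ a ∈ E ∧ b ∈ E)
  have hsymm : ∀ a b, C a b → C b a := fun a b h =>
    (@Relation.ReflTransGen.symmetric _ (fun a b => adj a b ∧ a ∈ E ∧ b ∈ E)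
      ⟨fun x y h => ⟨adj_symm h.1, h.2.2, h.2.1⟩⟩).symm _ _ h
  have step : ∀ n n' (δ : Dir), S.pres D s0 n → S.pres D s0 n' → S.loc n' = S.loc n + dv δ → C (S.loc n) (S.loc n') := by
    intro n n' δ h1 h2 e
    refine Relation.ReflTransGen.single ⟨?_, (S.dom_seed D s0 _).2 ⟨n, h1, rfl⟩, (S.dom_seed D s0 _).2 ⟨n', h2, rfl⟩⟩
    rw [e]; exact adj_dv _ _
  have pr : ∀ p u v w, p ∈ D → S.ok (.rod u v w : Nd F Rl) → S.pres D s0 (p, .rod u v w) := fun p u v w h1 h2 => ⟨h1, h2⟩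
  -- walks
  have wu : ∀ p, p ∈ D → ∀ v ≤ 3, ∀ u < 4000, C (S.loc (p, .rod 0 v 0)) (S.loc (p, .rod u v 0)) := by
    intro p hp v hv u
    induction u with
    | zero => intro _; exact .refl
    | succ u ih =>
      intro hu
      refine (ih (by omega)).trans (step _ _ (0, true) (pr _ _ _ _ hp ?_) (pr _ _ _ _ hp ?_) ?_)
      · refine ⟨by omega, by omega, by omega, by omega⟩
      · refine ⟨by omega, by omega, by omega, by omega⟩
      · simp only [loc, add_assoc]
        congr 1
        refine mk3_ext ?_ ?_ ?_ <;> simp [abs, dv, sg, mk3_zero, mk3_one, mk3_two]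
  have wv : ∀ p, p ∈ D → ∀ v < 4000, C (S.loc (p, .rod 0 0 0)) (S.loc (p, .rod 0 v 0)) := by
    intro p hp v
    induction v with
    | zero => intro _; exact .refl
    | succ u ih =>
      intro hu
      refine (ih (by omega)).trans (step _ _ (1, true) (pr _ _ _ _ hp ?_) (pr _ _ _ _ hp ?_) ?_)
      · refine ⟨by omega, by omega, by omega, by omega⟩
      · refine ⟨by omega, by omega, by omega, by omega⟩
      · simp only [loc, add_assoc]
        congr 1
        refine mk3_ext ?_ ?_ ?_ <;> simp [abs, dv, sg, mk3_zero, mk3_one, mk3_two]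
  have ww : ∀ p, p ∈ D → ∀ v < 4000, C (S.loc (p, .rod 0 0 0)) (S.loc (p, .rod 0 0 v)) := by
    intro p hp v
    induction v with
    | zero => intro _; exact .refl
    | succ u ih =>
      intro hu
      refine (ih (by omega)).trans (step _ _ (2, true) (pr _ _ _ _ hp ?_) (pr _ _ _ _ hp ?_) ?_)
      · refine ⟨by omega, by omega, by omega, by omega⟩
      · refine ⟨by omega, by omega, by omega, by omega⟩
      · simp only [loc, add_assoc]
        congr 1
        refine mk3_ext ?_ ?_ ?_ <;> simp [abs, dv, sg, mk3_zero, mk3_one, mk3_two]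
  have root : ∀ n, S.pres D s0 n → n.1 ∈ D ∧ C (S.loc (n.1, .rod 0 0 0)) (S.loc n) := by
    rintro ⟨p, x⟩ h
    cases x with
    | off f =>
      have hp := hs p f h
      refine ⟨hp, ?_⟩
      have hX := S.pX_le f
      refine ((wv p hp 3 (by omega)).trans (wu p hp 3 le_rfl (S.pX f + 1) (by omega))).trans
        (step _ _ (2, true) (pr _ _ _ _ hp (by refine ⟨by omega, by omega, by omega, by omega⟩)) h ?_)
      simp only [loc, add_assoc]
      congr 1
      refine mk3_ext ?_ ?_ ?_ <;> simp [abs, dv, sg, mk3_zero, mk3_one, mk3_two]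
    | rod u v w =>
      obtain ⟨hp, ho⟩ := h
      refine ⟨hp, ?_⟩
      simp only [ok] at ho
      obtain ⟨o1, o2, o3, o4⟩ := ho
      rcases o4 with ⟨rfl, hv⟩ | ⟨rfl, rfl⟩ | ⟨rfl, rfl⟩
      · exact (wv p hp v o2).trans (wu p hp v hv u o1)
      · exact ww p hp w o3
      · exact wv p hp v o2
    | _ => exact absurd h (by simp [pres])
  have clup : ∀ p (i : Fin 3), p ∈ D → p + dv (i, true) ∈ D → C (S.loc (p, .rod 0 0 0)) (S.loc (p + dv (i, true), .rod 0 0 0)) := by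
    intro p i hp hq
    have o0 : S.ok (.rod 0 0 0 : Nd F Rl) := by simp [ok]
    fin_cases i
    · refine (wu p hp 0 (by omega) 3999 (by omega)).trans (step _ _ (0, true) (pr _ _ _ _ hp (by simp [ok])) (pr _ _ _ _ hq o0) ?_)
      simp only [loc, smul_add, add_assoc]
      congr 1
      refine mk3_ext ?_ ?_ ?_ <;> simp [abs, dv, sg, mk3_zero, mk3_one, mk3_two]
    · refine (wv p hp 3999 (by omega)).trans (step _ _ (1, true) (pr _ _ _ _ hp (by simp [ok])) (pr _ _ _ _ hq o0) ?_)
      simp only [loc, smul_add, add_assoc]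
      congr 1
      refine mk3_ext ?_ ?_ ?_ <;> simp [abs, dv, sg, mk3_zero, mk3_one, mk3_two]
    · refine (ww p hp 3999 (by omega)).trans (step _ _ (2, true) (pr _ _ _ _ hp (by simp [ok])) (pr _ _ _ _ hq o0) ?_)
      simp only [loc, smul_add, add_assoc]
      congr 1
      refine mk3_ext ?_ ?_ ?_ <;> simp [abs, dv, sg, mk3_zero, mk3_one, mk3_two]
  have clus : ∀ p q, p ∈ D → q ∈ D → C (S.loc (p, .rod 0 0 0)) (S.loc (q, .rod 0 0 0)) := by
    intro p q hp hq
    have h := hD p hp q hq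
    clear hq
    induction h with
    | refl => exact .refl
    | tail h1 h2 ih =>
      rename_i y z
      refine Relation.ReflTransGen.trans ih ?_
      obtain ⟨ha, hy, hz⟩ := h2
      obtain ⟨⟨i, b⟩, rfl⟩ := exists_dv_of_adj ha
      cases b
      · have e : y + dv (i, false) + dv (i, true) = y := by
          have : dv (i, false) = - dv (i, true) := dv_opp (i, true)
          rw [this]; abel
        have := clup (y + dv (i, false)) i hz (by rw [e]; exact hy)
        rw [e] at this
        exact hsymm _ _ this
      · exact clup y i hy hz
  intro a ha b hb
  obtain ⟨n, hn, rfl⟩ := (S.dom_seed D s0 a).1 ha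
  obtain ⟨n', hn', rfl⟩ := (S.dom_seed D s0 b).1 hb
  obtain ⟨d1, c1⟩ := root n hn
  obtain ⟨d2, c2⟩ := root n' hn'
  exact ((hsymm _ _ c1).trans (clus _ _ d1 d2)).trans c2

theorem seed_bond (D : Set (Pt 3)) (s0 : St (Pt 3 × F) Q) (a b)
    (ha : a ∈ dom (S.realize (S.seedN D s0))) (hb : b ∈ dom (S.realize (S.seedN D s0))) (hab : adj a b) :
    2 ≤ bondAt (S.realize (S.seedN D s0)) a b := by
  obtain ⟨⟨p, x⟩, hn, rfl⟩ := (S.dom_seed D s0 a).1 ha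
  obtain ⟨⟨p', x'⟩, hn', rfl⟩ := (S.dom_seed D s0 b).1 hb
  obtain ⟨v, hv⟩ := Option.ne_none_iff_exists'.1 ((S.seedN_ne D s0 _).2 hn)
  obtain ⟨v', hv'⟩ := Option.ne_none_iff_exists'.1 ((S.seedN_ne D s0 _).2 hn')
  obtain ⟨δ, e⟩ := exists_dv_of_adj hab
  have f1 : vfl v δ = true := by
    rw [(S.seedN_val hv).1]
    simp only [sfl, decide_eq_true_eq]
    exact ⟨_, hn', e⟩
  have f2 : vfl v' (opp δ) = true := by
    rw [(S.seedN_val hv').1]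
    simp only [sfl, decide_eq_true_eq]
    exact ⟨_, hn, by rw [e, dv_opp]; abel⟩
  rw [bondAt_some (S.realize_some (S.pres_ok hn) hv) (S.realize_some (S.pres_ok hn') hv'), e, bond_dir,
    face_tile, face_tile, S.fc_sg f1, S.fc_sg f2]
  simp

/-- the simulating tile system -/
def simTAS (D : Set (Pt 3)) (s0 : St (Pt 3 × F) Q) (hs : ∀ p f, s0 (p, f) ≠ none → p ∈ D)
    (hD : ConnectedSet D) (hne : D.Nonempty) (hfin : D.Finite) : TAS 3 where
  tileset := S.U
  seed := S.realize (S.seedN D s0)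
  temp := 2
  temp_pos := by norm_num
  seed_nonempty := by
    obtain ⟨p, hp⟩ := hne
    exact ⟨_, (S.dom_seed D s0 _).2 ⟨(p, .rod 0 0 0), ⟨hp, by simp [ok]⟩, rfl⟩⟩
  seed_connected := S.seed_conn D s0 hs hD
  seed_finite := by
    refine ((hfin.prod S.finite_ok).image S.loc).subset ?_
    intro z hz
    obtain ⟨n, hn, rfl⟩ := (S.dom_seed D s0 z).1 hz
    refine ⟨n, ⟨?_, S.pres_ok hn⟩, rfl⟩
    obtain ⟨p, x⟩ := n
    cases x <;> simp only [pres] at hn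
    · exact hs _ _ hn
    · exact hn.1
  seed_tiles := by
    intro z t h
    obtain ⟨p, x, v, h1, h2, rfl, rfl⟩ := S.realize_inv h
    exact S.mem_U.2 ⟨x, v, h1, (S.seedN_ok D s0 _ _ _ h2).2.1, rfl⟩
  seed_stable := stable_of_connected (S.seed_bond D s0) (S.seed_conn D s0 hs hD)

end LRS
end IU

namespace IU
variable {F Rl Q : Type}

namespace LRS
variable (S : LRS F Rl Q)

/-! ## From node states to site states -/

def offS (ν : NSt F Rl Q) : St (Pt 3 × F) Q := fun x => (ν (x.1, .off x.2)).bind qv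

theorem offS_mono {ν ν' : NSt F Rl Q} (h : Le ν ν') : Le (offS ν) (offS ν') := by
  intro x a hx
  simp only [offS, Option.bind_eq_some_iff] at hx ⊢
  obtain ⟨v, h1, h2⟩ := hx
  exact ⟨v, h _ _ h1, h2⟩

theorem offS_some {ν : NSt F Rl Q} {p f v} (hν : S.WF ν) (h : ν (p, .off f) = some v) :
    ∃ a, qv v = some a ∧ offS ν (p, f) = some a := by
  have := (hν _ _ _ h).2
  have hq : ∃ a, qv v = some a := by cases v <;> simp [valid, qv] at this ⊢
  obtain ⟨a, ha⟩ := hq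
  exact ⟨a, ha, by simp [offS, h, ha]⟩

def Fired (ν : NSt F Rl Q) (P : Pt 3 × F → Prop) (r : Rl) (p : Pt 3) (c : Q) : Prop :=
  ∃ a b, offS ν (p, S.f1 r) = some a ∧ offS ν (p, S.f2 r) = some b ∧ S.rel r a b c ∧
    P (p, S.f1 r) ∧ P (p, S.f2 r)

def clm (ν : NSt F Rl Q) (P : Pt 3 × F → Prop) (p : Pt 3) (x : Nd F Rl) (v : Val Q) : Prop :=
  match x with
  | .off f => P (p, f)
  | .tr f _ => ∃ a, v = .q a ∧ offS ν (p, f) = some a ∧ P (p, f)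
  | .pr r b _ => ∃ a, v = .q a ∧ offS ν (p, S.fb r b) = some a ∧ P (p, S.fb r b)
  | .gate r => ∃ a b c, v = .g a b c ∧ offS ν (p, S.f1 r) = some a ∧ offS ν (p, S.f2 r) = some b ∧
      S.rel r a b c ∧ P (p, S.f1 r) ∧ P (p, S.f2 r)
  | .out r _ => ∃ c, v = .q c ∧ S.Fired ν P r p c ∧ ∃ a b, ν (p, .gate r) = some (.g a b c)
  | .arm r _ => ∃ c, v = .q c ∧ S.Fired ν P r p c ∧ ∃ a b, ν (p, .gate r) = some (.g a b c)
  | .bus f _ => ∃ c r p', v = .q c ∧ f = S.tgt r ∧ p = p' + ov (S.off r) ∧ S.Fired ν P r p' c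
  | .rod _ _ _ => True

theorem clm_mono {ν ν' : NSt F Rl Q} {P P' : Pt 3 × F → Prop} (hle : Le ν ν') (hP : ∀ x, P x → P' x)
    {p x v} (h : S.clm ν P p x v) : S.clm ν' P' p x v := by
  have ho := offS_mono hle
  have hF : ∀ {r p c}, S.Fired ν P r p c → S.Fired ν' P' r p c := by
    rintro r p c ⟨a, b, h1, h2, h3, h4, h5⟩
    exact ⟨a, b, ho _ _ h1, ho _ _ h2, h3, hP _ h4, hP _ h5⟩
  cases x with
  | off f => exact hP _ h
  | tr f w => obtain ⟨a, h1, h2, h3⟩ := h; exact ⟨a, h1, ho _ _ h2, hP _ h3⟩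
  | pr r b u => obtain ⟨a, h1, h2, h3⟩ := h; exact ⟨a, h1, ho _ _ h2, hP _ h3⟩
  | gate r =>
    obtain ⟨a, b, c, h1, h2, h3, h4, h5, h6⟩ := h
    exact ⟨a, b, c, h1, ho _ _ h2, ho _ _ h3, h4, hP _ h5, hP _ h6⟩
  | out r j => obtain ⟨c, h1, h2, a, b, h3⟩ := h; exact ⟨c, h1, hF h2, a, b, hle _ _ h3⟩
  | arm r j => obtain ⟨c, h1, h2, a, b, h3⟩ := h; exact ⟨c, h1, hF h2, a, b, hle _ _ h3⟩
  | bus f w => obtain ⟨c, r, p', h1, h2, h3, h4⟩ := h; exact ⟨c, r, p', h1, h2, h3, hF h4⟩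
  | rod u v w => trivial

theorem claims {ν0 ν : NSt F Rl Q} (hwf : S.WF ν) (hle : Le ν0 ν) (P : Pt 3 × F → Prop)
    (hbase : ∀ p x v, ν0 (p, x) = some v → S.clm ν P p x v)
    (hclosed : ∀ r p c, S.Fired ν P r p c → offS ν (p + ov (S.off r), S.tgt r) = some c →
      P (p + ov (S.off r), S.tgt r))
    {n} (h : S.ngs.Supp ν0 ν n) : ∀ v, ν n = some v → S.clm ν P n.1 n.2 v := by
  induction h with
  | @base n h0 =>
    intro v hv
    obtain ⟨p, x⟩ := n
    exact hbase p x v (hle.eq_of hv h0)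
  | @step n v H hv hr hH hS ih =>
    intro v' hv'
    rw [hv] at hv'; cases hv'
    cases hr with
    | wire p x y w a h1 h2 h3 =>
      have hm : ((p, y), w) ∈ ({((p, y), w)} : Finset ((Pt 3 × Nd F Rl) × Val Q)) := by simp
      have hw := hH _ hm
      have hc := ih _ hm w hw
      dsimp only at hw hc ⊢
      cases x with
      | bus f w => simp [pred] at h2
      | gate r => simp [pred] at h2
      | rod u v w => simp [pred] at h2
      | off f =>
        simp only [pred, Option.some.injEq] at h2
        subst h2
        obtain ⟨c, r, p', e1, rfl, rfl, hF⟩ := hc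
        rw [e1] at h3
        simp only [qv, Option.some.injEq] at h3
        subst h3
        exact hclosed r p' c hF (by simp [offS, hv, qv])
      | tr f k =>
        simp only [pred, Option.some.injEq] at h2
        subst h2
        split_ifs at hw hc with hk
        · obtain ⟨a', e1, e2⟩ := S.offS_some hwf hw
          rw [e1] at h3; cases h3
          exact ⟨a, rfl, e2, hc⟩
        · obtain ⟨a', rfl, e2, e3⟩ := hc
          simp only [qv, Option.some.injEq] at h3
          subst h3
          exact ⟨_, rfl, e2, e3⟩
      | pr r b u =>
        simp only [pred, Option.some.injEq] at h2
        subst h2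
        split_ifs at hw hc with hk
        · obtain ⟨a', rfl, e2, e3⟩ := hc
          simp only [qv, Option.some.injEq] at h3
          subst h3
          exact ⟨_, rfl, e2, e3⟩
        · obtain ⟨a', rfl, e2, e3⟩ := hc
          simp only [qv, Option.some.injEq] at h3
          subst h3
          exact ⟨_, rfl, e2, e3⟩
        · obtain ⟨a', rfl, e2, e3⟩ := hc
          simp only [qv, Option.some.injEq] at h3
          subst h3
          exact ⟨_, rfl, e2, e3⟩
      | out r j =>
        simp only [pred, Option.some.injEq] at h2
        subst h2
        split_ifs at hw hc with hk
        · obtain ⟨a', b', c', rfl, e⟩ := hc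
          simp only [qv, Option.some.injEq] at h3
          subst h3
          exact ⟨_, rfl, ⟨a', b', e⟩, a', b', hw⟩
        · obtain ⟨c', rfl, e⟩ := hc
          simp only [qv, Option.some.injEq] at h3
          subst h3
          exact ⟨_, rfl, e⟩
      | arm r b =>
        simp only [pred, Option.some.injEq] at h2
        subst h2
        obtain ⟨c', rfl, e⟩ := hc
        simp only [qv, Option.some.injEq] at h3
        subst h3
        exact ⟨_, rfl, e⟩
    | gate p r a b c hrel =>
      obtain ⟨a', e1, e2, e3⟩ := ih ((p, .pr r false 400), .q a) (by simp) _ (hH _ (by simp))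
      obtain ⟨b', f1, f2, f3⟩ := ih ((p, .pr r true 400), .q b) (by simp) _ (hH _ (by simp))
      cases e1; cases f1
      exact ⟨_, _, _, rfl, e2, f2, hrel, e3, f3⟩
    | busA p r a =>
      obtain ⟨c, e1, e2, _⟩ := ih ((p, .arm r false), .q a) (by simp) _ (hH _ (by simp))
      exact ⟨c, r, p, e1, rfl, rfl, e2⟩
    | busU p f w a h1 h2 => exact ih ((p, .bus f w), .q a) (by simp) _ (hH _ (by simp))
    | busD p f w a h1 h2 => exact ih ((p, .bus f (w+1)), .q a) (by simp) _ (hH _ (by simp))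

/-- seed states for the purpose of the abstraction -/
def SeedLike (ν0 : NSt F Rl Q) : Prop := S.WF ν0 ∧ ∀ p x v, ν0 (p, x) = some v → isSd v

/-- reachable states satisfy the claims with `P` = assigned -/
def Cl (ν : NSt F Rl Q) : Prop := S.WF ν ∧ ∀ p x v, ν (p, x) = some v → S.clm ν (fun y => offS ν y ≠ none) p x v

theorem cl_of_reach [Finite Q] {ν0 ν : NSt F Rl Q} (h0 : S.SeedLike ν0) (h : S.ngs.Reach ν0 ν) : S.Cl ν := by
  have hwf := Reach.wf S h0.1 h
  refine ⟨hwf, fun p x v hv => S.claims hwf h.1 _ ?_ ?_ (h.2 _ (by simp [hv])) v hv⟩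
  · intro p x v hv
    rcases S.sd_valid (h0.1 _ _ _ hv).2 (h0.2 _ _ _ hv) with ⟨f, rfl⟩ | ⟨_, _, _, rfl⟩
    · obtain ⟨a, _, h2⟩ := S.offS_some hwf (h.1 _ _ hv)
      show offS ν (p, f) ≠ none
      rw [h2]; simp
    · trivial
  · intro r p c _ h2
    rw [h2]; simp

/-- A1 -/
theorem off_reach {ν ν' : NSt F Rl Q} (h : S.Cl ν) (hr : S.ngs.Reach ν ν') :
    S.gs.Reach (offS ν) (offS ν') := by
  have hwf := Reach.wf S h.1 hr
  refine ⟨offS_mono hr.1, ?_⟩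
  rintro ⟨p, f⟩ hx
  have hx' : ν' (p, .off f) ≠ none := by
    intro hc; simp [offS, hc] at hx
  obtain ⟨v, hv⟩ := Option.ne_none_iff_exists'.1 hx'
  refine S.claims (n := (p, .off f)) hwf hr.1 (S.gs.Supp (offS ν) (offS ν')) ?_ ?_ (hr.2 _ hx') v hv
  · intro p x v hv
    exact S.clm_mono hr.1 (fun x hx => .base hx) (h.2 _ _ _ hv)
  · rintro r p c ⟨a, b, h1, h2, h3, h4, h5⟩ h6
    refine .step h6 ⟨r, p, a, b, rfl, h3, rfl⟩ ?_ ?_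
    · intro h hh
      rw [Finset.mem_insert, Finset.mem_singleton] at hh
      rcases hh with rfl | rfl
      · exact h1
      · exact h2
    · intro h hh
      rw [Finset.mem_insert, Finset.mem_singleton] at hh
      rcases hh with rfl | rfl
      · exact h4
      · exact h5

theorem en_of {s : St (Pt 3 × F) Q} {r p a b c} (h1 : s (p, S.f1 r) = some a) (h2 : s (p, S.f2 r) = some b)
    (h3 : S.rel r a b c) : S.gs.En s (p + ov (S.off r), S.tgt r) c := by
  refine ⟨_, ⟨r, p, a, b, rfl, h3, rfl⟩, ?_⟩
  intro h hh
  rw [Finset.mem_insert, Finset.mem_singleton] at hh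
  rcases hh with rfl | rfl
  · exact h1
  · exact h2

/-- A2 -/
theorem cube_claim {ν : NSt F Rl Q} (h : S.Cl ν) {p x v} (hv : ν (p, x) = some v) (c : Pt 3)
    (hc : ∀ i, S.loc (p, x) i / 4000 = c i) :
    (∃ f, offS ν (c, f) ≠ none ∨ ∃ v, S.gs.En (offS ν) (c, f) v) ∨ (c = p ∧ ∃ u v w, x = .rod u v w) := by
  have hcl := h.2 _ _ _ hv
  have hcc : c = p ∨ ∃ r, isTrans x r ∧ c = p + ov (S.off r) := by
    have e : ∀ i, S.loc (p, x) i / 4000 = p i + S.abs x i / 4000 := by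
      intro i
      simp only [loc, Pi.add_apply, Pi.smul_apply, smul_eq_mul]
      omega
    rcases S.cube_abs x (h.1 _ _ _ hv).1 with h1 | ⟨r, h1, h2⟩
    · left; funext i; rw [← hc i, e i, h1 i, add_zero]
    · right; exact ⟨r, h1, by funext i; rw [← hc i, e i, h2 i]; rfl⟩
  have nn : ∀ {y : Pt 3 × F} {a}, offS ν y = some a → offS ν y ≠ none := fun h => by rw [h]; simp
  rcases hcc with rfl | ⟨r, h1, rfl⟩
  · cases x with
    | off f => exact Or.inl ⟨f, Or.inl hcl⟩
    | tr f w => obtain ⟨a, _, h2, _⟩ := hcl; exact Or.inl ⟨f, Or.inl (nn h2)⟩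
    | pr r b u => obtain ⟨a, _, h2, _⟩ := hcl; exact Or.inl ⟨_, Or.inl (nn h2)⟩
    | gate r => obtain ⟨a, b, c', _, h2, _⟩ := hcl; exact Or.inl ⟨_, Or.inl (nn h2)⟩
    | out r j => obtain ⟨c', _, ⟨a, b, h2, _⟩, _⟩ := hcl; exact Or.inl ⟨_, Or.inl (nn h2)⟩
    | arm r j => obtain ⟨c', _, ⟨a, b, h2, _⟩, _⟩ := hcl; exact Or.inl ⟨_, Or.inl (nn h2)⟩
    | bus f w =>
      obtain ⟨c', r, p', _, rfl, rfl, a, b, h1, h2, h3, _⟩ := hcl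
      exact Or.inl ⟨_, Or.inr ⟨_, S.en_of h1 h2 h3⟩⟩
    | rod u v w => exact Or.inr ⟨rfl, _, _, _, rfl⟩
  · rcases h1 with ⟨j, rfl⟩ | ⟨j, rfl⟩
    · obtain ⟨c', _, ⟨a, b, h2, h3, h4, _⟩, _⟩ := hcl
      exact Or.inl ⟨_, Or.inr ⟨_, S.en_of h2 h3 h4⟩⟩
    · obtain ⟨c', _, ⟨a, b, h2, h3, h4, _⟩, _⟩ := hcl
      exact Or.inl ⟨_, Or.inr ⟨_, S.en_of h2 h3 h4⟩⟩

/-! ### chains of wires, abstract predicate version -/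

/-- A3 -/
theorem off_term {ν : NSt F Rl Q} (h : S.Cl ν) (ht : S.ngs.Term ν) : S.gs.Term (offS ν) := by
  have en : ∀ {n v H}, S.NRule n v H → (∀ h ∈ H, ν h.1 = some h.2) → ν n ≠ none := by
    intro n v H h1 h2 hn
    exact ht n v hn ⟨H, h1, h2⟩
  have wire : ∀ p x y, S.ok x → S.pred x = some y → (∃ w a, ν (p, y) = some w ∧ qv w = some a) →
      ∃ v, ν (p, x) = some v := by
    rintro p x y h1 h2 ⟨w, a, h3, h4⟩
    refine Option.ne_none_iff_exists'.1 (en (NRule.wire p x y w a h1 h2 h4) ?_)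
    intro h hh; rw [Finset.mem_singleton] at hh; subst hh; exact h3
  rintro ⟨pt, ft⟩ c0 hnone ⟨H, ⟨r, p, a, b, e, hrel, rfl⟩, hH⟩
  cases e
  have o1 := hH ((p, S.f1 r), a) (by simp)
  have o2 := hH ((p, S.f2 r), b) (by simp)
  dsimp only at o1 o2
  have trk : ∀ f a, offS ν (p, f) = some a → ∀ w, 1 ≤ w → w < 1600 → ν (p, .tr f w) = some (.q a) := by
    intro f a hf w
    have val : ∀ w v, ν (p, .tr f w) = some v → v = .q a := by
      intro w v hv
      obtain ⟨a', rfl, e, _⟩ := h.2 _ _ _ hv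
      rw [hf] at e; cases e; rfl
    induction w with
    | zero => intro h; omega
    | succ w ih =>
      intro h1 h2
      have : ∃ v, ν (p, .tr f (w+1)) = some v := by
        refine wire p _ _ (by simp only [ok]; omega) rfl ?_
        split_ifs with hw
        · simp only [offS, Option.bind_eq_some_iff] at hf
          obtain ⟨v, h1, h2⟩ := hf
          exact ⟨v, a, h1, h2⟩
        · exact ⟨_, a, ih (by omega) (by omega), rfl⟩
      obtain ⟨v, hv⟩ := this
      rw [hv, val _ _ hv]
  have prk : ∀ b' a, offS ν (p, S.fb r b') = some a → ∀ k, S.pX (S.fb r b') + 2 + k ≤ 400 →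
      ν (p, .pr r b' (S.pX (S.fb r b') + 2 + k)) = some (.q a) := by
    intro b' a hf k
    have val : ∀ w v, ν (p, .pr r b' w) = some v → v = .q a := by
      intro w v hv
      obtain ⟨a', rfl, e, _⟩ := h.2 _ _ _ hv
      rw [hf] at e; cases e; rfl
    have g1 := S.pW_ge r
    have g2 := S.pW_le r
    induction k with
    | zero =>
      intro h1
      have : ∃ v, ν (p, .pr r b' (S.pX (S.fb r b') + 2)) = some v := by
        refine wire p _ _ (by simp only [ok]; omega) rfl ?_
        rw [if_pos rfl]
        refine ⟨.q a, a, trk _ a hf _ ?_ ?_, rfl⟩ <;> split_ifs <;> omega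
      obtain ⟨v, hv⟩ := this
      rw [add_zero, hv, val _ _ hv]
    | succ k ih =>
      intro h1
      have : ∃ v, ν (p, .pr r b' (S.pX (S.fb r b') + 2 + (k+1))) = some v := by
        refine wire p _ _ (by simp only [ok]; omega) rfl ?_
        rw [if_neg (by omega)]
        exact ⟨.q a, a, ih (by omega), rfl⟩
      obtain ⟨v, hv⟩ := this
      rw [hv, val _ _ hv]
  have p1 : ν (p, .pr r false 400) = some (.q a) := by
    have := S.pX_le (S.fb r false)
    have h1 := prk false a o1 (400 - (S.pX (S.fb r false) + 2)) (by omega)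
    rwa [show S.pX (S.fb r false) + 2 + (400 - (S.pX (S.fb r false) + 2)) = 400 by omega] at h1
  have p2 : ν (p, .pr r true 400) = some (.q b) := by
    have := S.pX_le (S.fb r true)
    have h1 := prk true b o2 (400 - (S.pX (S.fb r true) + 2)) (by omega)
    rwa [show S.pX (S.fb r true) + 2 + (400 - (S.pX (S.fb r true) + 2)) = 400 by omega] at h1
  have gt : ∃ a b c, ν (p, .gate r) = some (.g a b c) := by
    obtain ⟨v, hv⟩ := Option.ne_none_iff_exists'.1 (en (NRule.gate p r a b c0 hrel) (by
      intro h hh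
      rw [Finset.mem_insert, Finset.mem_singleton] at hh
      rcases hh with rfl | rfl
      · exact p1
      · exact p2))
    obtain ⟨a, b, c, rfl, _⟩ := h.2 _ _ _ hv
    exact ⟨a, b, c, hv⟩
  obtain ⟨ga, gb, c1, hg⟩ := gt
  have outk : ∀ j < S.len r, ∃ c, ν (p, .out r j) = some (.q c) := by
    intro j
    have val : ∀ w v, ν (p, .out r w) = some v → ∃ c, v = .q c := by
      intro w v hv
      obtain ⟨a', rfl, e⟩ := h.2 _ _ _ hv
      exact ⟨_, rfl⟩
    induction j with
    | zero =>
      intro hj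
      obtain ⟨v, hv⟩ := wire p (.out r 0) _ hj rfl ⟨.g ga gb c1, c1, by simpa using hg, rfl⟩
      obtain ⟨c, rfl⟩ := val _ _ hv
      exact ⟨c, hv⟩
    | succ j ih =>
      intro hj
      obtain ⟨c, hc⟩ := ih (by omega)
      obtain ⟨v, hv⟩ := wire p (.out r (j+1)) _ hj rfl ⟨.q c, c, by simpa using hc, rfl⟩
      obtain ⟨c, rfl⟩ := val _ _ hv
      exact ⟨c, hv⟩
  have lp := S.len_pos r
  obtain ⟨c, hc⟩ := outk (S.len r - 1) (by omega)
  by_cases hbus : ∃ k v, ν (p + ov (S.off r), .bus (S.tgt r) k) = some v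
  swap
  · -- arms agree
    -- the arms carry the value of the last output node unless placed earlier with another value
    have armv : ∀ b', ν (p, .arm r b') = some (.q c1) := by
      intro b'
      obtain ⟨v, hv⟩ := wire p (.arm r b') _ trivial rfl ⟨.q c, c, hc, rfl⟩
      obtain ⟨d, rfl, _, a', b'', hg'⟩ := h.2 _ _ _ hv
      rw [hg] at hg'
      cases hg'
      exact hv
    exfalso
    obtain ⟨v, hv⟩ := Option.ne_none_iff_exists'.1 (en (NRule.busA p r c1) (by
      intro h hh
      rw [Finset.mem_insert, Finset.mem_singleton] at hh
      rcases hh with rfl | rfl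
      · exact armv false
      · exact armv true))
    exact hbus ⟨_, _, hv⟩
  · obtain ⟨k, v, hk⟩ := hbus
    have val : ∀ w v, ν (p + ov (S.off r), .bus (S.tgt r) w) = some v → ∃ c, v = .q c := by
      intro w v hv
      obtain ⟨a', _, _, rfl, e⟩ := h.2 _ _ _ hv
      exact ⟨_, rfl⟩
    have down : ∀ k v, ν (p + ov (S.off r), .bus (S.tgt r) (k+1)) = some v → ∃ v, ν (p + ov (S.off r), .bus (S.tgt r) 1) = some v := by
      intro k
      induction k with
      | zero => intro v hv; exact ⟨v, hv⟩
      | succ k ih =>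
        intro v hv
        have o := (h.1 _ _ _ hv).1
        simp only [ok] at o
        obtain ⟨d, rfl⟩ := val _ _ hv
        obtain ⟨v', hv'⟩ := Option.ne_none_iff_exists'.1 (en (NRule.busD (p + ov (S.off r)) (S.tgt r) (k+1) d (by omega) (by omega)) (by
          intro h hh; rw [Finset.mem_singleton] at hh; subst hh; exact hv))
        exact ih _ hv'
    have o := (h.1 _ _ _ hk).1
    simp only [ok] at o
    obtain ⟨k, rfl⟩ : ∃ k', k = k' + 1 := ⟨k - 1, by omega⟩
    obtain ⟨v', hv'⟩ := down k v hk
    obtain ⟨d, rfl⟩ := val _ _ hv'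
    obtain ⟨v, hv⟩ := wire (p + ov (S.off r)) (.off (S.tgt r)) _ trivial rfl ⟨_, d, hv', rfl⟩
    obtain ⟨a, _, h2⟩ := S.offS_some h.1 hv
    rw [h2] at hnone
    cases hnone

end LRS
end IU

namespace IU
variable {F Rl Q : Type}

namespace LRS
variable (S : LRS F Rl Q)

/-- the site responsible for a node -/
def owner : Pt 3 × Nd F Rl → Option (Pt 3 × F)
  | (p, .off f) => some (p, f)
  | (p, .tr f _) => some (p, f)
  | (p, .bus f _) => some (p, f)
  | (p, .pr r b _) => some (p, S.fb r b)
  | (p, .gate r) => some (p + ov (S.off r), S.tgt r)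
  | (p, .out r _) => some (p + ov (S.off r), S.tgt r)
  | (p, .arm r _) => some (p + ov (S.off r), S.tgt r)
  | (_, .rod _ _ _) => none

/-- no node exists on behalf of an unassigned site -/
def Good (ν : NSt F Rl Q) : Prop := ∀ n x, S.owner n = some x → offS ν x = none → ν n = none

def trim (Z : Set (Pt 3 × F)) (ν : NSt F Rl Q) : NSt F Rl Q := fun n =>
  if ∀ x, S.owner n = some x → x ∉ Z then ν n else none

theorem trim_le (Z : Set (Pt 3 × F)) (ν : NSt F Rl Q) : Le (S.trim Z ν) ν := by
  intro n v h
  simp only [trim] at h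
  split_ifs at h
  exact h

theorem offS_trim (Z : Set (Pt 3 × F)) (ν : NSt F Rl Q) (x) :
    offS (S.trim Z ν) x = if x ∈ Z then none else offS ν x := by
  by_cases h : x ∈ Z <;> simp [offS, trim, owner, h]

theorem trim_good {Z : Set (Pt 3 × F)} {ν : NSt F Rl Q} (hZ : ∀ x, offS ν x = none → x ∈ Z) :
    S.Good (S.trim Z ν) := by
  intro n x h1 h2
  rw [offS_trim] at h2
  have hx : x ∈ Z := by
    by_contra hc
    rw [if_neg hc] at h2
    exact hc (hZ x h2)
  simp only [trim]
  rw [if_neg]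
  intro h
  exact h x h1 hx

theorem trim_reach {Z : Set (Pt 3 × F)} {ν0 ν : NSt F Rl Q} (hr : S.ngs.Reach ν0 ν) (hc : S.Cl ν)
    (hsd : ∀ n v, ν0 n = some v → ∀ x, S.owner n = some x → x ∉ Z)
    (hcl : ∀ r p a b c, offS ν (p, S.f1 r) = some a → offS ν (p, S.f2 r) = some b → S.rel r a b c →
      (p + ov (S.off r), S.tgt r) ∉ Z → (p, S.f1 r) ∉ Z ∧ (p, S.f2 r) ∉ Z) :
    S.ngs.Reach ν0 (S.trim Z ν) := by
  refine ⟨?_, ?_⟩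
  · intro n v hv
    simp only [trim]
    rw [if_pos (hsd n v hv)]
    exact hr.1 _ _ hv
  · intro n hn
    have hk : ∀ x, S.owner n = some x → x ∉ Z := by
      by_contra hc
      simp only [trim] at hn
      rw [if_neg hc] at hn
      exact hn rfl
    have hn' : ν n ≠ none := (S.trim_le Z ν).ne hn
    have key : ∀ {n}, S.ngs.Supp ν0 ν n → (∀ x, S.owner n = some x → x ∉ Z) →
        S.ngs.Supp ν0 (S.trim Z ν) n := by
      intro n h
      induction h with
      | base h => intro _; exact .base h
      | @step n v H hv hru hH hS ih =>
        intro hk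
        have kk : ∀ h ∈ H, ∀ x, S.owner h.1 = some x → x ∉ Z := by
          cases hru with
          | wire p x y w a h1 h2 h3 =>
            intro h hh
            rw [Finset.mem_singleton] at hh
            subst hh
            have e : S.owner (p, y) = S.owner (p, x) := by
              cases x <;> simp only [pred, Option.some.injEq, reduceCtorEq] at h2 <;> subst h2
              · rfl
              · split_ifs <;> rfl
              · split_ifs <;> rfl
              · split_ifs <;> rfl
              · rfl
            rw [e]
            exact hk
          | gate p r a b c hrel =>
            obtain ⟨a', e1, e2, e3⟩ := hc.2 _ _ _ (hH ((p, .pr r false 400), .q a) (by simp))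
            obtain ⟨b', f1, f2, f3⟩ := hc.2 _ _ _ (hH ((p, .pr r true 400), .q b) (by simp))
            cases e1; cases f1
            have := hcl r p a b c e2 f2 hrel (hk _ rfl)
            intro h hh
            rw [Finset.mem_insert, Finset.mem_singleton] at hh
            rcases hh with rfl | rfl
            · intro x hx; cases hx; exact this.1
            · intro x hx; cases hx; exact this.2
          | busA p r a =>
            intro h hh
            rw [Finset.mem_insert, Finset.mem_singleton] at hh
            rcases hh with rfl | rfl
            · intro x hx; cases hx; exact hk _ rfl
            · intro x hx; cases hx; exact hk _ rfl
          | busU p f w a h1 h2 =>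
            intro h hh
            rw [Finset.mem_singleton] at hh
            subst hh
            intro x hx; cases hx; exact hk _ rfl
          | busD p f w a h1 h2 =>
            intro h hh
            rw [Finset.mem_singleton] at hh
            subst hh
            intro x hx; cases hx; exact hk _ rfl
        refine .step (v := v) (H := H) ?_ hru ?_ ?_
        · simp only [trim]; rw [if_pos hk]; exact hv
        · intro h hh
          simp only [trim]; rw [if_pos (kk h hh)]; exact hH h hh
        · intro h hh
          exact ih h hh (kk h hh)
    exact key (hr.2 n hn') hk

/-! ### A4: lifting growth of site states -/

def fireV (s' : St (Pt 3 × F) Q) (r : Rl) (p : Pt 3) : Option (Q × Q × Q) :=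
  match s' (p, S.f1 r), s' (p, S.f2 r), s' (p + ov (S.off r), S.tgt r) with
  | some a, some b, some c => if S.rel r a b c then some (a, b, c) else none
  | _, _, _ => none

theorem fireV_some {s' : St (Pt 3 × F) Q} {r p a b c} (h : S.fireV s' r p = some (a, b, c)) :
    s' (p, S.f1 r) = some a ∧ s' (p, S.f2 r) = some b ∧ s' (p + ov (S.off r), S.tgt r) = some c ∧
      S.rel r a b c := by
  unfold fireV at h
  split at h
  · rename_i h1 h2 h3
    split_ifs at h with h4
    simp only [Option.some.injEq, Prod.mk.injEq] at h
    obtain ⟨rfl, rfl, rfl⟩ := h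
    exact ⟨h1, h2, h3, h4⟩
  · cases h

theorem fireV_of {s' : St (Pt 3 × F) Q} {r p a b c} (h1 : s' (p, S.f1 r) = some a)
    (h2 : s' (p, S.f2 r) = some b) (h3 : s' (p + ov (S.off r), S.tgt r) = some c) (h4 : S.rel r a b c) :
    S.fireV s' r p = some (a, b, c) := by
  unfold fireV
  rw [h1, h2, h3]
  simp [h4]

def canon (s s' : St (Pt 3 × F) Q) : NSt F Rl Q
  | (p, .off f) => (s' (p, f)).map .q
  | (p, .tr f w) => if S.ok (.tr f w) then (s' (p, f)).map .q else none
  | (p, .bus f w) => if S.ok (.bus f w) ∧ s (p, f) = none then (s' (p, f)).map .q else none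
  | (p, .pr r b u) => if S.ok (.pr r b u) then (s' (p, S.fb r b)).map .q else none
  | (p, .gate r) => if s (p + ov (S.off r), S.tgt r) = none then
      (S.fireV s' r p).map (fun t => .g t.1 t.2.1 t.2.2) else none
  | (p, .out r j) => if S.ok (.out r j) ∧ s (p + ov (S.off r), S.tgt r) = none then
      (S.fireV s' r p).map (fun t => .q t.2.2) else none
  | (p, .arm r _) => if s (p + ov (S.off r), S.tgt r) = none then
      (S.fireV s' r p).map (fun t => .q t.2.2) else none
  | (_, .rod _ _ _) => none

def ext (ν : NSt F Rl Q) (s' : St (Pt 3 × F) Q) : NSt F Rl Q := fun n =>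
  if ν n = none then S.canon (offS ν) s' n else ν n

theorem ext_le (ν : NSt F Rl Q) (s' : St (Pt 3 × F) Q) : Le ν (S.ext ν s') := by
  intro n v h
  simp [ext, h]

section
variable {ν : NSt F Rl Q} {s' : St (Pt 3 × F) Q}

theorem offS_ext (hc : S.Cl ν) (hle : Le (offS ν) s') : offS (S.ext ν s') = s' := by
  funext ⟨p, f⟩
  by_cases h : ν (p, .off f) = none
  · simp only [offS, ext, h, canon, if_true]
    cases s' (p, f) <;> simp [qv]
  · obtain ⟨v, hv⟩ := Option.ne_none_iff_exists'.1 h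
    obtain ⟨a, h1, h2⟩ := S.offS_some hc.1 hv
    rw [hle _ _ h2]
    simp [offS, ext, hv, h1]

theorem ext_off (hc : S.Cl ν) (hle : Le (offS ν) s') {p f a} (h : s' (p, f) = some a) : ∃ w, S.ext ν s' (p, .off f) = some w ∧ qv w = some a := by
  have := congrFun (S.offS_ext hc hle) (p, f)
  rw [h] at this
  simpa only [offS, Option.bind_eq_some_iff] using this

theorem ext_tr (hc : S.Cl ν) (hle : Le (offS ν) s') {p f w a} (ho : S.ok (.tr f w : Nd F Rl)) (h : s' (p, f) = some a) :
    S.ext ν s' (p, .tr f w) = some (.q a) := by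
  cases hv : ν (p, .tr f w) with
  | none => simp [ext, hv, canon, ho, h]
  | some v =>
    obtain ⟨a', rfl, h2, _⟩ := hc.2 _ _ _ hv
    have := hle _ _ h2
    rw [h] at this
    cases this
    exact S.ext_le ν s' _ _ hv

theorem ext_pr (hc : S.Cl ν) (hle : Le (offS ν) s') {p r b u a} (ho : S.ok (.pr r b u : Nd F Rl)) (h : s' (p, S.fb r b) = some a) :
    S.ext ν s' (p, .pr r b u) = some (.q a) := by
  cases hv : ν (p, .pr r b u) with
  | none => simp [ext, hv, canon, ho, h]
  | some v =>
    obtain ⟨a', rfl, h2, _⟩ := hc.2 _ _ _ hv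
    have := hle _ _ h2
    rw [h] at this
    cases this
    exact S.ext_le ν s' _ _ hv

theorem supp_trpr (hc : S.Cl ν) (hle : Le (offS ν) s') {p f} (hS : S.ngs.Supp ν (S.ext ν s') (p, .off f)) (hs : s' (p, f) ≠ none) :
    ∀ w, 1 ≤ w → w < 1600 → S.ngs.Supp ν (S.ext ν s') (p, .tr f w) := by
  obtain ⟨a, ha⟩ := Option.ne_none_iff_exists'.1 hs
  intro w
  induction w with
  | zero => intro h; omega
  | succ w ih =>
    intro h1 h2
    have ho : S.ok (.tr f (w+1) : Nd F Rl) := by simp only [ok]; omega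
    by_cases hw : w = 0
    · subst hw
      obtain ⟨v, e1, e2⟩ := S.ext_off hc hle ha
      refine .step (S.ext_tr hc hle ho ha) (NRule.wire p _ (.off f) v a ho (by simp [pred]) e2) ?_ ?_
      · intro h hh; rw [Finset.mem_singleton] at hh; subst hh; exact e1
      · intro h hh; rw [Finset.mem_singleton] at hh; subst hh; exact hS
    · have ho' : S.ok (.tr f w : Nd F Rl) := by simp only [ok]; omega
      refine .step (S.ext_tr hc hle ho ha) (NRule.wire p _ (.tr f w) (.q a) a ho
        (by simp only [pred, Option.some.injEq]; rw [if_neg (by omega)]; rfl) rfl) ?_ ?_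
      · intro h hh; rw [Finset.mem_singleton] at hh; subst hh; exact S.ext_tr hc hle ho' ha
      · intro h hh; rw [Finset.mem_singleton] at hh; subst hh; exact ih (by omega) (by omega)

theorem supp_pr (hc : S.Cl ν) (hle : Le (offS ν) s') {p r b} (hS : S.ngs.Supp ν (S.ext ν s') (p, .off (S.fb r b))) (hs : s' (p, S.fb r b) ≠ none) :
    ∀ u, S.ok (.pr r b u : Nd F Rl) → S.ngs.Supp ν (S.ext ν s') (p, .pr r b u) := by
  obtain ⟨a, ha⟩ := Option.ne_none_iff_exists'.1 hs
  have g1 := S.pW_ge r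
  have g2 := S.pW_le r
  have key : ∀ k, S.pX (S.fb r b) + 2 + k ≤ 400 →
      S.ngs.Supp ν (S.ext ν s') (p, .pr r b (S.pX (S.fb r b) + 2 + k)) := by
    intro k
    induction k with
    | zero =>
      intro h
      have ho : S.ok (.pr r b (S.pX (S.fb r b) + 2 + 0) : Nd F Rl) := by simp only [ok]; omega
      have hw : 1 ≤ (if b then S.pW r + 1 else S.pW r - 1) ∧ (if b then S.pW r + 1 else S.pW r - 1) < 1600 := by
        split_ifs <;> omega
      refine .step (S.ext_pr hc hle ho ha) (NRule.wire p _ (.tr (S.fb r b) (if b then S.pW r + 1 else S.pW r - 1)) (.q a) a ho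
        (by simp [pred]) rfl) ?_ ?_
      · intro h hh; rw [Finset.mem_singleton] at hh; subst hh
        exact S.ext_tr hc hle (by simpa only [ok] using hw) ha
      · intro h hh; rw [Finset.mem_singleton] at hh; subst hh
        exact S.supp_trpr hc hle hS hs _ hw.1 hw.2
    | succ k ih =>
      intro h
      have ho : S.ok (.pr r b (S.pX (S.fb r b) + 2 + (k+1)) : Nd F Rl) := by simp only [ok]; omega
      have ho' : S.ok (.pr r b (S.pX (S.fb r b) + 2 + k) : Nd F Rl) := by simp only [ok]; omega
      refine .step (S.ext_pr hc hle ho ha) (NRule.wire p _ (.pr r b (S.pX (S.fb r b) + 2 + k)) (.q a) a ho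
        (by simp only [pred, Option.some.injEq]; rw [if_neg (by omega)]; rfl) rfl) ?_ ?_
      · intro h hh; rw [Finset.mem_singleton] at hh; subst hh
        exact S.ext_pr hc hle ho' ha
      · intro h hh; rw [Finset.mem_singleton] at hh; subst hh
        exact ih (by omega)
  intro u hu
  simp only [ok] at hu
  have := key (u - (S.pX (S.fb r b) + 2)) (by omega)
  rwa [show S.pX (S.fb r b) + 2 + (u - (S.pX (S.fb r b) + 2)) = u by omega] at this


theorem ext_new (_hc : S.Cl ν) (hg : S.Good ν) (_hle : Le (offS ν) s') {p r a b c} (hf : S.fireV s' r p = some (a, b, c))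
    (hn : offS ν (p + ov (S.off r), S.tgt r) = none) :
    S.ext ν s' (p, .gate r) = some (.g a b c) ∧ (∀ j < S.len r, S.ext ν s' (p, .out r j) = some (.q c)) ∧
    (∀ b', S.ext ν s' (p, .arm r b') = some (.q c)) := by
  refine ⟨?_, ?_, ?_⟩
  · have := hg (p, .gate r) _ rfl hn
    simp [ext, this, canon, hn, hf]
  · intro j hj
    have := hg (p, .out r j) _ rfl hn
    simp [ext, this, canon, hn, hf, ok, hj]
  · intro b'
    have := hg (p, .arm r b') _ rfl hn
    simp [ext, this, canon, hn, hf]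

theorem ext_bus (_hc : S.Cl ν) (hg : S.Good ν) (_hle : Le (offS ν) s') {p f w c} (hn : offS ν (p, f) = none) (h : s' (p, f) = some c)
    (hw : S.ok (.bus f w : Nd F Rl)) : S.ext ν s' (p, .bus f w) = some (.q c) := by
  have := hg (p, .bus f w) _ rfl hn
  simp [ext, this, canon, hn, h, hw]

theorem supp_new (hc : S.Cl ν) (hg : S.Good ν) (hle : Le (offS ν) s') {p r a b c} (hf : S.fireV s' r p = some (a, b, c))
    (hn : offS ν (p + ov (S.off r), S.tgt r) = none)
    (h1 : S.ngs.Supp ν (S.ext ν s') (p, .off (S.f1 r))) (h2 : S.ngs.Supp ν (S.ext ν s') (p, .off (S.f2 r))) :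
    S.ngs.Supp ν (S.ext ν s') (p, .gate r) ∧ (∀ j < S.len r, S.ngs.Supp ν (S.ext ν s') (p, .out r j)) ∧
    (∀ b', S.ngs.Supp ν (S.ext ν s') (p, .arm r b')) := by
  obtain ⟨e1, e2, e3, e4⟩ := S.fireV_some hf
  obtain ⟨n1, n2, n3⟩ := S.ext_new hc hg hle hf hn
  have g1 := S.pX_le (S.fb r false)
  have g2 := S.pX_le (S.fb r true)
  have o1 : S.ok (.pr r false 400 : Nd F Rl) := by simp only [ok]; omega
  have o2 : S.ok (.pr r true 400 : Nd F Rl) := by simp only [ok]; omega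
  have hgate : S.ngs.Supp ν (S.ext ν s') (p, .gate r) := by
    refine .step n1 (NRule.gate p r a b c e4) ?_ ?_
    · intro h hh
      rw [Finset.mem_insert, Finset.mem_singleton] at hh
      rcases hh with rfl | rfl
      · exact S.ext_pr hc hle o1 e1
      · exact S.ext_pr hc hle o2 e2
    · intro h hh
      rw [Finset.mem_insert, Finset.mem_singleton] at hh
      rcases hh with rfl | rfl
      · exact S.supp_pr hc hle (r := r) (b := false) h1 (by simp [fb, e1]) _ o1
      · exact S.supp_pr hc hle (r := r) (b := true) h2 (by simp [fb, e2]) _ o2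
  have hout : ∀ j < S.len r, S.ngs.Supp ν (S.ext ν s') (p, .out r j) := by
    intro j
    induction j with
    | zero =>
      intro hj
      refine .step (n2 _ hj) (NRule.wire p _ (.gate r) (.g a b c) c hj (by simp [pred]) rfl) ?_ ?_
      · intro h hh; rw [Finset.mem_singleton] at hh; subst hh; exact n1
      · intro h hh; rw [Finset.mem_singleton] at hh; subst hh; exact hgate
    | succ j ih =>
      intro hj
      refine .step (n2 _ hj) (NRule.wire p _ (.out r j) (.q c) c hj (by simp [pred]) rfl) ?_ ?_
      · intro h hh; rw [Finset.mem_singleton] at hh; subst hh; exact n2 _ (by omega)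
      · intro h hh; rw [Finset.mem_singleton] at hh; subst hh; exact ih (by omega)
  refine ⟨hgate, hout, fun b' => ?_⟩
  have := S.len_pos r
  refine .step (n3 b') (NRule.wire p _ (.out r (S.len r - 1)) (.q c) c trivial rfl rfl) ?_ ?_
  · intro h hh; rw [Finset.mem_singleton] at hh; subst hh; exact n2 _ (by omega)
  · intro h hh; rw [Finset.mem_singleton] at hh; subst hh; exact hout _ (by omega)

theorem supp_bus (hc : S.Cl ν) (hg : S.Good ν) (hle : Le (offS ν) s') {p f c w0} (hn : offS ν (p, f) = none) (h : s' (p, f) = some c)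
    (hw : S.ok (.bus f w0 : Nd F Rl)) (h0 : S.ngs.Supp ν (S.ext ν s') (p, .bus f w0)) :
    (∀ w, S.ok (.bus f w : Nd F Rl) → S.ngs.Supp ν (S.ext ν s') (p, .bus f w)) ∧
    S.ngs.Supp ν (S.ext ν s') (p, .off f) := by
  have hb : ∀ w, 1 ≤ w → w < 1600 → S.ext ν s' (p, .bus f w) = some (.q c) := fun w h1 h2 =>
    S.ext_bus hc hg hle hn h ⟨h1, h2⟩
  simp only [ok] at hw
  have up : ∀ k, w0 + k < 1600 → S.ngs.Supp ν (S.ext ν s') (p, .bus f (w0 + k)) := by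
    intro k
    induction k with
    | zero => intro _; exact h0
    | succ k ih =>
      intro hk
      refine .step (hb _ (by omega) hk) (NRule.busU p f (w0+k) c (by omega) (by omega)) ?_ ?_
      · intro h hh; rw [Finset.mem_singleton] at hh; subst hh; exact hb _ (by omega) (by omega)
      · intro h hh; rw [Finset.mem_singleton] at hh; subst hh; exact ih (by omega)
  have down : ∀ k, k < w0 → S.ngs.Supp ν (S.ext ν s') (p, .bus f (w0 - k)) := by
    intro k
    induction k with
    | zero => intro _; exact h0
    | succ k ih =>
      intro hk
      refine .step (hb _ (by omega) (by omega)) (NRule.busD p f (w0-(k+1)) c (by omega) (by omega)) ?_ ?_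
      · intro h hh; rw [Finset.mem_singleton] at hh; subst hh; exact hb _ (by omega) (by omega)
      · intro h hh; rw [Finset.mem_singleton] at hh; subst hh
        have := ih (by omega)
        rwa [show w0 - k = w0 - (k+1) + 1 by omega] at this
  have all : ∀ w, S.ok (.bus f w : Nd F Rl) → S.ngs.Supp ν (S.ext ν s') (p, .bus f w) := by
    intro w hw'
    simp only [ok] at hw'
    by_cases hlt : w0 ≤ w
    · have := up (w - w0) (by omega)
      rwa [show w0 + (w - w0) = w by omega] at this
    · have := down (w0 - w) (by omega)
      rwa [show w0 - (w0 - w) = w by omega] at this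
  refine ⟨all, ?_⟩
  have hoff : S.ext ν s' (p, .off f) = some (.q c) := by
    have := hg (p, .off f) _ rfl hn
    simp [ext, this, canon, h]
  refine .step hoff (NRule.wire p _ (.bus f 1) (.q c) c trivial rfl rfl) ?_ ?_
  · intro h hh; rw [Finset.mem_singleton] at hh; subst hh; exact hb _ (by omega) (by omega)
  · intro h hh; rw [Finset.mem_singleton] at hh; subst hh; exact all _ (by simp only [ok]; omega)

theorem supp_site (hc : S.Cl ν) (hg : S.Good ν) (hle : Le (offS ν) s') {x} (h : S.gs.Supp (offS ν) s' x) : S.ngs.Supp ν (S.ext ν s') (x.1, .off x.2) ∧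
    (offS ν x = none → ∀ w, S.ok (.bus x.2 w : Nd F Rl) → S.ngs.Supp ν (S.ext ν s') (x.1, .bus x.2 w)) := by
  induction h with
  | @base x h =>
    refine ⟨.base ?_, fun h' => absurd h' h⟩
    intro hc; apply h; simp [offS, hc]
  | @step x c H hv hr hH hS ih =>
    obtain ⟨r, p, a, b, rfl, hrel, rfl⟩ := hr
    have i1 := (ih ((p, S.f1 r), a) (by simp)).1
    have i2 := (ih ((p, S.f2 r), b) (by simp)).1
    have o1 := hH ((p, S.f1 r), a) (by simp)
    have o2 := hH ((p, S.f2 r), b) (by simp)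
    dsimp only at i1 i2 o1 o2
    by_cases hn : offS ν (p + ov (S.off r), S.tgt r) = none
    · have hf := S.fireV_of o1 o2 hv hrel
      obtain ⟨_, _, e⟩ := S.supp_new hc hg hle hf hn i1 i2
      obtain ⟨_, _, e'⟩ := S.ext_new hc hg hle hf hn
      have g1 := S.pW_ge r
      have g2 := S.pW_le r
      have ho : S.ok (.bus (S.tgt r) (S.pW r) : Nd F Rl) := by simp only [ok]; omega
      obtain ⟨f1, f2⟩ := S.supp_bus hc hg hle hn hv ho (by
        refine .step (S.ext_bus hc hg hle hn hv ho) (NRule.busA p r c) ?_ ?_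
        · intro h hh
          rw [Finset.mem_insert, Finset.mem_singleton] at hh
          rcases hh with rfl | rfl
          · exact e' _
          · exact e' _
        · intro h hh
          rw [Finset.mem_insert, Finset.mem_singleton] at hh
          rcases hh with rfl | rfl
          · exact e _
          · exact e _)
      exact ⟨f2, fun _ => f1⟩
    · refine ⟨.base ?_, fun h' => absurd h' hn⟩
      intro hc; apply hn; simp [offS, hc]

end

/-- A4 -/
theorem ext_reach {ν : NSt F Rl Q} {s' : St (Pt 3 × F) Q} (hc : S.Cl ν) (hg : S.Good ν)
    (hr : S.gs.Reach (offS ν) s') : S.ngs.Reach ν (S.ext ν s') ∧ offS (S.ext ν s') = s' := by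
  have hle := hr.1
  refine ⟨⟨S.ext_le ν s', ?_⟩, S.offS_ext hc hle⟩
  rintro ⟨p, x⟩ hx
  by_cases hν : ν (p, x) = none
  swap
  · exact .base hν
  simp only [ext, hν, if_true] at hx
  have ss : ∀ {p f}, s' (p, f) ≠ none → S.ngs.Supp ν (S.ext ν s') (p, .off f) := fun h =>
    (S.supp_site hc hg hle (hr.2 _ h)).1
  cases x with
  | off f => exact ss (by simpa [canon] using hx)
  | tr f w =>
    simp only [canon] at hx
    split_ifs at hx with ho
    · have hs : s' (p, f) ≠ none := by simpa using hx
      exact S.supp_trpr hc hle (ss hs) hs _ ho.1 ho.2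
    · exact absurd rfl hx
  | pr r b u =>
    simp only [canon] at hx
    split_ifs at hx with ho
    · have hs : s' (p, S.fb r b) ≠ none := by simpa using hx
      exact S.supp_pr hc hle (ss hs) hs _ ho
    · exact absurd rfl hx
  | bus f w =>
    simp only [canon] at hx
    split_ifs at hx with ho
    · have hs : s' (p, f) ≠ none := by simpa using hx
      exact (S.supp_site hc hg hle (hr.2 _ hs)).2 ho.2 _ ho.1
    · exact absurd rfl hx
  | gate r =>
    simp only [canon] at hx
    split_ifs at hx with ho
    · have : S.fireV s' r p ≠ none := by simpa using hx
      obtain ⟨⟨a, b, c⟩, hf⟩ := Option.ne_none_iff_exists'.1 this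
      obtain ⟨e1, e2, _⟩ := S.fireV_some hf
      exact (S.supp_new hc hg hle hf ho (ss (by simp [e1])) (ss (by simp [e2]))).1
    · exact absurd rfl hx
  | out r j =>
    simp only [canon] at hx
    split_ifs at hx with ho
    · have : S.fireV s' r p ≠ none := by simpa using hx
      obtain ⟨⟨a, b, c⟩, hf⟩ := Option.ne_none_iff_exists'.1 this
      obtain ⟨e1, e2, _⟩ := S.fireV_some hf
      exact (S.supp_new hc hg hle hf ho.2 (ss (by simp [e1])) (ss (by simp [e2]))).2.1 _ ho.1
    · exact absurd rfl hx
  | arm r j =>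
    simp only [canon] at hx
    split_ifs at hx with ho
    · have : S.fireV s' r p ≠ none := by simpa using hx
      obtain ⟨⟨a, b, c⟩, hf⟩ := Option.ne_none_iff_exists'.1 this
      obtain ⟨e1, e2, _⟩ := S.fireV_some hf
      exact (S.supp_new hc hg hle hf ho (ss (by simp [e1])) (ss (by simp [e2]))).2.2 _
    · exact absurd rfl hx
  | rod u v w => exact absurd rfl hx

theorem offS_seed (D : Set (Pt 3)) (s0 : St (Pt 3 × F) Q) : offS (S.seedN D s0) = s0 := by
  funext ⟨p, f⟩
  simp only [offS, seedN]
  cases s0 (p, f) <;> simp [qv]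

theorem seedLike [Finite Q] (D : Set (Pt 3)) (s0 : St (Pt 3 × F) Q) : S.SeedLike (S.seedN D s0) := by
  have h := S.seedN_ok D s0
  exact ⟨SeedOk.wf S h, fun p x v hv => (h p x v hv).2.2.1⟩

theorem seed_owner [Finite Q] {D : Set (Pt 3)} {s0 : St (Pt 3 × F) Q} {n v} (h : S.seedN D s0 n = some v) :
    ∀ x, S.owner n = some x → s0 x ≠ none := by
  have := (S.seedN_ne D s0 n).1 (by simp [h])
  obtain ⟨p, x⟩ := n
  intro y hy
  cases x <;> simp only [pres] at this
  · cases hy; exact this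
  · cases hy

end LRS
end IU

namespace IU

/-! ## The concrete universal rule system -/

/-- local information about a pair of coordinates -/
structure Gam where
  eq : Bool
  plus : Bool
  minus : Bool
  fst : Bool
  lst : Bool
  cs : Option (Dir → Bool)
  mb : Dir → Bool

instance : Finite Gam := by
  refine Finite.of_injective (β := Bool × Bool × Bool × Bool × Bool × Option (Dir → Bool) × (Dir → Bool))
    (fun g => (g.eq, g.plus, g.minus, g.fst, g.lst, g.cs, g.mb)) ?_
  intro a b h
  cases a; cases b
  simp only [Prod.mk.injEq] at h
  simp [h]

instance : Inhabited Gam := ⟨⟨false, false, false, false, false, none, fun _ => false⟩⟩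

abbrev Tab := Fin 3 → Fin 3 → Option Gam
abbrev Lab := Fin 3 → Fin 3 → Gam

inductive QV
  | row (t : Tab) (fl : Fin 3 → Bool)
  | lab (x : Lab)
  | bit (b : Bool)

instance : Finite QV := by
  refine Finite.of_injective (β := (Tab × (Fin 3 → Bool)) ⊕ (Lab ⊕ Bool))
    (fun q => match q with
      | .row t fl => .inl (t, fl)
      | .lab x => .inr (.inl x)
      | .bit b => .inr (.inr b)) ?_
  intro a b h
  cases a <;> cases b <;> simp at h ⊢ <;> exact h

inductive Fd
  | R (i : Fin 3)
  | M
  | N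
  | W
  | Win (i : Fin 3)
  | In (d : Dir)
  | A (k : Fin 7)
  | K
  | L

inductive Ru
  | NR (δ : Dir)
  | NW (δ : Dir)
  | turn (i j : Fin 3)
  | RM
  | MN
  | KW
  | KWin
  | WT (j : Fin 3)
  | CR (δ : Dir)
  | A0
  | AI (k : Fin 6)
  | AN (k : Fin 6)
  | KO
  | KP
  | LS
  | LP
  | Sp (f : Fd) (δ : Dir)

def dirc (d : Dir) : ℕ := 2 * d.1.val + d.2.toNat

theorem dirc_lt (d : Dir) : dirc d < 6 := by
  rcases d with ⟨a, b⟩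
  have := a.2
  cases b <;> simp [dirc] <;> omega

theorem dirc_inj {d d' : Dir} (h : dirc d = dirc d') : d = d' := by
  revert d d'; decide

def cF : Fd → ℕ
  | .R i => i.val
  | .M => 3
  | .N => 4
  | .W => 5
  | .Win i => 6 + i.val
  | .In d => 9 + dirc d
  | .A k => 15 + k.val
  | .K => 22
  | .L => 23

theorem cF_lt (f : Fd) : cF f < 24 := by
  cases f with
  | In d => have := dirc_lt d; simp only [cF]; omega
  | _ => simp only [cF]; omega

theorem cF_inj : Function.Injective cF := by
  intro f g h
  cases f <;> cases g <;> simp only [cF] at h <;> first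
    | rfl
    | (exfalso; rename_i d d'; have := dirc_lt d; have := dirc_lt d'; omega)
    | (exfalso; rename_i d; have := dirc_lt d; omega)
    | (exfalso; rename_i d d'; have := dirc_lt d; omega)
    | (exfalso; rename_i d d'; have := dirc_lt d'; omega)
    | (exfalso; omega)
    | (congr 1; exact dirc_inj (by omega))
    | (congr 1; exact Fin.ext (by omega))

def cR : Ru → ℕ
  | .NR δ => dirc δ
  | .NW δ => 6 + dirc δ
  | .turn i j => 12 + (3 * i.val + j.val)
  | .RM => 21
  | .MN => 22
  | .KW => 23
  | .KWin => 24
  | .WT j => 25 + j.val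
  | .CR δ => 28 + dirc δ
  | .A0 => 34
  | .AI k => 35 + k.val
  | .AN k => 41 + k.val
  | .KO => 47
  | .KP => 48
  | .LS => 49
  | .LP => 50
  | .Sp f δ => 60 + (6 * cF f + dirc δ)

/-- a coarse code of the constructor -/
def cR1 : Ru → ℕ
  | .NR _ => 0
  | .NW _ => 1
  | .turn _ _ => 2
  | .RM => 3
  | .MN => 4
  | .KW => 5
  | .KWin => 6
  | .WT _ => 7
  | .CR _ => 8
  | .A0 => 9
  | .AI _ => 10
  | .AN _ => 11
  | .KO => 12
  | .KP => 13
  | .LS => 14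
  | .LP => 15
  | .Sp _ _ => 16

def cR2 (n : ℕ) : ℕ :=
  if n < 6 then 0 else if n < 12 then 1 else if n < 21 then 2 else if n < 22 then 3 else
  if n < 23 then 4 else if n < 24 then 5 else if n < 25 then 6 else if n < 28 then 7 else
  if n < 34 then 8 else if n < 35 then 9 else if n < 41 then 10 else if n < 47 then 11 else
  if n < 48 then 12 else if n < 49 then 13 else if n < 50 then 14 else if n < 51 then 15 else 16

theorem cR2_cR (r : Ru) : cR2 (cR r) = cR1 r := by
  cases r with
  | NR δ => have := dirc_lt δ; simp only [cR, cR1, cR2]; grind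
  | NW δ => have := dirc_lt δ; simp only [cR, cR1, cR2]; grind
  | CR δ => have := dirc_lt δ; simp only [cR, cR1, cR2]; grind
  | Sp f δ => have := dirc_lt δ; simp only [cR, cR1, cR2]; grind
  | _ => simp only [cR, cR1, cR2]; grind

theorem cR_inj : Function.Injective cR := by
  intro r r' h
  have h1 : cR1 r = cR1 r' := by rw [← cR2_cR, ← cR2_cR, h]
  cases r with
  | NR δ =>
    cases r' <;> first | (exfalso; revert h1; simp [cR1]; done) | skip
    simp only [cR] at h; rw [dirc_inj h]
  | NW δ =>
    cases r' <;> first | (exfalso; revert h1; simp [cR1]; done) | skip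
    rename_i δ'
    simp only [cR] at h; rw [dirc_inj (by omega : dirc δ = dirc δ')]
  | turn i j =>
    cases r' <;> first | (exfalso; revert h1; simp [cR1]; done) | skip
    simp only [cR] at h; congr 1 <;> exact Fin.ext (by omega)
  | WT j =>
    cases r' <;> first | (exfalso; revert h1; simp [cR1]; done) | skip
    simp only [cR] at h; congr 1; exact Fin.ext (by omega)
  | CR δ =>
    cases r' <;> first | (exfalso; revert h1; simp [cR1]; done) | skip
    rename_i δ'
    simp only [cR] at h; rw [dirc_inj (by omega : dirc δ = dirc δ')]
  | AI k =>
    cases r' <;> first | (exfalso; revert h1; simp [cR1]; done) | skip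
    simp only [cR] at h; congr 1; exact Fin.ext (by omega)
  | AN k =>
    cases r' <;> first | (exfalso; revert h1; simp [cR1]; done) | skip
    simp only [cR] at h; congr 1; exact Fin.ext (by omega)
  | Sp f δ =>
    cases r' <;> first | (exfalso; revert h1; simp [cR1]; done) | skip
    rename_i f' δ'
    simp only [cR] at h
    have a1 := dirc_lt δ
    have a2 := dirc_lt δ'
    rw [dirc_inj (by omega : dirc δ = dirc δ'), cF_inj (by omega : cF f = cF f')]
  | _ => cases r' <;> first | rfl | (exfalso; revert h1; simp [cR1]; done)

theorem cR_lt (r : Ru) : cR r < 500 := by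
  cases r with
  | Sp f δ => have := cF_lt f; have := dirc_lt δ; simp only [cR]; omega
  | NR δ => have := dirc_lt δ; simp only [cR]; omega
  | NW δ => have := dirc_lt δ; simp only [cR]; omega
  | CR δ => have := dirc_lt δ; simp only [cR]; omega
  | _ => simp only [cR]; omega

def dk : Fin 6 → Dir := ![(0, false), (0, true), (1, false), (1, true), (2, false), (2, true)]

theorem dk_surj : ∀ d, ∃ l, dk l = d := by decide

def jx (d : Dir) : Fin 3 := d.1 + 1

/-- the neighbour in direction `δ` belongs to the same block -/
def nbd (x : Lab) (δ : Dir) : Prop := (if δ.2 then (x δ.1 δ.1).lst else (x δ.1 δ.1).fst) = false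

def succRow (x : Lab) (δ : Dir) : QV :=
  .row (fun a b => if a ≠ δ.1 ∧ b ≠ δ.1 then some (x a b) else none)
    (fun j => if j = δ.1 then true else if δ.2 then (x δ.1 j).plus else (x δ.1 j).minus)

def sw (i j a : Fin 3) : Fin 3 := if a = i then j else a

def turnRow (i j : Fin 3) (t : Tab) (fl : Fin 3 → Bool) : QV :=
  .row (fun a b => if a ≠ j ∧ b ≠ j then t (sw i j a) (sw i j b) else none) fl

def mergeT (t t' : Tab) : Tab := fun a b => (t a b).or (t' a b)

def allowed : Fd → Dir → Prop
  | .W, _ => True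
  | .Win i, δ => δ.1 ≠ i
  | .In d, δ => δ.1 ≠ jx d
  | .A k, δ => k = 6 ∧ δ.1 ≠ 0
  | _, _ => False

def rrel : Ru → QV → QV → QV → Prop
  | .NR δ, a, _, c => ∃ x, a = .lab x ∧ nbd x δ ∧ c = succRow x δ
  | .NW δ, a, _, c => ∃ x, a = .lab x ∧ ¬ nbd x δ ∧ c = succRow x δ
  | .turn i j, a, _, c => ∃ t fl, a = .row t fl ∧ i ≠ j ∧ fl j = true ∧ c = turnRow i j t fl
  | .RM, a, b, c => ∃ t fl t' fl', a = .row t fl ∧ b = .row t' fl' ∧ c = .row (mergeT t t') (fun _ => false)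
  | .MN, a, b, c => ∃ t fl t' fl', a = .row t fl ∧ b = .row t' fl' ∧
      c = .lab (fun i j => (mergeT t t' i j).getD default)
  | .KW, a, _, c => a = .bit true ∧ c = .bit true
  | .KWin, a, _, c => a = .bit true ∧ c = .bit true
  | .WT j, _, b, c => ∃ x, b = .lab x ∧ (x 0 j).eq = true ∧ c = .bit true
  | .CR δ, _, b, c => ∃ x, b = .lab x ∧ ¬ nbd x δ ∧ (x (δ.1 + 1) (δ.1 + 2)).mb δ = true ∧ c = .bit true
  | .A0, a, _, c => ∃ x, a = .lab x ∧ (x 0 1).eq = true ∧ (x 0 2).eq = true ∧ (x 0 0).cs ≠ none ∧ c = .bit true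
  | .AI _, _, _, c => c = .bit true
  | .AN k, _, b, c => ∃ x S, b = .lab x ∧ (x 0 0).cs = some S ∧ S (dk k) = false ∧ c = .bit true
  | .KO, _, b, c => ∃ x, b = .lab x ∧ (x 1 1).fst = true ∧ (x 2 2).fst = true ∧ c = .bit true
  | .KP, _, b, c => ∃ x, b = .lab x ∧ (x 0 0).fst = false ∧ c = .bit false
  | .LS, _, b, c => ∃ x, b = .lab x ∧ (x 0 0).fst = true ∧ c = .bit true
  | .LP, a, _, c => a = .bit false ∧ c = .bit true
  | .Sp f δ, _, b, c => ∃ x, b = .lab x ∧ allowed f δ ∧ nbd x δ ∧ c = .bit true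

def rf1 : Ru → Fd
  | .NR _ => .N
  | .NW _ => .N
  | .turn i _ => .R i
  | .RM => .R 0
  | .MN => .M
  | .KW => .K
  | .KWin => .K
  | .WT _ => .Win 0
  | .CR δ => .Win (δ.1 + 2)
  | .A0 => .N
  | .AI k => .A k.castSucc
  | .AN k => .A k.castSucc
  | .KO => .A 6
  | .KP => .K
  | .LS => .K
  | .LP => .K
  | .Sp f _ => f

def rf2 : Ru → Fd
  | .NR _ => .N
  | .NW _ => .W
  | .turn i _ => .R i
  | .RM => .R 1
  | .MN => .R 2
  | .KW => .L
  | .KWin => .L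
  | .WT _ => .N
  | .CR _ => .N
  | .A0 => .N
  | .AI k => .In (dk k)
  | .AN _ => .N
  | .KO => .N
  | .KP => .N
  | .LS => .N
  | .LP => .L
  | .Sp _ _ => .N

def rtgt : Ru → Fd
  | .NR δ => .R δ.1
  | .NW δ => .R δ.1
  | .turn _ j => .R j
  | .RM => .M
  | .MN => .N
  | .KW => .W
  | .KWin => .Win 0
  | .WT j => .Win j
  | .CR δ => .In (opp δ)
  | .A0 => .A 0
  | .AI k => .A k.succ
  | .AN k => .A k.succ
  | .KO => .K
  | .KP => .K
  | .LS => .L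
  | .LP => .L
  | .Sp f _ => f

def roff : Ru → Option Dir
  | .NR δ => some δ
  | .NW δ => some δ
  | .CR δ => some δ
  | .KP => some (0, false)
  | .LP => some (0, true)
  | .Sp _ δ => some δ
  | _ => none

/-- the universal rule system -/
def SU : LRS Fd Ru QV where
  f1 := rf1
  f2 := rf2
  tgt := rtgt
  off := roff
  rel := rrel
  iF := cF
  iR := cR
  iF_inj := cF_inj
  iR_inj := cR_inj
  iF_lt f := by have := cF_lt f; omega
  iR_lt := cR_lt

/-! ## Parameters -/

structure Par where
  m : ℕ
  hm : 0 < m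
  cs : ℤ → Option (Dir → Bool)
  mb : ℤ → ℤ → Dir → Bool
  cs_range : ∀ c S, cs c = some S → 0 ≤ c ∧ c < m
  cs_ne : ∀ c S, cs c = some S → ∃ d, S d = true

namespace Par
variable (θ : Par)

def H (u v : ℤ) : Gam where
  eq := decide (u % θ.m = v % θ.m)
  plus := decide ((u + 1) % θ.m = v % θ.m)
  minus := decide ((u - 1) % θ.m = v % θ.m)
  fst := decide (u % θ.m = 0)
  lst := decide ((u + 1) % θ.m = 0)
  cs := θ.cs (u % θ.m)
  mb := θ.mb (u % θ.m) (v % θ.m)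

theorem H_congr {u u' v v' : ℤ} (h : u % θ.m = u' % θ.m) (h' : v % θ.m = v' % θ.m) : θ.H u v = θ.H u' v' := by
  have e1 : (u + 1) % θ.m = (u' + 1) % θ.m := Int.ModEq.add_right 1 h
  have e2 : (u - 1) % θ.m = (u' - 1) % θ.m := Int.ModEq.sub_right 1 h
  simp only [H, h, h', e1, e2]

def blk (p : Pt 3) : Pt 3 := fun i => p i / θ.m
def lc (p : Pt 3) : Pt 3 := fun i => p i % θ.m
def pt (B y : Pt 3) : Pt 3 := fun i => θ.m * B i + y i

def box (y : Pt 3) : Prop := ∀ i, 0 ≤ y i ∧ y i < θ.m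

theorem mpos : (0 : ℤ) < θ.m := by exact_mod_cast θ.hm

theorem pt_blk_lc (p : Pt 3) : θ.pt (θ.blk p) (θ.lc p) = p := by
  funext i
  simp only [pt, blk, lc]
  exact Int.mul_ediv_add_emod (p i) θ.m

theorem box_lc (p : Pt 3) : θ.box (θ.lc p) := fun i =>
  ⟨Int.emod_nonneg _ θ.mpos.ne', Int.emod_lt_of_pos _ θ.mpos⟩

theorem blk_pt {B y : Pt 3} (h : θ.box y) : θ.blk (θ.pt B y) = B := by
  funext i
  simp only [pt, blk]
  rw [Int.add_comm, Int.add_mul_ediv_left _ _ θ.mpos.ne', Int.ediv_eq_zero_of_lt (h i).1 (h i).2, zero_add]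

theorem lc_pt {B y : Pt 3} (h : θ.box y) : θ.lc (θ.pt B y) = y := by
  funext i
  simp only [pt, lc]
  rw [Int.add_comm, Int.add_mul_emod_self_left, Int.emod_eq_of_lt (h i).1 (h i).2]

theorem pt_add (B y v : Pt 3) : θ.pt B y + v = θ.pt B (y + v) := by
  funext i
  simp only [pt, Pi.add_apply]
  ring

def rowv (i : Fin 3) (p : Pt 3) : QV :=
  .row (fun a b => if a ≠ i ∧ b ≠ i then some (θ.H (p a) (p b)) else none)
    (fun j => decide (p i % θ.m = p j % θ.m))

def mv (p : Pt 3) : QV :=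
  .row (fun a b => if (a ≠ 0 ∧ b ≠ 0) ∨ (a ≠ 1 ∧ b ≠ 1) then some (θ.H (p a) (p b)) else none) (fun _ => false)

def labf (p : Pt 3) : Lab := fun a b => θ.H (p a) (p b)

def cval (f : Fd) (p : Pt 3) : QV :=
  match f with
  | .R i => θ.rowv i p
  | .M => θ.mv p
  | .N => .lab (θ.labf p)
  | _ => .bit true

theorem dv_same (δ : Dir) : dv δ δ.1 = sg δ.2 := by simp [dv]
theorem dv_other {δ : Dir} {i : Fin 3} (h : i ≠ δ.1) : dv δ i = 0 := by simp [dv, h]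

theorem succ_arith {m x : ℤ} (hm : 0 < m) : ((x + 1) % m ≠ 0 → (x + 1) / m = x / m) ∧
    ((x + 1) % m = 0 → (x + 1) / m = x / m + 1) ∧ (x % m ≠ 0 → (x - 1) / m = x / m) ∧
    (x % m = 0 → (x - 1) / m = x / m - 1) := by
  have e1 := Int.mul_ediv_add_emod x m
  have b1 := Int.emod_nonneg x hm.ne'
  have b2 := Int.emod_lt_of_pos x hm
  have key : ∀ y q r : ℤ, y = m * q + r → 0 ≤ r → r < m → y / m = q ∧ y % m = r := by
    intro y q r hy h0 h1
    subst hy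
    constructor
    · rw [Int.add_comm, Int.add_mul_ediv_left _ _ hm.ne', Int.ediv_eq_zero_of_lt h0 h1, zero_add]
    · rw [Int.add_comm, Int.add_mul_emod_self_left, Int.emod_eq_of_lt h0 h1]
  have up : (x % m + 1 < m ∧ (x + 1) / m = x / m ∧ (x+1) % m = x % m + 1) ∨
      (x % m + 1 = m ∧ (x+1) / m = x / m + 1 ∧ (x + 1) % m = 0) := by
    by_cases h : x % m + 1 < m
    · left; exact ⟨h, key (x+1) (x/m) (x % m + 1) (by linarith) (by omega) h⟩
    · right
      refine ⟨by omega, key (x+1) (x/m+1) 0 ?_ le_rfl hm⟩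
      have : x % m = m - 1 := by omega
      rw [this] at e1
      linarith
  have dn : (x % m = 0 ∧ (x - 1) / m = x / m - 1) ∨ (x % m ≠ 0 ∧ (x - 1) / m = x / m) := by
    by_cases h : x % m = 0
    · left
      refine ⟨h, (key (x-1) (x/m-1) (m-1) ?_ (by omega) (by omega)).1⟩
      rw [h] at e1
      linarith
    · right
      exact ⟨h, (key (x-1) (x/m) (x % m - 1) (by linarith) (by omega) (by omega)).1⟩
  refine ⟨fun h => ?_, fun h => ?_, fun h => ?_, fun h => ?_⟩
  · rcases up with ⟨_, h1, _⟩ | ⟨_, _, h1⟩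
    · exact h1
    · exact absurd h1 h
  · rcases up with ⟨_, _, h1⟩ | ⟨_, h1, _⟩
    · omega
    · exact h1
  · rcases dn with ⟨h1, _⟩ | ⟨_, h1⟩
    · exact absurd h1 h
    · exact h1
  · rcases dn with ⟨_, h1⟩ | ⟨h1, _⟩
    · exact h1
    · exact absurd h h1

theorem blk_step (p : Pt 3) (δ : Dir) :
    (nbd (θ.labf p) δ → θ.blk (p + dv δ) = θ.blk p) ∧
    (¬ nbd (θ.labf p) δ → θ.blk (p + dv δ) = θ.blk p + dv δ) := by
  have ar := succ_arith (x := p δ.1) θ.mpos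
  obtain ⟨a, b⟩ := δ
  constructor
  · intro h
    funext i
    simp only [blk, Pi.add_apply]
    by_cases hi : i = a
    · subst hi
      cases b
      · simp only [nbd, labf, H, dv, sg] at h ⊢
        simp at h ⊢
        exact ar.2.2.1 (fun hc => h (Int.dvd_of_emod_eq_zero hc))
      · simp only [nbd, labf, H, dv, sg] at h ⊢
        simp at h ⊢
        exact ar.1 (fun hc => h (Int.dvd_of_emod_eq_zero hc))
    · simp [dv, hi]
  · intro h
    funext i
    simp only [blk, Pi.add_apply]
    by_cases hi : i = a
    · subst hi
      cases b
      · simp only [nbd, labf, H, dv, sg] at h ⊢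
        simp at h ⊢
        exact ar.2.2.2 (Int.emod_eq_zero_of_dvd h)
      · simp only [nbd, labf, H, dv, sg] at h ⊢
        simp at h ⊢
        exact ar.2.1 (Int.emod_eq_zero_of_dvd h)
    · simp [dv, hi]

theorem nbd_iff (p : Pt 3) (δ : Dir) : nbd (θ.labf p) δ ↔ θ.blk (p + dv δ) = θ.blk p := by
  refine ⟨(θ.blk_step p δ).1, fun h => ?_⟩
  by_contra hc
  have := (θ.blk_step p δ).2 hc
  rw [h] at this
  exact dv_ne_zero δ (by simpa using this.symm)

theorem lc_step {p v : Pt 3} (h : θ.blk (p + v) = θ.blk p) : θ.lc (p + v) = θ.lc p + v := by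
  have e1 := θ.pt_blk_lc (p + v)
  have e2 := θ.pt_blk_lc p
  rw [h] at e1
  funext i
  have e1 := congrFun e1 i
  have e2 := congrFun e2 i
  simp only [pt, Pi.add_apply] at e1 e2 ⊢
  linarith

end Par
end IU

namespace IU
namespace Par
variable (θ : Par)

/-! ## Candidate level system and safety -/

/-- the candidate level growth system -/
def cgs : GS (Pt 3) ℤ where
  rule B c H := ∃ (S : Dir → Bool) (g : Dir → ℤ), θ.cs c = some S ∧
    (∀ d, S d = true → θ.mb c (g d) (opp d) = true) ∧
    H = (Finset.univ.filter (fun d => S d = true)).image (fun d => (B + dv d, g d))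

abbrev OSt := St (Pt 3 × Fd) QV

/-- the site of the decision chain with index `c` -/
def kp (B : Pt 3) (c : ℤ) : Pt 3 := θ.pt B ![c, 0, 0]

def Dec (s : OSt) (B : Pt 3) (c : ℤ) : Prop :=
  0 ≤ c ∧ c < θ.m ∧ (∀ c', 0 ≤ c' → c' < c → s (θ.kp B c', .K) = some (.bit false)) ∧
    s (θ.kp B c, .K) = some (.bit true)

def win (s : OSt) : St (Pt 3) ℤ := fun B =>
  if h : ∃ c, θ.Dec s B c then some (Classical.choose h) else none

theorem dec_unique {s : OSt} {B : Pt 3} {c c' : ℤ} (h : θ.Dec s B c) (h' : θ.Dec s B c') : c = c' := by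
  rcases lt_trichotomy c c' with hl | hl | hl
  · have := h'.2.2.1 c h.1 hl
    rw [h.2.2.2] at this
    simp at this
  · exact hl
  · have := h.2.2.1 c' h'.1 hl
    rw [h'.2.2.2] at this
    simp at this

theorem win_iff {s : OSt} {B : Pt 3} {c : ℤ} : θ.win s B = some c ↔ θ.Dec s B c := by
  unfold win
  constructor
  · intro h
    split_ifs at h with h1
    have := Classical.choose_spec h1
    simp only [Option.some.injEq] at h
    rwa [h] at this
  · intro h
    have h1 : ∃ c, θ.Dec s B c := ⟨c, h⟩
    rw [dif_pos h1, θ.dec_unique (Classical.choose_spec h1) h]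

theorem dec_mono {s s' : OSt} (hl : Le s s') {B : Pt 3} {c : ℤ} (h : θ.Dec s B c) : θ.Dec s' B c :=
  ⟨h.1, h.2.1, fun c' h1 h2 => hl _ _ (h.2.2.1 c' h1 h2), hl _ _ h.2.2.2⟩

theorem win_mono {s s' : OSt} (hl : Le s s') : Le (θ.win s) (θ.win s') := fun _ _ h =>
  θ.win_iff.2 (θ.dec_mono hl (θ.win_iff.1 h))

theorem kp_eq {p : Pt 3} (h1 : θ.lc p 1 = 0) (h2 : θ.lc p 2 = 0) : θ.kp (θ.blk p) (θ.lc p 0) = p := by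
  rw [kp]
  conv_rhs => rw [← θ.pt_blk_lc p]
  congr 1
  funext i
  fin_cases i <;> simp [h1, h2]

theorem box_kp {c : ℤ} (h0 : 0 ≤ c) (h1 : c < θ.m) : θ.box ![c, 0, 0] := by
  intro i
  have := θ.mpos
  fin_cases i <;> simp <;> omega

theorem blk_kp (B : Pt 3) {c : ℤ} (h0 : 0 ≤ c) (h1 : c < θ.m) : θ.blk (θ.kp B c) = B :=
  θ.blk_pt (θ.box_kp h0 h1)

theorem lc_kp (B : Pt 3) {c : ℤ} (h0 : 0 ≤ c) (h1 : c < θ.m) : θ.lc (θ.kp B c) = ![c, 0, 0] :=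
  θ.lc_pt (θ.box_kp h0 h1)

theorem kp_step (B : Pt 3) (c : ℤ) : θ.kp B c + dv (0, true) = θ.kp B (c + 1) := by
  rw [kp, kp, pt_add]
  congr 1
  funext i
  fin_cases i <;> simp [dv, sg]

variable (s : OSt) (ω : St (Pt 3) ℤ) (D : Pt 3 → Prop)

def near (B : Pt 3) : Prop := ω B ≠ none ∨ ∃ δ, ω (B + dv δ) ≠ none

def nbrok (B : Pt 3) (u : ℤ) (d : Dir) : Prop :=
  ∃ c', ω (B + dv d) = some c' ∧ D (B + dv d) ∧ θ.mb u c' (opp d) = true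

def enb (B : Pt 3) (c : ℤ) : Prop := ∃ S, θ.cs c = some S ∧ ∀ d, S d = true → θ.nbrok ω D B c d

def cond0 (f : Fd) (p : Pt 3) (v : QV) : Prop :=
  match f with
  | .R i => v = θ.rowv i p
  | .M => v = θ.mv p
  | .N => v = .lab (θ.labf p)
  | .W => v = .bit true ∧ ω (θ.blk p) ≠ none ∧ D (θ.blk p)
  | .Win i => v = .bit true ∧ ω (θ.blk p) = some (θ.lc p i) ∧ D (θ.blk p)
  | .In d => v = .bit true ∧ θ.nbrok ω D (θ.blk p) (θ.lc p (jx d)) d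
  | .A k => v = .bit true ∧ (k ≠ 6 → ∀ i, θ.lc p i = θ.lc p 0) ∧ ∃ S, θ.cs (θ.lc p 0) = some S ∧
      ∀ l : Fin 6, l.val < k.val → S (dk l) = true → θ.nbrok ω D (θ.blk p) (θ.lc p 0) (dk l)
  | .K => θ.lc p 1 = 0 ∧ θ.lc p 2 = 0 ∧
      ((v = .bit true ∧ ((ω (θ.blk p) = some (θ.lc p 0) ∧ D (θ.blk p)) ∨ θ.enb ω D (θ.blk p) (θ.lc p 0))) ∨
       (v = .bit false ∧ θ.blk (p + dv (0, true)) = θ.blk p ∧ s (p + dv (0, true), .K) ≠ none))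
  | .L => v = .bit true ∧ θ.lc p 1 = 0 ∧ θ.lc p 2 = 0 ∧
      (∀ c', 0 ≤ c' → c' < θ.lc p 0 → s (θ.kp (θ.blk p) c', .K) = some (.bit false)) ∧
      s (θ.kp (θ.blk p) 0, .K) ≠ none

def cond (f : Fd) (p : Pt 3) (v : QV) : Prop := near ω (θ.blk p) ∧ θ.cond0 s ω D f p v

theorem blk_sub {p : Pt 3} {δ : Dir} (h : ¬ nbd (θ.labf p) δ) : θ.blk (p + dv δ) + dv (opp δ) = θ.blk p := by
  rw [(θ.blk_step p δ).2 h, dv_opp]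
  simp

theorem lc_other {p : Pt 3} {δ : Dir} {i : Fin 3} (h : i ≠ δ.1) : θ.lc (p + dv δ) i = θ.lc p i := by
  simp [lc, dv_other h]

theorem succRow_eq (p : Pt 3) (δ : Dir) : succRow (θ.labf p) δ = θ.rowv δ.1 (p + dv δ) := by
  unfold succRow rowv
  congr 1
  · funext a b
    by_cases h : a ≠ δ.1 ∧ b ≠ δ.1
    · rw [if_pos h, if_pos h]
      simp only [labf, Pi.add_apply, dv_other h.1, dv_other h.2, add_zero]
    · rw [if_neg h, if_neg h]
  · funext j
    by_cases h : j = δ.1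
    · subst h; simp
    · rw [if_neg h]
      simp only [labf, H, Pi.add_apply, dv_same, dv_other h, add_zero]
      cases hb : δ.2
      · simp only [sg]; rfl
      · simp only [sg]; rfl

theorem turnRow_eq (p : Pt 3) {i j : Fin 3} (hij : i ≠ j) (h : p i % θ.m = p j % θ.m) :
    turnRow i j (fun a b => if a ≠ i ∧ b ≠ i then some (θ.H (p a) (p b)) else none)
      (fun k => decide (p i % θ.m = p k % θ.m)) = θ.rowv j p := by
  have hsw : ∀ a, a ≠ j → sw i j a ≠ i := by
    intro a ha
    unfold sw
    split_ifs with h1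
    · exact hij.symm
    · exact h1
  have hsw2 : ∀ a, p (sw i j a) % θ.m = p a % θ.m := by
    intro a
    unfold sw
    split_ifs with h1
    · rw [h1, h]
    · rfl
  unfold turnRow rowv
  congr 1
  · funext a b
    by_cases h1 : a ≠ j ∧ b ≠ j
    · beta_reduce
      rw [if_pos h1, if_pos h1, if_pos ⟨hsw a h1.1, hsw b h1.2⟩, θ.H_congr (hsw2 a) (hsw2 b)]
    · rw [if_neg h1, if_neg h1]
  · funext k
    rw [h]

theorem merge1 (p : Pt 3) :
    mergeT (fun a b => if a ≠ 0 ∧ b ≠ 0 then some (θ.H (p a) (p b)) else none)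
      (fun a b => if a ≠ 1 ∧ b ≠ 1 then some (θ.H (p a) (p b)) else none) =
    (fun a b => if (a ≠ 0 ∧ b ≠ 0) ∨ (a ≠ 1 ∧ b ≠ 1) then some (θ.H (p a) (p b)) else none) := by
  funext a b
  unfold mergeT
  beta_reduce
  by_cases h1 : a ≠ 0 ∧ b ≠ 0
  · rw [if_pos h1, if_pos (Or.inl h1)]; rfl
  · by_cases h2 : a ≠ 1 ∧ b ≠ 1
    · rw [if_neg h1, if_pos h2, if_pos (Or.inr h2)]; rfl
    · rw [if_neg h1, if_neg h2, if_neg (by tauto)]; rfl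

theorem merge2 (p : Pt 3) (a b : Fin 3) :
    (mergeT (fun a b => if (a ≠ 0 ∧ b ≠ 0) ∨ (a ≠ 1 ∧ b ≠ 1) then some (θ.H (p a) (p b)) else none)
      (fun a b => if a ≠ 2 ∧ b ≠ 2 then some (θ.H (p a) (p b)) else none) a b).getD default = θ.labf p a b := by
  unfold mergeT
  beta_reduce
  by_cases h1 : (a ≠ 0 ∧ b ≠ 0) ∨ (a ≠ 1 ∧ b ≠ 1)
  · rw [if_pos h1]; rfl
  · have h2 : a ≠ 2 ∧ b ≠ 2 := by revert h1; revert a b; decide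
    rw [if_neg h1, if_pos h2]; rfl

variable {s ω D}

theorem cs6 : ∀ k : Fin 6, k.castSucc ≠ 6 := by decide

theorem cond_rule (hω : ω = θ.win s) (hD : ∀ B c, ω B = some c → θ.enb ω D B c → D B)
    (r : Ru) (p : Pt 3) (a b v : QV) (ha : s (p, rf1 r) = some a) (hb : s (p, rf2 r) = some b)
    (ca : θ.cond s ω D (rf1 r) p a) (cb : θ.cond s ω D (rf2 r) p b) (hr : rrel r a b v) :
    θ.cond s ω D (rtgt r) (p + ov (roff r)) v := by
  obtain ⟨hn, ca⟩ := ca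
  obtain ⟨-, cb⟩ := cb
  have dec : ∀ b, θ.cond0 s ω D .K p (.bit true) → s (p, .K) = some (.bit true) → θ.cond0 s ω D .L p b →
      ω (θ.blk p) = some (θ.lc p 0) ∧ D (θ.blk p) := by
    intro b hK hs hL
    have h1 : ω (θ.blk p) = some (θ.lc p 0) := by
      rw [hω, win_iff]
      refine ⟨(θ.box_lc p 0).1, (θ.box_lc p 0).2, hL.2.2.2.1, ?_⟩
      rw [θ.kp_eq hL.2.1 hL.2.2.1, hs]
    refine ⟨h1, ?_⟩
    rcases hK.2.2 with ⟨-, h | h⟩ | ⟨h, -⟩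
    · exact h.2
    · exact hD _ _ h1 h
    · simp at h
  have same : ∀ δ, nbd (θ.labf p) δ → near ω (θ.blk (p + dv δ)) := by
    intro δ h; rw [(θ.blk_step p δ).1 h]; exact hn
  cases r with
  | NR δ =>
    obtain ⟨x, rfl, h1, rfl⟩ := hr
    have e : x = θ.labf p := by simpa [cond0, rf1] using ca
    subst e
    exact ⟨same δ h1, θ.succRow_eq p δ⟩
  | NW δ =>
    obtain ⟨x, rfl, h1, rfl⟩ := hr
    have e : x = θ.labf p := by simpa [cond0, rf1] using ca
    subst e
    refine ⟨Or.inr ⟨opp δ, ?_⟩, θ.succRow_eq p δ⟩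
    simp only [roff, ov]
    rw [θ.blk_sub h1]
    exact cb.2.1
  | turn i j =>
    obtain ⟨t, fl, rfl, hij, hf, rfl⟩ := hr
    have e : QV.row t fl = θ.rowv i p := ca
    simp only [rowv, QV.row.injEq] at e
    obtain ⟨rfl, rfl⟩ := e
    simp only [decide_eq_true_eq] at hf
    simp only [roff, ov, add_zero]
    exact ⟨hn, θ.turnRow_eq p hij hf⟩
  | RM =>
    obtain ⟨t, fl, t', fl', rfl, rfl, rfl⟩ := hr
    have e : QV.row t fl = θ.rowv 0 p := ca
    have e' : QV.row t' fl' = θ.rowv 1 p := cb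
    simp only [rowv, QV.row.injEq] at e e'
    obtain ⟨rfl, rfl⟩ := e
    obtain ⟨rfl, rfl⟩ := e'
    simp only [roff, ov, add_zero]
    refine ⟨hn, ?_⟩
    change _ = θ.mv p
    rw [θ.merge1, mv]
  | MN =>
    obtain ⟨t, fl, t', fl', rfl, rfl, rfl⟩ := hr
    have e : QV.row t fl = θ.mv p := ca
    have e' : QV.row t' fl' = θ.rowv 2 p := cb
    simp only [rowv, mv, QV.row.injEq] at e e'
    obtain ⟨rfl, rfl⟩ := e
    obtain ⟨rfl, rfl⟩ := e'
    simp only [roff, ov, add_zero]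
    refine ⟨hn, ?_⟩
    change _ = QV.lab (θ.labf p)
    congr 1
    funext a b
    exact θ.merge2 p a b
  | KW =>
    obtain ⟨rfl, rfl⟩ := hr
    obtain ⟨d1, d2⟩ := dec b ca ha cb
    simp only [roff, ov, add_zero]
    exact ⟨hn, rfl, by simp [d1], d2⟩
  | KWin =>
    obtain ⟨rfl, rfl⟩ := hr
    obtain ⟨d1, d2⟩ := dec b ca ha cb
    simp only [roff, ov, add_zero]
    exact ⟨hn, rfl, d1, d2⟩
  | WT j =>
    obtain ⟨x, rfl, h1, rfl⟩ := hr
    have e : x = θ.labf p := by simpa [cond0, rf2] using cb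
    subst e
    simp only [labf, H, decide_eq_true_eq] at h1
    simp only [roff, ov, add_zero]
    refine ⟨hn, rfl, ?_, ca.2.2⟩
    rw [ca.2.1]
    simp only [lc]
    rw [h1]
  | CR δ =>
    obtain ⟨x, rfl, h1, h2, rfl⟩ := hr
    have e : x = θ.labf p := by simpa [cond0, rf2] using cb
    subst e
    simp only [roff, ov]
    have hne : (δ.1 + 1) ≠ δ.1 := by generalize δ.1 = z; revert z; decide
    refine ⟨Or.inr ⟨opp δ, ?_⟩, rfl, ?_⟩
    · rw [θ.blk_sub h1, ca.2.1]
      simp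
    · refine ⟨θ.lc p (δ.1 + 2), ?_, ?_, ?_⟩
      · rw [θ.blk_sub h1]; exact ca.2.1
      · rw [θ.blk_sub h1]; exact ca.2.2
      · have : jx (opp δ) = δ.1 + 1 := rfl
        rw [opp_opp, this, θ.lc_other hne]
        exact h2
  | A0 =>
    obtain ⟨x, rfl, h1, h2, h3, rfl⟩ := hr
    have e : x = θ.labf p := by simpa [cond0, rf1] using ca
    subst e
    simp only [roff, ov, add_zero]
    simp only [labf, H, decide_eq_true_eq] at h1 h2 h3
    obtain ⟨S, hS⟩ := Option.ne_none_iff_exists'.1 h3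
    refine ⟨hn, rfl, fun _ i => ?_, S, hS, fun l hl => absurd hl (by simp)⟩
    fin_cases i
    · rfl
    · exact h1.symm
    · exact h2.symm
  | AI k =>
    cases hr
    simp only [roff, ov, add_zero]
    obtain ⟨-, h1, S, hS, h2⟩ := ca
    have e1 := h1 (cs6 k)
    have h5 : ∀ l : Fin 6, l.val < k.succ.val → l.val < k.val + 1 := fun l h => h
    refine ⟨hn, rfl, fun _ => e1, S, hS, fun l hl hSl => ?_⟩
    by_cases hlk : l.val < k.val
    · exact h2 l (by simpa using hlk) hSl
    · have : l = k := Fin.ext (by have := h5 l hl; omega)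
      subst this
      have h7 : θ.nbrok ω D (θ.blk p) (θ.lc p (jx (dk l))) (dk l) := cb.2
      rw [e1 (jx (dk l))] at h7
      exact h7
  | AN k =>
    obtain ⟨x, S', rfl, h3, h4, rfl⟩ := hr
    have e : x = θ.labf p := by simpa [cond0, rf2] using cb
    subst e
    simp only [roff, ov, add_zero]
    obtain ⟨-, h1, S, hS, h2⟩ := ca
    have e1 := h1 (cs6 k)
    have h5 : ∀ l : Fin 6, l.val < k.succ.val → l.val < k.val + 1 := fun l h => h
    refine ⟨hn, rfl, fun _ => e1, S, hS, fun l hl hSl => ?_⟩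
    by_cases hlk : l.val < k.val
    · exact h2 l (by simpa using hlk) hSl
    · have : l = k := Fin.ext (by have := h5 l hl; omega)
      subst this
      have h3 : θ.cs (θ.lc p 0) = some S' := h3
      rw [hS] at h3
      cases h3
      rw [h4] at hSl
      cases hSl
  | KO =>
    obtain ⟨x, rfl, h1, h2, rfl⟩ := hr
    have e : x = θ.labf p := by simpa [cond0, rf2] using cb
    subst e
    simp only [labf, H, decide_eq_true_eq] at h1 h2
    simp only [roff, ov, add_zero]
    obtain ⟨-, -, S, hS, h3⟩ := ca
    refine ⟨hn, h1, h2, Or.inl ⟨rfl, Or.inr ⟨S, hS, fun d hd => ?_⟩⟩⟩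
    obtain ⟨l, rfl⟩ := dk_surj d
    exact h3 l l.2 hd
  | KP =>
    obtain ⟨x, rfl, h1, rfl⟩ := hr
    have e : x = θ.labf p := by simpa [cond0, rf2] using cb
    subst e
    have hnb : nbd (θ.labf p) (0, false) := h1
    simp only [roff, ov]
    have hb1 := (θ.blk_step p (0, false)).1 hnb
    have hback : p + dv (0, false) + dv (0, true) = p := by
      have := dv_opp (0, true)
      simp only [opp, Bool.not_true] at this
      rw [this]; simp
    refine ⟨same _ hnb, ?_, ?_, Or.inr ⟨rfl, ?_, ?_⟩⟩
    · rw [θ.lc_other (by simp)]; exact ca.1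
    · rw [θ.lc_other (by simp)]; exact ca.2.1
    · rw [hback, hb1]
    · rw [hback]
      have : s (p, .K) = some a := ha
      rw [this]; simp
  | LS =>
    obtain ⟨x, rfl, h1, rfl⟩ := hr
    have e : x = θ.labf p := by simpa [cond0, rf2] using cb
    subst e
    simp only [labf, H, decide_eq_true_eq] at h1
    simp only [roff, ov, add_zero]
    have h1 : θ.lc p 0 = 0 := h1
    refine ⟨hn, rfl, ca.1, ca.2.1, fun c' h3 h4 => absurd h4 (by omega), ?_⟩
    rw [← h1, θ.kp_eq ca.1 ca.2.1]
    have : s (p, .K) = some a := ha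
    rw [this]; simp
  | LP =>
    obtain ⟨rfl, rfl⟩ := hr
    simp only [roff, ov]
    rcases ca.2.2 with ⟨h, -⟩ | ⟨-, h1, h2⟩
    · simp at h
    have hst := θ.lc_step h1
    have e0 : θ.lc (p + dv (0, true)) 0 = θ.lc p 0 + 1 := by
      rw [hst]; simp [dv, sg]
    refine ⟨by rw [h1]; exact hn, rfl, ?_, ?_, ?_, ?_⟩
    · rw [θ.lc_other (by simp)]; exact ca.1
    · rw [θ.lc_other (by simp)]; exact ca.2.1
    · rw [h1, e0]
      intro c' h3 h4
      by_cases h5 : c' < θ.lc p 0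
      · exact cb.2.2.2.1 c' h3 h5
      · have : c' = θ.lc p 0 := by omega
        rw [this, θ.kp_eq ca.1 ca.2.1]
        exact ha
    · rw [h1]; exact cb.2.2.2.2
  | Sp f δ =>
    obtain ⟨x, rfl, h1, h2, rfl⟩ := hr
    have e : x = θ.labf p := by simpa [cond0, rf2] using cb
    subst e
    simp only [roff, ov]
    have hbk := (θ.blk_step p δ).1 h2
    refine ⟨same δ h2, ?_⟩
    simp only [rf1, rtgt] at ca ⊢
    cases f with
    | W => simp only [cond0, hbk] at ca ⊢; exact ⟨trivial, ca.2⟩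
    | Win i => simp only [cond0, hbk] at ca ⊢; rw [θ.lc_other (Ne.symm h1)]; exact ⟨trivial, ca.2⟩
    | In d => simp only [cond0, hbk] at ca ⊢; rw [θ.lc_other (Ne.symm h1)]; exact ⟨trivial, ca.2⟩
    | A k =>
      obtain ⟨rfl, h1⟩ := h1
      simp only [cond0, hbk] at ca ⊢
      rw [θ.lc_other (Ne.symm h1)]
      exact ⟨trivial, fun h => absurd rfl h, ca.2.2⟩
    | _ => exact h1.elim

theorem rule_cases {x : Pt 3 × Fd} {v : QV} {Hs : Finset ((Pt 3 × Fd) × QV)} (h : SU.gs.rule x v Hs) :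
    ∃ r p a b, x = (p + ov (roff r), rtgt r) ∧ rrel r a b v ∧ ((p, rf1 r), a) ∈ Hs ∧ ((p, rf2 r), b) ∈ Hs := by
  obtain ⟨r, p, a, b, h1, h2, rfl⟩ := h
  exact ⟨r, p, a, b, h1, h2, by simp [SU], by simp [SU]⟩

theorem safety {sa : OSt} (hl : Le sa s) (hω : ω = θ.win s)
    (hD : ∀ B c, ω B = some c → θ.enb ω D B c → D B)
    (hbase : ∀ x v, sa x = some v → θ.cond s ω D x.2 x.1 v) {x} (h : SU.gs.Supp sa s x) :
    ∀ v, s x = some v → θ.cond s ω D x.2 x.1 v := by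
  induction h with
  | base h =>
    intro v hv
    exact hbase _ _ (hl.eq_of hv h)
  | step hv hr hH _ ih =>
    intro v' hv'
    rw [hv] at hv'
    cases hv'
    obtain ⟨r, p, a, b, rfl, h2, h3, h4⟩ := rule_cases hr
    exact θ.cond_rule hω hD r p a b _ (hH _ h3) (hH _ h4) (ih _ h3 _ (hH _ h3)) (ih _ h4 _ (hH _ h4)) h2

/-! ### monotonicity -/

theorem near_mono {ω' : St (Pt 3) ℤ} (h : Le ω ω') {B} (hn : near ω B) : near ω' B := by
  rcases hn with h1 | ⟨δ, h1⟩
  · exact Or.inl (h.ne h1)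
  · exact Or.inr ⟨δ, h.ne h1⟩

theorem cond_mono {s' : OSt} {ω' : St (Pt 3) ℤ} {D' : Pt 3 → Prop} (hs : Le s s') (hω : Le ω ω')
    (hD : ∀ B, D B → D' B) {f p v} (h : θ.cond s ω D f p v) : θ.cond s' ω' D' f p v := by
  have hnb : ∀ B u d, θ.nbrok ω D B u d → θ.nbrok ω' D' B u d := by
    rintro B u d ⟨c', h1, h2, h3⟩
    exact ⟨c', hω _ _ h1, hD _ h2, h3⟩
  obtain ⟨hn, h⟩ := h
  refine ⟨near_mono hω hn, ?_⟩
  cases f with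
  | R i => exact h
  | M => exact h
  | N => exact h
  | W => exact ⟨h.1, hω.ne h.2.1, hD _ h.2.2⟩
  | Win i => exact ⟨h.1, hω _ _ h.2.1, hD _ h.2.2⟩
  | In d => exact ⟨h.1, hnb _ _ _ h.2⟩
  | A k =>
    obtain ⟨h1, h2, S, h3, h4⟩ := h
    exact ⟨h1, h2, S, h3, fun l hl hS => hnb _ _ _ (h4 l hl hS)⟩
  | K =>
    obtain ⟨h1, h2, h3⟩ := h
    refine ⟨h1, h2, ?_⟩
    rcases h3 with ⟨h3, h4 | ⟨S, h4, h5⟩⟩ | ⟨h3, h4, h5⟩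
    · exact Or.inl ⟨h3, Or.inl ⟨hω _ _ h4.1, hD _ h4.2⟩⟩
    · exact Or.inl ⟨h3, Or.inr ⟨S, h4, fun d hd => hnb _ _ _ (h5 d hd)⟩⟩
    · exact Or.inr ⟨h3, h4, hs.ne h5⟩
  | L => exact ⟨h.1, h.2.1, h.2.2.1, fun c' h1 h2 => hs _ _ (h.2.2.2.1 c' h1 h2), hs.ne h.2.2.2.2⟩

/-- the safety invariant -/
def Safe (s : OSt) : Prop := ∀ x v, s x = some v → θ.cond s (θ.win s) (fun B => θ.win s B ≠ none) x.2 x.1 v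

theorem cond_base {sa s : OSt} (h : θ.Safe sa) (hl : Le sa s) (hD : ∀ B, θ.win sa B ≠ none → D B) :
    ∀ x v, sa x = some v → θ.cond s (θ.win s) D x.2 x.1 v := fun x v hx =>
  θ.cond_mono hl (θ.win_mono hl) hD (h x v hx)

theorem Safe.reach {sa s : OSt} (h : θ.Safe sa) (hr : SU.gs.Reach sa s) : θ.Safe s := by
  intro x v hx
  refine θ.safety hr.1 rfl (fun B c h1 _ => by simp [h1]) ?_ (hr.2 x (by simp [hx])) v hx
  exact θ.cond_base h hr.1 (fun B hB => (θ.win_mono hr.1).ne hB)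

/-- F1 : the winners follow the candidate system -/
theorem win_reach {sa s : OSt} (h : θ.Safe sa) (hr : SU.gs.Reach sa s) : θ.cgs.Reach (θ.win sa) (θ.win s) := by
  have hD : ∀ B c, θ.win s B = some c → θ.enb (θ.win s) (θ.cgs.Supp (θ.win sa) (θ.win s)) B c →
      θ.cgs.Supp (θ.win sa) (θ.win s) B := by
    rintro B c h1 ⟨S, hS, h2⟩
    have : ∀ d, ∃ g, S d = true → θ.win s (B + dv d) = some g ∧ θ.cgs.Supp (θ.win sa) (θ.win s) (B + dv d) ∧
        θ.mb c g (opp d) = true := by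
      intro d
      by_cases hd : S d = true
      · obtain ⟨g, hg⟩ := h2 d hd
        exact ⟨g, fun _ => hg⟩
      · exact ⟨0, fun h => absurd h hd⟩
    choose g hg using this
    refine .step h1 ⟨S, g, hS, fun d hd => (hg d hd).2.2, rfl⟩ ?_ ?_
    · intro k hk
      simp only [Finset.mem_image, Finset.mem_filter, Finset.mem_univ, true_and] at hk
      obtain ⟨d, hd, rfl⟩ := hk
      exact (hg d hd).1
    · intro k hk
      simp only [Finset.mem_image, Finset.mem_filter, Finset.mem_univ, true_and] at hk
      obtain ⟨d, hd, rfl⟩ := hk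
      exact (hg d hd).2.1
  refine ⟨θ.win_mono hr.1, fun B hB => ?_⟩
  obtain ⟨c, hc⟩ := Option.ne_none_iff_exists'.1 hB
  have hdec := θ.win_iff.1 hc
  have hK := θ.safety hr.1 rfl hD (θ.cond_base h hr.1 (fun B hB => .base hB)) (hr.2 (θ.kp B c, .K) (by simp [hdec.2.2.2]))
    _ hdec.2.2.2
  have hK := hK.2
  simp only [cond0] at hK
  rw [θ.blk_kp B hdec.1 hdec.2.1, θ.lc_kp B hdec.1 hdec.2.1] at hK
  rcases hK.2.2 with ⟨-, h1 | h1⟩ | ⟨h1, -⟩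
  · exact h1.2
  · exact hD _ _ hc h1
  · simp at h1

/-- a chain starting at the origin determines a winner -/
theorem dec_of_K0 {s : OSt} (h : θ.Safe s) {B : Pt 3} (h0 : s (θ.kp B 0, .K) ≠ none) : θ.win s B ≠ none := by
  by_contra hc
  have key : ∀ n : ℕ, (n : ℤ) < θ.m ∧ s (θ.kp B n, .K) ≠ none ∧
      ∀ c', 0 ≤ c' → c' < (n : ℤ) → s (θ.kp B c', .K) = some (.bit false) := by
    intro n
    induction n with
    | zero => exact ⟨θ.mpos, h0, fun c' h1 h2 => by simp at h2; omega⟩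
    | succ n ih =>
      obtain ⟨h1, h2, h3⟩ := ih
      obtain ⟨v, hv⟩ := Option.ne_none_iff_exists'.1 h2
      have hK := (h _ _ hv).2
      simp only [cond0] at hK
      rw [θ.blk_kp B (by omega) h1] at hK
      rcases hK.2.2 with ⟨rfl, -⟩ | ⟨rfl, h4, h5⟩
      · exfalso
        have : θ.win s B = some (n : ℤ) := θ.win_iff.2 ⟨by omega, h1, h3, hv⟩
        rw [this] at hc
        simp at hc
      · have e0 := θ.lc_step (p := θ.kp B n) (v := dv (0, true)) (by rw [h4, θ.blk_kp B (by omega) h1])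
        have hlt := (θ.box_lc (θ.kp B n + dv (0, true)) 0).2
        rw [e0, θ.lc_kp B (by omega) h1] at hlt
        rw [kp_step] at h5
        push_cast
        refine ⟨by simpa [dv, sg] using hlt, h5, fun c' h6 h7 => ?_⟩
        by_cases h8 : c' < (n : ℤ)
        · exact h3 c' h6 h8
        · have : c' = n := by omega
          rw [this]; exact hv
  have := (key θ.m).1
  omega

end Par
end IU

namespace IU
namespace Par
variable (θ : Par)

/-! ## Liveness -/

theorem step_in {p v : Pt 3} (h : θ.box (θ.lc p + v)) :
    θ.blk (p + v) = θ.blk p ∧ θ.lc (p + v) = θ.lc p + v := by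
  have e : p + v = θ.pt (θ.blk p) (θ.lc p + v) := by rw [← pt_add, pt_blk_lc]
  rw [e]
  exact ⟨θ.blk_pt h, θ.lc_pt h⟩

theorem toward (p : Pt 3) (j : Fin 3) (t : ℤ) (h0 : 0 ≤ t) (h1 : t < θ.m) (hne : θ.lc p j ≠ t) :
    ∃ ε : Dir, ε.1 = j ∧ ∃ q, q + dv ε = p ∧ θ.blk q = θ.blk p ∧ nbd (θ.labf q) ε ∧
      (∀ i, i ≠ j → θ.lc q i = θ.lc p i) ∧ (θ.lc q j - t).natAbs < (θ.lc p j - t).natAbs := by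
  have main : ∀ ε : Dir, ε.1 = j → (0 ≤ θ.lc p j - sg ε.2 ∧ θ.lc p j - sg ε.2 < θ.m) →
      (θ.lc p j - sg ε.2 - t).natAbs < (θ.lc p j - t).natAbs →
      ∃ q, q + dv ε = p ∧ θ.blk q = θ.blk p ∧ nbd (θ.labf q) ε ∧
      (∀ i, i ≠ j → θ.lc q i = θ.lc p i) ∧ (θ.lc q j - t).natAbs < (θ.lc p j - t).natAbs := by
    intro ε hε hb hd
    subst hε
    have hbox : θ.box (θ.lc p + - dv ε) := by
      intro i
      by_cases hi : i = ε.1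
      · subst hi
        simp only [Pi.add_apply, Pi.neg_apply, dv_same]
        exact hb
      · simp only [Pi.add_apply, Pi.neg_apply, dv_other hi]
        have := θ.box_lc p i
        simpa using this
    obtain ⟨e1, e2⟩ := θ.step_in hbox
    have e3 : p + - dv ε + dv ε = p := by simp
    refine ⟨p + - dv ε, e3, e1, ?_, ?_, ?_⟩
    · rw [nbd_iff, e3, e1]
    · intro i hi
      rw [e2]
      simp [dv_other hi]
    · rw [e2]
      simpa [dv_same, ← sub_eq_add_neg] using hd
  have hb := θ.box_lc p j
  rcases lt_or_gt_of_ne hne with h | h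
  · exact ⟨(j, false), rfl, main _ rfl (by simp [sg]; omega) (by simp [sg]; omega)⟩
  · exact ⟨(j, true), rfl, main _ rfl (by simp [sg]; omega) (by simp [sg]; omega)⟩

theorem dist_lt {y z t : Pt 3} {j : Fin 3} (h : ∀ i, i ≠ j → z i = y i)
    (hj : (z j - t j).natAbs < (y j - t j).natAbs) :
    ∑ i, (z i - t i).natAbs < ∑ i, (y i - t i).natAbs := by
  apply Finset.sum_lt_sum
  · intro i _
    by_cases hi : i = j
    · subst hi; exact hj.le
    · rw [h i hi]
  · exact ⟨j, Finset.mem_univ _, hj⟩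

variable (P : Pt 3 × Fd → QV → Prop)

/-- closure of `P` under the rules -/
def Clo : Prop := ∀ r p a b, P (p, rf1 r) a → P (p, rf2 r) b → rtgt r ≠ .K →
  rrel r a b (θ.cval (rtgt r) (p + ov (roff r))) →
  P (p + ov (roff r), rtgt r) (θ.cval (rtgt r) (p + ov (roff r)))

def Qc (f : Fd) (p : Pt 3) : Prop := P (p, f) (θ.cval f p)

def NF (B : Pt 3) : Prop := ∀ p, θ.blk p = B → θ.Qc P .N p
def WF (B : Pt 3) : Prop := ∀ p, θ.blk p = B → θ.Qc P .W p
def WinF (B : Pt 3) (c : ℤ) : Prop := ∀ i p, θ.blk p = B → θ.lc p i = c → θ.Qc P (.Win i) p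
def chain (B : Pt 3) (c : ℤ) : Prop :=
  (∀ c', 0 ≤ c' → c' < c → P (θ.kp B c', .K) (.bit false)) ∧ P (θ.kp B c, .K) (.bit true)

variable {P}

theorem r_NR (h : θ.Clo P) {q : Pt 3} {δ : Dir} (hN : θ.Qc P .N q) (hn : nbd (θ.labf q) δ) :
    θ.Qc P (.R δ.1) (q + dv δ) := by
  refine h (.NR δ) q _ _ hN hN (by simp [rtgt]) ?_
  exact ⟨_, rfl, hn, (θ.succRow_eq q δ).symm⟩

theorem r_NW (h : θ.Clo P) {q : Pt 3} {δ : Dir} (hN : θ.Qc P .N q) (hW : θ.Qc P .W q) (hn : ¬ nbd (θ.labf q) δ) :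
    θ.Qc P (.R δ.1) (q + dv δ) := by
  refine h (.NW δ) q _ _ hN hW (by simp [rtgt]) ?_
  exact ⟨_, rfl, hn, (θ.succRow_eq q δ).symm⟩

theorem r_turn (h : θ.Clo P) {q : Pt 3} {i j : Fin 3} (hR : θ.Qc P (.R i) q) (hij : i ≠ j)
    (he : θ.lc q i = θ.lc q j) : θ.Qc P (.R j) q := by
  have := h (.turn i j) q _ _ hR hR (by simp [rtgt]) ?_
  · simpa [roff, ov, rtgt, Qc] using this
  · simp only [roff, ov, add_zero]
    exact ⟨_, _, rfl, hij, by simpa [lc] using he, (θ.turnRow_eq q hij he).symm⟩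

theorem r_N (h : θ.Clo P) {q : Pt 3} (hR : ∀ i, θ.Qc P (.R i) q) : θ.Qc P .N q := by
  have hM : θ.Qc P .M q := by
    have := h .RM q _ _ (hR 0) (hR 1) (by simp [rtgt]) ?_
    · simpa [roff, ov, rtgt, Qc] using this
    · simp only [roff, ov, add_zero]
      refine ⟨_, _, _, _, rfl, rfl, ?_⟩
      rw [θ.merge1]; rfl
  have := h .MN q _ _ hM (hR 2) (by simp [rtgt]) ?_
  · simpa [roff, ov, rtgt, Qc] using this
  · simp only [roff, ov, add_zero]
    refine ⟨_, _, _, _, rfl, rfl, ?_⟩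
    change QV.lab (θ.labf q) = _
    congr 1
    funext a b
    exact (θ.merge2 q a b).symm

theorem slab (h : θ.Clo P) {B : Pt 3} {a : Fin 3} {k : ℤ}
    (hR : ∀ p, θ.blk p = B → θ.lc p a = k → θ.Qc P (.R a) p) :
    ∀ p, θ.blk p = B → θ.lc p a = k → θ.Qc P .N p := by
  have key : ∀ n : ℕ, ∀ p, θ.blk p = B → θ.lc p a = k → ∑ i, (θ.lc p i - k).natAbs = n → θ.Qc P .N p := by
    intro n
    induction n using Nat.strong_induction_on with
    | _ n ih =>
      intro p hB hk hn
      apply θ.r_N h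
      intro j
      by_cases hj : j = a
      · subst hj; exact hR p hB hk
      by_cases hjk : θ.lc p j = k
      · exact θ.r_turn h (hR p hB hk) (Ne.symm hj) (by rw [hk, hjk])
      · have hb := θ.box_lc p a
        rw [hk] at hb
        obtain ⟨ε, hε, q, hq, hqB, hnb, ho, hd⟩ := θ.toward p j k hb.1 hb.2 hjk
        have hN : θ.Qc P .N q := by
          refine ih _ ?_ q (by rw [hqB, hB]) (by rw [ho a (Ne.symm hj), hk]) rfl
          rw [← hn]
          exact dist_lt (t := fun _ => k) ho hd
        have := θ.r_NR h hN hnb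
        rwa [hq, hε] at this
  exact fun p hB hk => key _ p hB hk rfl

/-- entry coordinate -/
def ent (δ : Dir) : ℤ := if δ.2 then θ.m - 1 else 0

theorem ent_box (δ : Dir) : 0 ≤ θ.ent δ ∧ θ.ent δ < θ.m := by
  have := θ.mpos
  unfold ent
  split_ifs <;> omega

theorem not_nbd {p : Pt 3} {δ : Dir} (h : θ.lc p δ.1 = θ.ent δ) : ¬ nbd (θ.labf p) δ := by
  obtain ⟨a, b⟩ := δ
  cases b
  · simp only [lc, ent, nbd, labf, H] at h ⊢
    simp only [Bool.false_eq_true, if_false] at h ⊢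
    simp [h]
  · simp only [lc, ent, nbd, labf, H] at h ⊢
    simp only [if_true] at h ⊢
    have : (p a + 1) % (θ.m : ℤ) = 0 := by
      rw [← Int.emod_add_emod, h]
      simp
    simp [this]

theorem entry {p : Pt 3} {δ : Dir} (h : θ.lc p δ.1 = θ.ent δ) :
    θ.blk (p + dv δ) = θ.blk p + dv δ ∧ ¬ nbd (θ.labf (p + dv δ)) (opp δ) ∧ p + dv δ + dv (opp δ) = p := by
  have h1 := (θ.blk_step p δ).2 (θ.not_nbd h)
  have h2 : p + dv δ + dv (opp δ) = p := by rw [dv_opp]; simp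
  refine ⟨h1, ?_, h2⟩
  rw [nbd_iff, h2, h1]
  intro hc
  exact dv_ne_zero δ (by simpa using hc.symm)

theorem N_spread (h : θ.Clo P) {B : Pt 3} {δ : Dir} (hN : θ.NF P (B + dv δ)) (hW : θ.WF P (B + dv δ)) :
    θ.NF P B := by
  have key : ∀ n : ℕ, ∀ k, (k - θ.ent δ).natAbs = n → ∀ p, θ.blk p = B → θ.lc p δ.1 = k → θ.Qc P .N p := by
    intro n
    induction n using Nat.strong_induction_on with
    | _ n ih =>
      intro k hk
      apply θ.slab h
      intro p hB hp
      by_cases he : k = θ.ent δ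
      · rw [he] at hp
        obtain ⟨e1, e2, e3⟩ := θ.entry hp
        rw [hB] at e1
        have := θ.r_NW h (hN _ e1) (hW _ e1) e2
        rwa [e3] at this
      · obtain ⟨ε, hε, q, hq, hqB, hnb, ho, hd⟩ := θ.toward p δ.1 (θ.ent δ) (θ.ent_box δ).1 (θ.ent_box δ).2
          (by rw [hp]; exact he)
        have hNq : θ.Qc P .N q := ih _ (by rw [← hk]; rw [hp] at hd; exact hd) _ rfl q (by rw [hqB, hB]) rfl
        have := θ.r_NR h hNq hnb
        rwa [hq, hε] at this
  exact fun p hB => key _ _ rfl p hB rfl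

theorem spread (h : θ.Clo P) {B : Pt 3} (hN : θ.NF P B) {f : Fd} {J : Fin 3 → Prop}
    (hc : ∀ p, θ.cval f p = .bit true)
    (hJ : ∀ δ : Dir, J δ.1 → allowed f δ) (hf : f ≠ .K) {p0 : Pt 3} (hB0 : θ.blk p0 = B) (h0 : θ.Qc P f p0) :
    ∀ p, θ.blk p = B → (∀ i, ¬ J i → θ.lc p i = θ.lc p0 i) → θ.Qc P f p := by
  have key : ∀ n : ℕ, ∀ p, θ.blk p = B → (∀ i, ¬ J i → θ.lc p i = θ.lc p0 i) →
      ∑ i, (θ.lc p i - θ.lc p0 i).natAbs = n → θ.Qc P f p := by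
    intro n
    induction n using Nat.strong_induction_on with
    | _ n ih =>
      intro p hB hp hn
      by_cases he : θ.lc p = θ.lc p0
      · have : p = p0 := by rw [← θ.pt_blk_lc p, ← θ.pt_blk_lc p0, he, hB, hB0]
        rwa [this]
      · obtain ⟨j, hj⟩ := Function.ne_iff.1 he
        have hjJ : J j := by by_contra hc; exact hj (hp j hc)
        obtain ⟨ε, hε, q, hq, hqB, hnb, ho, hd⟩ := θ.toward p j _ (θ.box_lc p0 j).1 (θ.box_lc p0 j).2 hj
        have hQ : θ.Qc P f q := by
          refine ih _ ?_ q (by rw [hqB, hB]) ?_ rfl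
          · rw [← hn]; exact dist_lt ho hd
          · intro i hi
            rw [ho i (by rintro rfl; exact hi hjJ), hp i hi]
        have hNq := hN q (by rw [hqB, hB])
        have := h (.Sp f ε) q _ _ hQ hNq hf ⟨_, rfl, hJ ε (by rw [hε]; exact hjJ), hnb, hc _⟩
        simp only [roff, ov, rtgt, hq] at this
        exact this
  exact fun p hB hp => key _ p hB hp rfl

theorem win_full (h : θ.Clo P) {B : Pt 3} {c : ℤ} (h0 : 0 ≤ c) (h1 : c < θ.m) (hN : θ.NF P B)
    (hK : θ.chain P B c) : θ.WF P B ∧ θ.WinF P B c := by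
  have hL : ∀ n : ℕ, (n : ℤ) ≤ c → θ.Qc P .L (θ.kp B n) := by
    intro n
    induction n with
    | zero =>
      intro hn
      have hk : ∃ v, P (θ.kp B 0, .K) v := by
        by_cases hc : c = 0
        · exact ⟨_, hc ▸ hK.2⟩
        · exact ⟨_, hK.1 0 le_rfl (by omega)⟩
      obtain ⟨v, hv⟩ := hk
      have hb := θ.blk_kp B le_rfl θ.mpos
      have hl := θ.lc_kp B le_rfl θ.mpos
      have := h .LS (θ.kp B 0) _ _ hv (hN _ hb) (by simp [rtgt]) ?_
      · simpa [roff, ov, rtgt, Qc] using this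
      · simp only [roff, ov, add_zero]
        refine ⟨_, rfl, ?_, rfl⟩
        simp only [labf, H, decide_eq_true_eq]
        exact congrFun hl 0
    | succ n ih =>
      intro hn
      push_cast at hn ⊢
      have := h .LP (θ.kp B n) _ _ (hK.1 n (by omega) (by omega)) (ih (by omega)) (by simp [rtgt]) ⟨rfl, rfl⟩
      simp only [roff, ov, kp_step] at this
      exact this
  have hLc : θ.Qc P .L (θ.kp B c) := by
    have := hL c.toNat (by omega)
    rwa [Int.toNat_of_nonneg h0] at this
  have hb := θ.blk_kp B h0 h1
  have hl := θ.lc_kp B h0 h1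
  have hW : θ.Qc P .W (θ.kp B c) := by
    have := h .KW (θ.kp B c) _ _ hK.2 hLc (by simp [rtgt]) ⟨rfl, rfl⟩
    simpa [roff, ov, rtgt, Qc] using this
  have hW0 : θ.Qc P (.Win 0) (θ.kp B c) := by
    have := h .KWin (θ.kp B c) _ _ hK.2 hLc (by simp [rtgt]) ⟨rfl, rfl⟩
    simpa [roff, ov, rtgt, Qc] using this
  refine ⟨fun p hp => ?_, ?_⟩
  · exact θ.spread h hN (f := .W) (J := fun _ => True) (fun _ => rfl) (fun _ _ => trivial) (by simp) hb hW p hp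
      (fun i hi => absurd trivial hi)
  · have hW0' : ∀ p, θ.blk p = B → θ.lc p 0 = c → θ.Qc P (.Win 0) p := by
      intro p hp hpc
      refine θ.spread h hN (f := .Win 0) (J := fun i => i ≠ 0) (fun _ => rfl) (fun _ hδ => hδ) (by simp) hb hW0 p hp ?_
      intro i hi
      have : i = 0 := by simpa using hi
      rw [this, hl, hpc]; rfl
    intro j p hp hpc
    have hbox : θ.box (fun _ => c) := fun _ => ⟨h0, h1⟩
    have hb1 := θ.blk_pt (B := B) hbox
    have hl1 := θ.lc_pt (B := B) hbox
    have hj : θ.Qc P (.Win j) (θ.pt B (fun _ => c)) := by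
      have := h (.WT j) (θ.pt B (fun _ => c)) _ _ (hW0' _ hb1 (by rw [hl1])) (hN _ hb1) (by simp [rtgt]) ?_
      · simpa [roff, ov, rtgt, Qc] using this
      · refine ⟨_, rfl, ?_, rfl⟩
        simp only [labf, H, decide_eq_true_eq]
        have e0 := congrFun hl1 0
        have e1 := congrFun hl1 j
        simp only [lc] at e0 e1
        rw [e0, e1]
    refine θ.spread h hN (f := .Win j) (J := fun i => i ≠ j) (fun _ => rfl) (fun _ hδ => hδ) (by simp) hb1 hj p hp ?_
    intro i hi
    have : i = j := by simpa using hi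
    rw [this, hl1, hpc]

theorem in_full (h : θ.Clo P) {B : Pt 3} {c c' : ℤ} {d : Dir} (h0 : 0 ≤ c) (h1 : c < θ.m)
    (h0' : 0 ≤ c') (h1' : c' < θ.m) (hN : θ.NF P B)
    (hN' : θ.NF P (B + dv d)) (hW' : θ.WinF P (B + dv d) c') (hmb : θ.mb c c' (opp d) = true) :
    ∀ p, θ.blk p = B → θ.lc p (jx d) = c → θ.Qc P (.In d) p := by
  have n1 : d.1 + 1 ≠ d.1 := by generalize d.1 = z; revert z; decide
  have n2 : d.1 + 2 ≠ d.1 := by generalize d.1 = z; revert z; decide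
  have n3 : d.1 + 2 ≠ d.1 + 1 := by generalize d.1 = z; revert z; decide
  let y : Pt 3 := fun i => if i = d.1 then θ.ent d else if i = d.1 + 1 then c else c'
  have hbox : θ.box y := by
    intro i
    simp only [y]
    split_ifs
    · exact θ.ent_box d
    · exact ⟨h0, h1⟩
    · exact ⟨h0', h1'⟩
  have hb := θ.blk_pt (B := B) hbox
  have hl := θ.lc_pt (B := B) hbox
  have y0 : θ.lc (θ.pt B y) d.1 = θ.ent d := by rw [hl]; simp [y]
  have y1 : θ.lc (θ.pt B y) (d.1 + 1) = c := by rw [hl]; simp [y, n1]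
  have y2 : θ.lc (θ.pt B y) (d.1 + 2) = c' := by rw [hl]; simp [y, n2, n3]
  obtain ⟨e1, e2, e3⟩ := θ.entry y0
  rw [hb] at e1
  have z1 : θ.lc (θ.pt B y + dv d) (d.1 + 1) = c := by rw [θ.lc_other n1, y1]
  have z2 : θ.lc (θ.pt B y + dv d) (d.1 + 2) = c' := by rw [θ.lc_other n2, y2]
  have hIn : θ.Qc P (.In d) (θ.pt B y) := by
    have := h (.CR (opp d)) (θ.pt B y + dv d) _ _ (hW' _ _ e1 z2) (hN' _ e1) (by simp [rtgt]) ?_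
    · simp only [roff, ov, rtgt, opp_opp, e3] at this
      exact this
    · refine ⟨_, rfl, e2, ?_, rfl⟩
      have : (θ.labf (θ.pt B y + dv d) (d.1 + 1) (d.1 + 2)).mb (opp d) =
        θ.mb (θ.lc (θ.pt B y + dv d) (d.1 + 1)) (θ.lc (θ.pt B y + dv d) (d.1 + 2)) (opp d) := rfl
      rw [z1, z2] at this
      exact this.trans hmb
  intro p hp hpc
  refine θ.spread h hN (f := .In d) (J := fun i => i ≠ jx d) (fun _ => rfl) (fun _ hδ => hδ) (by simp) hb hIn p hp ?_
  intro i hi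
  have : i = jx d := by simpa using hi
  rw [this, hpc]
  exact y1.symm

theorem A_full (h : θ.Clo P) {B : Pt 3} {c : ℤ} {S : Dir → Bool} (hS : θ.cs c = some S) (hN : θ.NF P B)
    (hIn : ∀ d, S d = true → ∀ p, θ.blk p = B → θ.lc p (jx d) = c → θ.Qc P (.In d) p) :
    θ.Qc P (.A 6) (θ.kp B c) := by
  obtain ⟨h0, h1⟩ := θ.cs_range c S hS
  have hbox : θ.box (fun _ => c) := fun _ => ⟨h0, h1⟩
  have hb := θ.blk_pt (B := B) hbox
  have hl := θ.lc_pt (B := B) hbox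
  have e : ∀ i, θ.pt B (fun _ => c) i % θ.m = c := fun i => congrFun hl i
  have hA : ∀ n (hn : n < 7), θ.Qc P (.A ⟨n, hn⟩) (θ.pt B (fun _ => c)) := by
    intro n
    induction n with
    | zero =>
      intro hn
      have := h .A0 (θ.pt B (fun _ => c)) _ _ (hN _ hb) (hN _ hb) (by simp [rtgt]) ?_
      · simpa [roff, ov, rtgt, Qc] using this
      · refine ⟨_, rfl, ?_, ?_, ?_, rfl⟩
        · simp only [labf, H, e, decide_true]
        · simp only [labf, H, e, decide_true]
        · simp only [labf, H, e, hS]; simp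
    | succ n ih =>
      intro hn
      have ih := ih (by omega)
      let k : Fin 6 := ⟨n, by omega⟩
      cases hSk : S (dk k) with
      | true =>
        have := h (.AI k) (θ.pt B (fun _ => c)) _ _ ih (hIn _ hSk _ hb (by rw [hl])) (by simp [rtgt]) rfl
        simpa [roff, ov, rtgt, k, Qc] using this
      | false =>
        have := h (.AN k) (θ.pt B (fun _ => c)) _ _ ih (hN _ hb) (by simp [rtgt]) ?_
        · simpa [roff, ov, rtgt, k, Qc] using this
        · refine ⟨_, S, rfl, ?_, hSk, rfl⟩
          simp only [labf, H, e, hS]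
  refine θ.spread h hN (f := .A 6) (J := fun i => i ≠ 0) (fun _ => rfl) (fun _ hδ => ⟨rfl, hδ⟩) (by simp) hb
    (hA 6 (by omega)) _ (θ.blk_kp B h0 h1) ?_
  intro i hi
  have : i = 0 := by simpa using hi
  rw [this, hl, θ.lc_kp B h0 h1]; rfl

structure FullB (P : Pt 3 × Fd → QV → Prop) (B : Pt 3) (c : ℤ) : Prop where
  n : θ.NF P B
  w : θ.WF P B
  win : θ.WinF P B c
  ch : θ.chain P B c

/-- an enabled candidate reaches the test `A 6` -/
theorem en_full (h : θ.Clo P) {ω : St (Pt 3) ℤ} (hrg : ∀ B c, ω B = some c → 0 ≤ c ∧ c < θ.m) {B c H}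
    (hr : θ.cgs.rule B c H) (hH : ∀ k ∈ H, ω k.1 = some k.2) (hF : ∀ k ∈ H, θ.FullB P k.1 k.2) :
    θ.NF P B ∧ θ.Qc P (.A 6) (θ.kp B c) := by
  obtain ⟨S, g, hS, hmb, rfl⟩ := hr
  have hmem : ∀ d, S d = true → (B + dv d, g d) ∈
      (Finset.univ.filter (fun d => S d = true)).image (fun d => (B + dv d, g d)) := by
    intro d hd
    simp only [Finset.mem_image, Finset.mem_filter, Finset.mem_univ, true_and]
    exact ⟨d, hd, rfl⟩
  obtain ⟨d0, hd0⟩ := θ.cs_ne c S hS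
  have f0 := hF _ (hmem d0 hd0)
  have hN : θ.NF P B := θ.N_spread h f0.n f0.w
  refine ⟨hN, θ.A_full h hS hN fun d hd => ?_⟩
  have fd := hF _ (hmem d hd)
  obtain ⟨r0, r1⟩ := θ.cs_range c S hS
  obtain ⟨r2, r3⟩ := hrg _ _ (hH _ (hmem d hd))
  exact θ.in_full h r0 r1 r2 r3 hN fd.n fd.win (hmb d hd)

theorem full (h : θ.Clo P) {ω0 ω : St (Pt 3) ℤ} (hl : Le ω0 ω) (hrg : ∀ B c, ω B = some c → 0 ≤ c ∧ c < θ.m)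
    (h0 : ∀ B, ω0 B ≠ none → θ.NF P B)
    (hK : ∀ B c, ω B = some c → (ω0 B ≠ none ∨ (θ.NF P B ∧ θ.Qc P (.A 6) (θ.kp B c))) → θ.chain P B c)
    {B} (hs : θ.cgs.Supp ω0 ω B) : ∀ c, ω B = some c → θ.FullB P B c := by
  have fin : ∀ B c, ω B = some c → θ.NF P B → θ.chain P B c → θ.FullB P B c := by
    intro B c hc hN hch
    obtain ⟨r0, r1⟩ := hrg _ _ hc
    obtain ⟨a1, a2⟩ := θ.win_full h r0 r1 hN hch
    exact ⟨hN, a1, a2, hch⟩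
  induction hs with
  | base hb =>
    intro c hc
    exact fin _ _ hc (h0 _ hb) (hK _ _ hc (Or.inl hb))
  | step hv hr hH _ ih =>
    intro c hc
    rw [hv] at hc
    cases hc
    have := θ.en_full h hrg hr hH (fun k hk => ih k hk _ (hH k hk))
    exact fin _ _ hv this.1 (hK _ _ hv (Or.inr this))

end Par
end IU

namespace IU

theorem GS.restr {X V : Type} {G : GS X V} {s t : St X V} (h : Le s t) :
    G.Reach s (fun x => if G.Supp s t x then t x else none) := by
  refine ⟨fun x v hv => ?_, fun x hx => ?_⟩
  · have h1 : G.Supp s t x := .base (by simp [hv])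
    beta_reduce
    rw [if_pos h1]
    exact h _ _ hv
  · by_cases h1 : G.Supp s t x
    · clear hx
      induction h1 with
      | base h => exact .base h
      | step hv hr hH hS ih =>
        refine .step (v := _) ?_ hr ?_ ih
        · beta_reduce
          rw [if_pos (.step hv hr hH hS)]
          exact hv
        · intro k hk
          beta_reduce
          rw [if_pos (hS k hk)]
          exact hH k hk
    · beta_reduce at hx
      rw [if_neg h1] at hx
      exact absurd rfl hx

namespace Par
variable (θ : Par)

/-! ## The seed -/

/-- value of the decision chain -/
def kval (p : Pt 3) (o : Option ℤ) : Option QV :=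
  match o with
  | none => none
  | some c => if θ.lc p 1 = 0 ∧ θ.lc p 2 = 0 ∧ θ.lc p 0 ≤ c then some (.bit (decide (θ.lc p 0 = c))) else none

theorem kval_kp (B : Pt 3) {c' c : ℤ} (h0 : 0 ≤ c') (h1 : c' < θ.m) :
    θ.kval (θ.kp B c') (some c) = if c' ≤ c then some (.bit (decide (c' = c))) else none := by
  simp [kval, θ.lc_kp B h0 h1]

def seed0 (ω0 : St (Pt 3) ℤ) : OSt := fun x =>
  match x.2 with
  | .N => if ω0 (θ.blk x.1) ≠ none then some (.lab (θ.labf x.1)) else none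
  | .K => θ.kval x.1 (ω0 (θ.blk x.1))
  | _ => none

variable {ω0 : St (Pt 3) ℤ}

theorem seed0_K (B : Pt 3) {c' : ℤ} (h0 : 0 ≤ c') (h1 : c' < θ.m) :
    θ.seed0 ω0 (θ.kp B c', .K) = θ.kval (θ.kp B c') (ω0 B) := by
  simp [seed0, θ.blk_kp B h0 h1]

theorem win_seed0 (hrg : ∀ B c, ω0 B = some c → 0 ≤ c ∧ c < θ.m) : θ.win (θ.seed0 ω0) = ω0 := by
  have h1 : ∀ B c, ω0 B = some c → θ.win (θ.seed0 ω0) B = some c := by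
    intro B c h
    obtain ⟨r0, r1⟩ := hrg B c h
    rw [win_iff]
    refine ⟨r0, r1, fun c' h0 h1 => ?_, ?_⟩
    · rw [θ.seed0_K B h0 (by omega), h, θ.kval_kp B h0 (by omega), if_pos h1.le]
      simp [h1.ne]
    · rw [θ.seed0_K B r0 r1, h, θ.kval_kp B r0 r1]
      simp
  funext B
  cases h : ω0 B with
  | some c => exact h1 B c h
  | none =>
    by_contra hc
    obtain ⟨c, hc⟩ := Option.ne_none_iff_exists'.1 hc
    have := θ.win_iff.1 hc
    have h2 := this.2.2.2
    rw [θ.seed0_K B this.1 this.2.1, h] at h2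
    cases h2

theorem seed0_dom {x : Pt 3 × Fd} (h : θ.seed0 ω0 x ≠ none) : ω0 (θ.blk x.1) ≠ none := by
  obtain ⟨p, f⟩ := x
  cases f <;> simp only [seed0] at h
  case N => by_contra hc; simp [hc] at h
  case K =>
    intro hc
    rw [hc] at h
    exact h rfl
  all_goals exact absurd rfl h

theorem seed0_safe (hrg : ∀ B c, ω0 B = some c → 0 ≤ c ∧ c < θ.m) : θ.Safe (θ.seed0 ω0) := by
  intro x v hv
  have hd := θ.seed0_dom (x := x) (by rw [hv]; simp)
  rw [θ.win_seed0 hrg]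
  refine ⟨Or.inl hd, ?_⟩
  obtain ⟨p, f⟩ := x
  cases f <;> simp only [seed0] at hv
  case N =>
    rw [if_pos hd] at hv
    cases hv
    rfl
  case K =>
    obtain ⟨c, hc⟩ := Option.ne_none_iff_exists'.1 hd
    simp only at hc
    rw [hc] at hv
    simp only [kval] at hv
    split_ifs at hv with h1
    obtain ⟨h1, h2, h3⟩ := h1
    refine ⟨h1, h2, ?_⟩
    by_cases h4 : θ.lc p 0 = c
    · left
      refine ⟨by simpa [h4] using hv.symm, Or.inl ⟨by rw [hc, h4], ?_⟩⟩
      exact hd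
    · right
      obtain ⟨r0, r1⟩ := hrg _ _ hc
      have hb := θ.box_lc p
      have hbox : θ.box (θ.lc p + dv (0, true)) := by
        intro i
        by_cases hi : i = 0
        · subst hi
          have := hb 0
          simp [dv, sg]; omega
        · have := hb i
          simpa [dv, hi] using this
      obtain ⟨e1, e2⟩ := θ.step_in hbox
      refine ⟨by simpa [h4] using hv.symm, e1, ?_⟩
      simp only [seed0]
      rw [e1, hc]
      simp only [kval]
      rw [e2]
      simp [dv, sg, h1, h2]
      omega
  all_goals cases hv

/-! ## consequences of safety -/

theorem Safe.cval {s : OSt} (h : θ.Safe s) {p f v} (hv : s (p, f) = some v) (hf : f ≠ .K) : v = θ.cval f p := by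
  have := (h _ _ hv).2
  cases f with
  | R i => exact this
  | M => exact this
  | N => exact this
  | K => exact absurd rfl hf
  | _ => exact this.1

/-- F2 -/
theorem Safe.clean {s : OSt} (h : θ.Safe s) {x : Pt 3 × Fd}
    (hx : s x ≠ none ∨ ∃ v, SU.gs.En s x v) : near (θ.win s) (θ.blk x.1) := by
  rcases hx with hx | ⟨v, H, hr, hH⟩
  · obtain ⟨v, hv⟩ := Option.ne_none_iff_exists'.1 hx
    exact (h _ _ hv).1
  · obtain ⟨r, p, a, b, rfl, h2, h3, h4⟩ := rule_cases hr
    exact (θ.cond_rule (D := fun B => θ.win s B ≠ none) rfl (fun B c h1 _ => by simp [h1]) r p a b v (hH _ h3) (hH _ h4)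
      (h _ _ (hH _ h3)) (h _ _ (hH _ h4)) h2).1

theorem en_rule {s : OSt} {r : Ru} {p : Pt 3} {a b v : QV} (ha : s (p, rf1 r) = some a) (hb : s (p, rf2 r) = some b)
    (hr : rrel r a b v) : ∃ H, SU.gs.rule (p + ov (roff r), rtgt r) v H ∧ (∀ k ∈ H, s k.1 = some k.2) ∧
      ∀ k ∈ H, k.1 = (p, rf1 r) ∨ k.1 = (p, rf2 r) := by
  refine ⟨{((p, rf1 r), a), ((p, rf2 r), b)}, ⟨r, p, a, b, rfl, hr, rfl⟩, ?_, ?_⟩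
  · intro k hk
    simp only [Finset.mem_insert, Finset.mem_singleton] at hk
    rcases hk with rfl | rfl
    · exact ha
    · exact hb
  · intro k hk
    simp only [Finset.mem_insert, Finset.mem_singleton] at hk
    rcases hk with rfl | rfl
    · exact Or.inl rfl
    · exact Or.inr rfl

theorem kp_back (B : Pt 3) (c : ℤ) : θ.kp B c + dv (0, false) = θ.kp B (c - 1) := by
  rw [kp, kp, pt_add]
  congr 1
  funext i
  fin_cases i <;> simp [dv, sg]
  rfl

theorem rel_KO {B : Pt 3} {c : ℤ} (h0 : 0 ≤ c) (h1 : c < θ.m) (a : QV) :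
    rrel .KO a (θ.cval .N (θ.kp B c)) (.bit true) := by
  have hl := θ.lc_kp B h0 h1
  refine ⟨_, rfl, ?_, ?_, rfl⟩
  · simp only [labf, H, decide_eq_true_eq]
    exact congrFun hl 1
  · simp only [labf, H, decide_eq_true_eq]
    exact congrFun hl 2

theorem rel_KP {B : Pt 3} {c : ℤ} (h0 : 0 < c) (h1 : c < θ.m) (a : QV) :
    rrel .KP a (θ.cval .N (θ.kp B c)) (.bit false) := by
  have hl := θ.lc_kp B h0.le h1
  refine ⟨_, rfl, ?_, rfl⟩
  simp only [labf, H, decide_eq_false_iff_not]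
  have : θ.kp B c 0 % θ.m = c := congrFun hl 0
  rw [this]
  exact h0.ne'

theorem win_range {s : OSt} {B c} (h : θ.win s B = some c) : 0 ≤ c ∧ c < θ.m :=
  ⟨(θ.win_iff.1 h).1, (θ.win_iff.1 h).2.1⟩

theorem seed0_N {B : Pt 3} (h : ω0 B ≠ none) {p} (hp : θ.blk p = B) :
    θ.seed0 ω0 (p, .N) = some (θ.cval .N p) := by
  simp only [seed0, hp]
  rw [if_pos h]
  rfl

/-- F3 -/
theorem term_win (hrg : ∀ B c, ω0 B = some c → 0 ≤ c ∧ c < θ.m) {s : OSt} (hr : SU.gs.Reach (θ.seed0 ω0) s)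
    (ht : SU.gs.Term s) : θ.cgs.Term (θ.win s) := by
  have hs : θ.Safe s := Safe.reach θ (θ.seed0_safe hrg) hr
  have hen : ∀ r p a b v, s (p, rf1 r) = some a → s (p, rf2 r) = some b → rrel r a b v →
      s (p + ov (roff r), rtgt r) ≠ none := by
    intro r p a b v ha hb hrel hn
    obtain ⟨H, h1, h2, -⟩ := en_rule ha hb hrel
    exact ht _ _ hn ⟨H, h1, h2⟩
  have hclo : θ.Clo (fun x v => s x = some v) := by
    intro r p a b ha hb hK hrel
    obtain ⟨v, hv⟩ := Option.ne_none_iff_exists'.1 (hen r p a b _ ha hb hrel)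
    beta_reduce
    rw [hv, Safe.cval θ hs hv hK]
  have hwr := θ.win_reach (θ.seed0_safe hrg) hr
  rw [θ.win_seed0 hrg] at hwr
  have hfull : ∀ B c, θ.win s B = some c → θ.FullB (fun x v => s x = some v) B c := by
    intro B c hc
    refine θ.full hclo hwr.1 (fun B c h => θ.win_range h) ?_ ?_ (hwr.2 B (by simp [hc])) c hc
    · intro B hB p hp
      exact hr.1 _ _ (θ.seed0_N hB hp)
    · intro B c hc _
      have := θ.win_iff.1 hc
      exact ⟨this.2.2.1, this.2.2.2⟩
  rintro B c hn ⟨H, hr, hH⟩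
  obtain ⟨hN, hA⟩ := θ.en_full hclo (ω := θ.win s) (fun B c h => θ.win_range h) hr hH (fun k hk => hfull _ _ (hH k hk))
  obtain ⟨S, g, hS, -⟩ := hr
  obtain ⟨r0, r1⟩ := θ.cs_range c S hS
  have hKn : ∀ n : ℕ, (n : ℤ) ≤ c → s (θ.kp B (c - n), .K) ≠ none := by
    intro n
    induction n with
    | zero =>
      intro _
      have := hen .KO _ _ _ _ hA (hN _ (θ.blk_kp B r0 r1)) (θ.rel_KO r0 r1 _)
      simpa [roff, ov, rtgt] using this
    | succ n ih =>
      intro hle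
      push_cast at hle
      obtain ⟨v, hv⟩ := Option.ne_none_iff_exists'.1 (ih (by omega))
      have := hen .KP _ _ _ _ hv (hN _ (θ.blk_kp B (by omega) (by omega))) (θ.rel_KP (by omega) (by omega) _)
      simp only [roff, ov, rtgt, kp_back] at this
      push_cast
      rwa [← sub_sub]
  refine θ.dec_of_K0 hs ?_ hn
  have := hKn c.toNat (by omega)
  rwa [Int.toNat_of_nonneg r0, sub_self] at this

def NoK (s : OSt) : Prop := ∀ p, θ.win s (θ.blk p) = none → s (p, .K) = none

/-- the ideal continuation of `s` -/
def hat (s : OSt) (ω' : St (Pt 3) ℤ) : OSt := fun x =>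
  if s x ≠ none then s x else
    match x.2 with
    | .K => if θ.win s (θ.blk x.1) = none then θ.kval x.1 (ω' (θ.blk x.1)) else none
    | f => some (θ.cval f x.1)

theorem hat_nonK {s : OSt} {ω' : St (Pt 3) ℤ} {p f} (hf : f ≠ .K) (h : s (p, f) = none) :
    θ.hat s ω' (p, f) = some (θ.cval f p) := by
  unfold hat
  rw [if_neg (by simp [h])]
  cases f <;> first | rfl | exact absurd rfl hf

theorem hat_K {s : OSt} {ω' : St (Pt 3) ℤ} {p} (h : s (p, .K) = none) (hw : θ.win s (θ.blk p) = none) :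
    θ.hat s ω' (p, .K) = θ.kval p (ω' (θ.blk p)) := by
  unfold hat
  rw [if_neg (by simp [h])]
  simp only
  rw [if_pos hw]

/-- F4 -/
theorem follow_win (hrg : ∀ B c, ω0 B = some c → 0 ≤ c ∧ c < θ.m) {s : OSt} (hr : SU.gs.Reach (θ.seed0 ω0) s)
    (hk : θ.NoK s) {ω' : St (Pt 3) ℤ} (hω : θ.cgs.Reach (θ.win s) ω') :
    ∃ s', SU.gs.Reach s s' ∧ θ.win s' = ω' := by
  have hs : θ.Safe s := Safe.reach θ (θ.seed0_safe hrg) hr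
  have hle : Le s (θ.hat s ω') := by
    intro x v hv
    unfold hat
    rw [if_pos (by simp [hv]), hv]
  let s' : OSt := fun x => if SU.gs.Supp s (θ.hat s ω') x then θ.hat s ω' x else none
  have hreach : SU.gs.Reach s s' := GS.restr hle
  have hs' : ∀ x v, s' x = some v ↔ SU.gs.Supp s (θ.hat s ω') x ∧ θ.hat s ω' x = some v := by
    intro x v
    simp only [s']
    split_ifs with h <;> simp [h]
  have hrule : ∀ r p a b v, s' (p, rf1 r) = some a → s' (p, rf2 r) = some b → rrel r a b v →
      θ.hat s ω' (p + ov (roff r), rtgt r) = some v → s' (p + ov (roff r), rtgt r) = some v := by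
    intro r p a b v ha hb hrel hv
    obtain ⟨a1, a2⟩ := (hs' _ _).1 ha
    obtain ⟨b1, b2⟩ := (hs' _ _).1 hb
    obtain ⟨H, h1, h2, h3⟩ := en_rule a2 b2 hrel
    rw [hs']
    refine ⟨.step hv h1 h2 ?_, hv⟩
    intro k hk
    rcases h3 k hk with h | h
    · rw [h]; exact a1
    · rw [h]; exact b1
  have hclo : θ.Clo (fun x v => s' x = some v) := by
    intro r p a b ha hb hK hrel
    beta_reduce at ha hb ⊢
    cases hv : s (p + ov (roff r), rtgt r) with
    | some v =>
      rw [hreach.1 _ _ hv, Safe.cval θ hs hv hK]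
    | none => exact hrule r p a b _ ha hb hrel (θ.hat_nonK hK hv)
  have hwr := θ.win_reach (θ.seed0_safe hrg) hr
  rw [θ.win_seed0 hrg] at hwr
  have hwr' := hwr.trans hω
  have hrg' : ∀ B c, ω' B = some c → 0 ≤ c ∧ c < θ.m := by
    intro B c hc
    have h1 := hω.2 B (by simp [hc])
    cases h1 with
    | base h => exact θ.win_range (hω.1.eq_of hc h)
    | step hv hr _ _ =>
      rw [hc] at hv
      cases hv
      obtain ⟨S, g, hS, -⟩ := hr
      exact θ.cs_range c S hS
  have hfull : ∀ B c, ω' B = some c → θ.FullB (fun x v => s' x = some v) B c := by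
    intro B c hc
    refine θ.full hclo hwr'.1 hrg' ?_ ?_ (hwr'.2 B (by simp [hc])) c hc
    · intro B hB p hp
      exact hreach.1 _ _ (hr.1 _ _ (θ.seed0_N hB hp))
    · intro B c hc hor
      by_cases hw : θ.win s B = none
      · obtain ⟨hN, hA⟩ : θ.NF (fun x v => s' x = some v) B ∧ θ.Qc (fun x v => s' x = some v) (.A 6) (θ.kp B c) := by
          rcases hor with h | h
          · exact absurd hw (hwr.1.ne h)
          · exact h
        obtain ⟨r0, r1⟩ := hrg' B c hc
        have hhat : ∀ c', 0 ≤ c' → c' ≤ c → θ.hat s ω' (θ.kp B c', .K) = some (.bit (decide (c' = c))) := by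
          intro c' h0 h1
          have hb := θ.blk_kp B h0 (show c' < θ.m by omega)
          rw [θ.hat_K (hk _ (by rw [hb, hw])) (by rw [hb, hw]), hb, hc, θ.kval_kp B h0 (by omega), if_pos h1]
        have hKn : ∀ n : ℕ, (n : ℤ) ≤ c → s' (θ.kp B (c - n), .K) = some (.bit (decide (c - n = c))) := by
          intro n
          induction n with
          | zero =>
            intro _
            have := hrule .KO _ _ _ _ hA (hN _ (θ.blk_kp B r0 r1)) (θ.rel_KO r0 r1 _) (by
              simp only [roff, ov, rtgt, add_zero]
              rw [hhat c r0 le_rfl]; simp)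
            simpa [roff, ov, rtgt] using this
          | succ n ih =>
            intro hlen
            push_cast at hlen
            have h1 := hhat (c - n - 1) (by omega) (by omega)
            have e : decide (c - (n : ℤ) - 1 = c) = false := by
              rw [decide_eq_false_iff_not]; omega
            rw [e] at h1
            have := hrule .KP _ _ _ (.bit false) (ih (by omega)) (hN _ (θ.blk_kp B (by omega) (by omega)))
              (θ.rel_KP (by omega) (by omega) _) (by
                simp only [roff, ov, rtgt, kp_back]
                exact h1)
            simp only [roff, ov, rtgt, kp_back] at this
            push_cast
            rw [← sub_sub, this, e]
        have hKc : ∀ c', 0 ≤ c' → c' ≤ c → s' (θ.kp B c', .K) = some (.bit (decide (c' = c))) := by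
          intro c' h0 h1
          have := hKn (c - c').toNat (by omega)
          rw [Int.toNat_of_nonneg (by omega)] at this
          simpa using this
        refine ⟨fun c' h0 h1 => ?_, ?_⟩
        · have := hKc c' h0 h1.le
          simpa [h1.ne] using this
        · have := hKc c r0 le_rfl
          simpa using this
      · have h1 := θ.win_iff.1 (hω.1.eq_of hc hw)
        exact ⟨fun c' a b => hreach.1 _ _ (h1.2.2.1 c' a b), hreach.1 _ _ h1.2.2.2⟩
  refine ⟨s', hreach, ?_⟩
  symm
  apply Le.antisymm
  · intro B c hc
    rw [win_iff]
    obtain ⟨r0, r1⟩ := hrg' B c hc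
    have := (hfull B c hc).ch
    exact ⟨r0, r1, this.1, this.2⟩
  · intro B hB
    obtain ⟨c, hc⟩ := Option.ne_none_iff_exists'.1 hB
    by_cases hw : θ.win s B = none
    · have hd := θ.win_iff.1 hc
      have h1 := ((hs' _ _).1 hd.2.2.2).2
      have hb := θ.blk_kp B hd.1 hd.2.1
      rw [θ.hat_K (hk _ (by rw [hb, hw])) (by rw [hb, hw]), hb] at h1
      intro hc
      rw [hc] at h1
      cases h1
    · exact hω.1.ne hw

/-! ### trimming -/

def Zs (s : OSt) : Set (Pt 3 × Fd) := {x | s x = none ∨ (x.2 = .K ∧ θ.win s (θ.blk x.1) = none)}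

theorem Zs_closed {s : OSt} (hs : θ.Safe s) : ∀ r p a b c, s (p, rf1 r) = some a → s (p, rf2 r) = some b →
    rrel r a b c → (p + ov (roff r), rtgt r) ∉ θ.Zs s → (p, rf1 r) ∉ θ.Zs s ∧ (p, rf2 r) ∉ θ.Zs s := by
  intro r p a b c ha hb hrel hZ
  have h2 : rf2 r ≠ .K := by cases r <;> simp [rf2]
  have hL : ∀ b, s (p, .L) = some b → θ.win s (θ.blk p) ≠ none := fun b hb =>
    θ.dec_of_K0 hs (hs _ _ hb).2.2.2.2.2
  refine ⟨?_, ?_⟩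
  · rintro (h | ⟨h, hw⟩)
    · rw [ha] at h; cases h
    · simp only at h hw
      cases r with
      | KW => exact hL _ hb hw
      | KWin => exact hL _ hb hw
      | LP => exact hL _ hb hw
      | KP =>
        obtain ⟨x, rfl, h1, rfl⟩ := hrel
        have e : QV.lab x = .lab (θ.labf p) := Safe.cval θ hs hb (by simp [rf2])
        cases e
        have hnb : nbd (θ.labf p) (0, false) := h1
        apply hZ
        refine Or.inr ⟨rfl, ?_⟩
        simp only [roff, ov]
        rw [(θ.blk_step p (0, false)).1 hnb, hw]
      | LS =>
        obtain ⟨x, rfl, h1, rfl⟩ := hrel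
        have e : QV.lab x = .lab (θ.labf p) := Safe.cval θ hs hb (by simp [rf2])
        cases e
        simp only [labf, H, decide_eq_true_eq] at h1
        have h1 : θ.lc p 0 = 0 := h1
        have hK := (hs _ _ ha).2
        have e := θ.kp_eq hK.1 hK.2.1
        rw [h1] at e
        refine θ.dec_of_K0 hs ?_ hw
        rw [e]
        have : s (p, .K) = some a := ha
        rw [this]; simp
      | Sp f δ =>
        simp only [rf1] at h
        subst h
        obtain ⟨_, _, h1, _⟩ := hrel
        exact h1
      | _ => simp [rf1] at h
  · rintro (h | ⟨h, hw⟩)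
    · rw [hb] at h; cases h
    · exact h2 h

def cut (s : OSt) : OSt := fun x => if x ∈ θ.Zs s then none else s x

theorem win_cut (s : OSt) : θ.win (θ.cut s) = θ.win s := by
  have hle : Le (θ.cut s) s := by
    intro x v h
    simp only [cut] at h
    split_ifs at h
    exact h
  apply Le.antisymm (θ.win_mono hle)
  intro B hB
  obtain ⟨c, hc⟩ := Option.ne_none_iff_exists'.1 hB
  have hd := θ.win_iff.1 hc
  have key : ∀ (c' : ℤ) v, 0 ≤ c' → c' < θ.m → s (θ.kp B c', .K) = some v → θ.cut s (θ.kp B c', .K) = some v := by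
    intro c' v h0 h1 h2
    simp only [cut]
    rw [if_neg, h2]
    rintro (h | ⟨_, h⟩)
    · rw [h2] at h; cases h
    · simp only [θ.blk_kp B h0 h1] at h
      exact hB h
  have : θ.win (θ.cut s) B = some c := by
    rw [win_iff]
    exact ⟨hd.1, hd.2.1, fun c' h0 h1 => key _ _ h0 (by have := hd.2.1; omega) (hd.2.2.1 c' h0 h1), key _ _ hd.1 hd.2.1 hd.2.2.2⟩
  simp [this]

theorem noK_cut (s : OSt) : θ.NoK (θ.cut s) := by
  intro p h
  rw [win_cut] at h
  simp only [cut]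
  rw [if_pos]
  exact Or.inr ⟨rfl, h⟩

theorem noK_seed (hrg : ∀ B c, ω0 B = some c → 0 ≤ c ∧ c < θ.m) : θ.NoK (θ.seed0 ω0) := by
  intro p h
  rw [θ.win_seed0 hrg] at h
  by_contra hc
  exact θ.seed0_dom hc h

end Par
end IU

namespace IU

/-! ## Tile level versus candidate level -/

theorem GS.exists_rank {X V : Type} [Countable X] [Nonempty X] {G : GS X V} {s s' : St X V} (h : G.Reach s s') :
    ∃ rk : X → ℕ, ∀ x v, s' x = some v → s x = none → ∃ H, G.rule x v H ∧
      ∀ k ∈ H, s' k.1 = some k.2 ∧ rk k.1 < rk x := by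
  obtain ⟨f, h0, hstep, hun, hle⟩ := GS.exists_seq (G := G) h
  have hfs : ∀ n x v, f n x = some v → s' x = some v := by
    intro n x v hv
    rw [← hun, seqUnion_spec hle]
    exact ⟨n, hv⟩
  refine ⟨fun x => sInf {n | f n x ≠ none}, fun x v hv hx => ?_⟩
  have hex : ∃ n, f n x ≠ none := by
    by_contra hc
    push Not at hc
    rw [← hun, seqUnion_spec hle] at hv
    obtain ⟨n, hn⟩ := hv
    rw [hc n] at hn
    cases hn
  have hmem : f (sInf {n | f n x ≠ none}) x ≠ none := Nat.sInf_mem hex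
  set N := sInf {n | f n x ≠ none} with hN
  have hNpos : N ≠ 0 := by
    intro h1
    rw [h1, h0] at hmem
    exact hmem hx
  obtain ⟨M, hM⟩ := Nat.exists_eq_succ_of_ne_zero hNpos
  have hMn : f M x = none := by
    by_contra hc
    have : N ≤ M := Nat.sInf_le hc
    omega
  rw [hM] at hmem
  rcases hstep M with he | ⟨y, w, hy, ⟨H, hr, hH⟩, he⟩
  · rw [Nat.succ_eq_add_one, ← he] at hmem
    exact absurd hMn hmem
  · rw [Nat.succ_eq_add_one, he] at hmem
    by_cases hxy : x = y
    · subst hxy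
      have h1 : f (M+1) x = some w := by rw [he]; simp
      have h2 := hfs _ _ _ h1
      rw [hv] at h2
      cases h2
      refine ⟨H, hr, fun k hk => ⟨hfs _ _ _ (hH k hk), ?_⟩⟩
      have : sInf {n | f n k.1 ≠ none} ≤ M := Nat.sInf_le (by simp [hH k hk])
      show sInf {n | f n k.1 ≠ none} < N
      omega
    · rw [Function.update_of_ne hxy] at hmem
      exact absurd hMn hmem

section LayerC

variable (Ts : Finset (TileType 3)) (τ : ℕ)

abbrev Cand := {t // t ∈ Ts} × (Dir → Bool)

def cm : ℕ := Fintype.card (Cand Ts)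

theorem cm_eq : cm Ts = Ts.card * 64 := by
  unfold cm Cand
  rw [Fintype.card_prod]
  simp [Dir]

def enc (a : Cand Ts) : ℤ := ((Fintype.equivFin (Cand Ts) a).val : ℤ)

def decd (c : ℤ) : Option (Cand Ts) :=
  if h : 0 ≤ c ∧ c < cm Ts then some ((Fintype.equivFin (Cand Ts)).symm ⟨c.toNat, by
    have : c.toNat < cm Ts := by omega
    exact this⟩) else none

theorem enc_range (a : Cand Ts) : 0 ≤ enc Ts a ∧ enc Ts a < cm Ts := by
  have := (Fintype.equivFin (Cand Ts) a).isLt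
  unfold enc cm
  omega

theorem decd_enc (a : Cand Ts) : decd Ts (enc Ts a) = some a := by
  unfold decd
  rw [dif_pos (enc_range Ts a)]
  simp [enc]

theorem decd_range {c : ℤ} {a} (h : decd Ts c = some a) : 0 ≤ c ∧ c < cm Ts := by
  unfold decd at h
  split_ifs at h with h1
  exact h1

variable (hτ : 0 < τ) (hne : Ts.Nonempty)

def tyc (c : ℤ) : TileType 3 :=
  match decd Ts c with
  | some a => a.1.1
  | none => hne.choose

theorem tyc_mem (c : ℤ) : tyc Ts hne c ∈ Ts := by
  unfold tyc
  split
  · rename_i a _; exact a.1.2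
  · exact hne.choose_spec

def csf (c : ℤ) : Option (Dir → Bool) :=
  match decd Ts c with
  | some a => if τ ≤ ∑ d, (if a.2 d = true then (face a.1.1 d).2 else 0) then some a.2 else none
  | none => none

theorem csf_some {c S} (h : csf Ts τ c = some S) : 0 ≤ c ∧ c < cm Ts ∧
    τ ≤ ∑ d, (if S d = true then (face (tyc Ts hne c) d).2 else 0) := by
  unfold csf at h
  unfold tyc
  cases hd : decd Ts c with
  | none => simp [hd] at h
  | some a =>
    simp only [hd] at h
    split_ifs at h with h1
    cases h
    obtain ⟨r0, r1⟩ := decd_range Ts hd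
    exact ⟨r0, r1, h1⟩

def par : Par where
  m := cm Ts
  hm := by
    rw [cm_eq]
    have := hne.card_pos
    omega
  cs := csf Ts τ
  mb u v δ := decide (face (tyc Ts hne v) δ = face (tyc Ts hne u) (opp δ))
  cs_range c S h := by
    obtain ⟨a, b, _⟩ := csf_some Ts τ hne h
    exact ⟨a, b⟩
  cs_ne c S h := by
    obtain ⟨_, _, h1⟩ := csf_some Ts τ hne h
    by_contra hc
    push Not at hc
    simp [hc] at h1
    omega

def ty (ω : St (Pt 3) ℤ) : Config 3 := fun p => (ω p).map (tyc Ts hne)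

theorem ty_some {ω : St (Pt 3) ℤ} {p c} (h : ω p = some c) : ty Ts hne ω p = some (tyc Ts hne c) := by
  simp [ty, h]

theorem ty_none {ω : St (Pt 3) ℤ} {p} : ty Ts hne ω p = none ↔ ω p = none := by
  simp [ty]

theorem ty_mono {ω ω' : St (Pt 3) ℤ} (h : Le ω ω') : Le (ty Ts hne ω) (ty Ts hne ω') := by
  intro p t hp
  cases hc : ω p with
  | none => simp [ty, hc] at hp
  | some c =>
    rw [ty_some Ts hne hc] at hp
    rw [ty_some Ts hne (h _ _ hc), hp]

theorem c_rule {B c H} (h : (par Ts τ hτ hne).cgs.rule B c H) :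
    (tgs Ts τ).rule B (tyc Ts hne c) (H.image (fun k => (k.1, tyc Ts hne k.2))) := by
  obtain ⟨S, g, hS, hm, rfl⟩ := h
  refine ⟨tyc_mem Ts hne c, ?_⟩
  obtain ⟨_, _, h1⟩ := csf_some Ts τ hne hS
  rw [Finset.image_image, Finset.sum_image]
  · refine h1.trans (le_of_eq ?_)
    rw [Finset.sum_filter]
    apply Finset.sum_congr rfl
    intro d _
    by_cases hd : S d = true
    · simp only [hd, if_true, Function.comp]
      rw [bond_dir, if_pos]
      have := hm d hd
      simp only [par, decide_eq_true_eq, opp_opp] at this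
      exact this.symm
    · simp [hd]
  · intro a _ b _ hab
    simp only [Function.comp, Prod.mk.injEq, add_right_inj] at hab
    exact dv_inj hab.1

theorem c_reach {ω ω' : St (Pt 3) ℤ} (h : (par Ts τ hτ hne).cgs.Reach ω ω') :
    (tgs Ts τ).Reach (ty Ts hne ω) (ty Ts hne ω') := by
  refine ⟨ty_mono Ts hne h.1, fun x hx => ?_⟩
  have hs := h.2 x (fun hc => hx ((ty_none Ts hne).2 hc))
  clear hx
  induction hs with
  | base h1 => exact .base (fun hc => h1 ((ty_none Ts hne).1 hc))
  | step hv hr hH _ ih =>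
    refine .step (ty_some Ts hne hv) (c_rule Ts τ hτ hne hr) ?_ ?_
    · intro k hk
      obtain ⟨k', hk', rfl⟩ := Finset.mem_image.1 hk
      exact ty_some Ts hne (hH _ hk')
    · intro k hk
      obtain ⟨k', hk', rfl⟩ := Finset.mem_image.1 hk
      exact ih _ hk'

def selS (x : Pt 3) (t : TileType 3) (H : Finset (Pt 3 × TileType 3)) (d : Dir) : Bool :=
  decide (∃ k ∈ H, k.1 = x + dv d ∧ face t d = face k.2 (opp d))

def cand (x : Pt 3) (t : TileType 3) (H : Finset (Pt 3 × TileType 3)) : ℤ :=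
  if h : t ∈ Ts then enc Ts (⟨t, h⟩, selS x t H) else 0

theorem decd_cand {x t H} (h : t ∈ Ts) : decd Ts (cand Ts x t H) = some (⟨t, h⟩, selS x t H) := by
  unfold cand
  rw [dif_pos h, decd_enc]

theorem tyc_cand {x t H} (h : t ∈ Ts) : tyc Ts hne (cand Ts x t H) = t := by
  unfold tyc
  rw [decd_cand Ts h]

theorem sum_sel {x : Pt 3} {t : TileType 3} {H : Finset (Pt 3 × TileType 3)}
    (hf : ∀ k ∈ H, ∀ k' ∈ H, k.1 = k'.1 → k = k') :
    ∑ k ∈ H, bond t k.2 x k.1 ≤ ∑ d, (if selS x t H d = true then (face t d).2 else 0) := by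
  simp only [bond_eq_sum]
  rw [Finset.sum_comm]
  apply Finset.sum_le_sum
  intro d _
  by_cases hex : ∃ k ∈ H, k.1 = x + dv d ∧ face t d = face k.2 (opp d)
  · rw [if_pos (by simpa [selS] using hex)]
    obtain ⟨k, hk, h1, h2⟩ := hex
    rw [Finset.sum_eq_single k]
    · split_ifs <;> simp
    · intro k' hk' hn
      rw [if_neg]
      rintro ⟨h3, _⟩
      exact hn (hf _ hk' _ hk (h3.trans h1.symm))
    · intro hc; exact absurd hk hc
  · rw [Finset.sum_eq_zero]
    · simp
    · intro k hk
      rw [if_neg]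
      rintro ⟨h1, h2, _⟩
      exact hex ⟨k, hk, h1, h2⟩

theorem pick {ω : St (Pt 3) ℤ} {x t H} (hr : (tgs Ts τ).rule x t H)
    (hH : ∀ k ∈ H, ty Ts hne ω k.1 = some k.2) :
    ∃ K, (par Ts τ hτ hne).cgs.rule x (cand Ts x t H) K ∧
      ∀ k ∈ K, ω k.1 = some k.2 ∧ ∃ h ∈ H, h.1 = k.1 := by
  obtain ⟨ht, hsum⟩ := hr
  have hf : ∀ k ∈ H, ∀ k' ∈ H, k.1 = k'.1 → k = k' := by
    intro k hk k' hk' he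
    have h1 := hH k hk
    rw [he, hH k' hk'] at h1
    exact Prod.ext he (Option.some.inj h1).symm
  have hS : csf Ts τ (cand Ts x t H) = some (selS x t H) := by
    unfold csf
    rw [decd_cand Ts ht]
    simp only
    rw [if_pos (hsum.trans (sum_sel hf))]
  have hg : ∀ d, selS x t H d = true → ∃ c, ω (x + dv d) = some c ∧ face t d = face (tyc Ts hne c) (opp d) ∧
      ∃ h ∈ H, h.1 = x + dv d := by
    intro d hd
    simp only [selS, decide_eq_true_eq] at hd
    obtain ⟨k, hk, h1, h2⟩ := hd
    have h3 := hH k hk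
    rw [h1] at h3
    cases hc : ω (x + dv d) with
    | none => simp [ty, hc] at h3
    | some c =>
      rw [ty_some Ts hne hc] at h3
      rw [← Option.some.inj h3] at h2
      exact ⟨c, rfl, h2, k, hk, h1⟩
  have hget : ∀ d, selS x t H d = true → ω (x + dv d) = some ((ω (x + dv d)).getD 0) := by
    intro d hd
    obtain ⟨c, hc, _⟩ := hg d hd
    simp [hc]
  refine ⟨_, ⟨selS x t H, fun d => (ω (x + dv d)).getD 0, hS, ?_, rfl⟩, ?_⟩
  · intro d hd
    obtain ⟨c, hc, h2, _⟩ := hg d hd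
    simp only [par, decide_eq_true_eq, opp_opp, hc, Option.getD_some, tyc_cand Ts hne ht]
    exact h2.symm
  · intro k hk
    obtain ⟨d, hd, rfl⟩ := Finset.mem_image.1 hk
    have hd' := (Finset.mem_filter.1 hd).2
    obtain ⟨c, hc, h2, h3⟩ := hg d hd'
    exact ⟨hget d hd', h3⟩

theorem c_term {ω : St (Pt 3) ℤ} (h : (par Ts τ hτ hne).cgs.Term ω) : (tgs Ts τ).Term (ty Ts hne ω) := by
  rintro x t hx ⟨H, hr, hH⟩
  obtain ⟨K, hK, h1⟩ := pick Ts τ hτ hne hr hH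
  exact h x _ ((ty_none Ts hne).1 hx) ⟨K, hK, fun k hk => (h1 k hk).1⟩

theorem c_lift {ω : St (Pt 3) ℤ} {β : Config 3} (h : (tgs Ts τ).Reach (ty Ts hne ω) β) :
    ∃ ω', (par Ts τ hτ hne).cgs.Reach ω ω' ∧ ty Ts hne ω' = β := by
  obtain ⟨rk, hrk⟩ := GS.exists_rank h
  have hex : ∀ x, ∃ H, ∀ t, β x = some t → ω x = none → (tgs Ts τ).rule x t H ∧
      ∀ k ∈ H, β k.1 = some k.2 ∧ rk k.1 < rk x := by
    intro x
    cases hb : β x with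
    | none => exact ⟨∅, fun t ht => by cases ht⟩
    | some t =>
      by_cases hx : ω x = none
      · obtain ⟨H, h1, h2⟩ := hrk x t hb ((ty_none Ts hne).2 hx)
        refine ⟨H, fun t' ht' _ => ?_⟩
        cases ht'
        exact ⟨h1, h2⟩
      · exact ⟨∅, fun t _ hc => absurd hc hx⟩
  choose Hx hHx using hex
  set ω' : St (Pt 3) ℤ := fun x => if ω x ≠ none then ω x else (β x).map (fun t => cand Ts x t (Hx x)) with hω'
  have hle : Le ω ω' := by
    intro x c hc
    simp only [hω']
    rw [if_pos (by simp [hc]), hc]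
  have hnew : ∀ x t, β x = some t → ω x = none → ω' x = some (cand Ts x t (Hx x)) := by
    intro x t hb hx
    simp [hω', hx, hb]
  have hty : ty Ts hne ω' = β := by
    funext x
    cases hx : ω x with
    | some c =>
      rw [ty_some Ts hne (hle _ _ hx)]
      exact (h.1 _ _ (ty_some Ts hne hx)).symm
    | none =>
      cases hb : β x with
      | none => rw [ty_none]; simp [hω', hx, hb]
      | some t =>
        rw [ty_some Ts hne (hnew x t hb hx), tyc_cand Ts hne (hHx x t hb hx).1.1]
  refine ⟨ω', ⟨hle, ?_⟩, hty⟩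
  have hind : ∀ n x, rk x = n → ω' x ≠ none → (par Ts τ hτ hne).cgs.Supp ω ω' x := by
    intro n
    induction n using Nat.strong_induction_on with
    | _ n ih =>
      intro x hn hx
      by_cases h0 : ω x = none
      · have hb : β x ≠ none := by
          rw [← hty]
          exact fun hc => hx ((ty_none Ts hne).1 hc)
        obtain ⟨t, ht⟩ := Option.ne_none_iff_exists'.1 hb
        obtain ⟨h1, h2⟩ := hHx x t ht h0
        obtain ⟨K, hK, h3⟩ := pick Ts τ hτ hne (ω := ω') h1 (fun k hk => by rw [hty]; exact (h2 k hk).1)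
        refine .step (hnew x t ht h0) hK (fun k hk => (h3 k hk).1) (fun k hk => ?_)
        obtain ⟨h4, k', hk', he⟩ := h3 k hk
        refine ih (rk k.1) ?_ _ rfl (by simp [h4])
        rw [← he, ← hn]
        exact (h2 k' hk').2
      · exact .base h0
  exact fun x hx => hind _ x rfl hx

/-- seed on the candidate level -/
def om0 (σ : Config 3) : St (Pt 3) ℤ := fun x => (σ x).map (fun t => cand Ts x t ∅)

theorem ty_om0 {σ : Config 3} (h : ∀ p t, σ p = some t → t ∈ Ts) : ty Ts hne (om0 Ts σ) = σ := by
  funext x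
  cases hx : σ x with
  | none => simp [ty, om0, hx]
  | some t => simp [ty, om0, hx, tyc_cand Ts hne (h x t hx)]

theorem om0_range {σ : Config 3} (h : ∀ p t, σ p = some t → t ∈ Ts) (B c) (hc : om0 Ts σ B = some c) :
    0 ≤ c ∧ c < (par Ts τ hτ hne).m := by
  cases hx : σ B with
  | none => simp [om0, hx] at hc
  | some t =>
    simp only [om0, hx, Option.map_some, Option.some.injEq] at hc
    subst hc
    exact decd_range Ts (decd_cand Ts (h B t hx))

end LayerC
end IU

namespace IU
namespace Par
variable (θ : Par)

/-! ## The seed region -/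

def reg (σ : Config 3) : Set (Pt 3) := {p | σ (θ.blk p) ≠ none}

def conn (D : Set (Pt 3)) : Pt 3 → Pt 3 → Prop :=
  Relation.ReflTransGen (fun a b => adj a b ∧ a ∈ D ∧ b ∈ D)

theorem conn_symm {D : Set (Pt 3)} {p q : Pt 3} (h : conn D p q) : conn D q p := by
  induction h with
  | refl => exact .refl
  | tail _ h ih => exact Relation.ReflTransGen.head ⟨LRS.adj_symm h.1, h.2.2, h.2.1⟩ ih

theorem conn_in {σ : Config 3} {t : Pt 3} (ht : θ.box t) : ∀ (n : ℕ) (p : Pt 3), p ∈ θ.reg σ →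
    ∑ i, (θ.lc p i - t i).natAbs = n → conn (θ.reg σ) p (θ.pt (θ.blk p) t) := by
  intro n
  induction n using Nat.strong_induction_on with
  | _ n ih =>
    intro p hp hn
    by_cases he : θ.lc p = t
    · rw [← he, pt_blk_lc]; exact .refl
    · obtain ⟨j, hj⟩ : ∃ j, θ.lc p j ≠ t j := by
        by_contra hc
        push Not at hc
        exact he (funext hc)
      obtain ⟨ε, -, q, hq, hb, -, h1, h2⟩ := θ.toward p j (t j) (ht j).1 (ht j).2 hj
      have hqr : q ∈ θ.reg σ := by
        show σ (θ.blk q) ≠ none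
        rw [hb]; exact hp
      have := ih _ (by rw [← hn]; exact dist_lt h1 h2) q hqr rfl
      rw [hb] at this
      refine Relation.ReflTransGen.head ⟨?_, hp, hqr⟩ this
      rw [← hq]
      exact LRS.adj_symm (adj_dv q ε)

theorem box_zero : θ.box 0 := fun _ => ⟨le_refl _, θ.mpos⟩

theorem mem_reg_pt {σ : Config 3} {B t : Pt 3} (ht : θ.box t) : θ.pt B t ∈ θ.reg σ ↔ σ B ≠ none := by
  show σ (θ.blk _) ≠ none ↔ _
  rw [θ.blk_pt ht]

theorem conn_cross {σ : Config 3} {B : Pt 3} (i : Fin 3) (h1 : σ B ≠ none) (h2 : σ (B + dv (i, true)) ≠ none) :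
    conn (θ.reg σ) (θ.pt B 0) (θ.pt (B + dv (i, true)) 0) := by
  have hm := θ.mpos
  have hbox : θ.box (fun j => if j = i then θ.m - 1 else 0) := by
    intro j
    beta_reduce
    split_ifs
    · constructor <;> omega
    · exact ⟨le_refl _, hm⟩
  have e : θ.pt B (fun j => if j = i then θ.m - 1 else 0) + dv (i, true) = θ.pt (B + dv (i, true)) 0 := by
    funext j
    by_cases hj : j = i
    · simp [pt, dv, sg, hj]; ring
    · simp [pt, dv, sg, hj]
  have h3 := (θ.mem_reg_pt θ.box_zero).2 h1
  have h4 := θ.conn_in hbox _ _ h3 rfl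
  rw [θ.blk_pt θ.box_zero] at h4
  refine h4.tail ⟨?_, (θ.mem_reg_pt hbox).2 h1, (θ.mem_reg_pt θ.box_zero).2 h2⟩
  rw [← e]
  exact adj_dv _ _

theorem reg_conn {σ : Config 3} (h : ConnectedSet (dom σ)) : ConnectedSet (θ.reg σ) := by
  have key : ∀ B B', Relation.ReflTransGen (fun a b => adj a b ∧ a ∈ dom σ ∧ b ∈ dom σ) B B' →
      conn (θ.reg σ) (θ.pt B 0) (θ.pt B' 0) := by
    intro B B' hB
    induction hB with
    | refl => exact .refl
    | @tail b c _ h1 ih =>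
      refine ih.trans ?_
      obtain ⟨⟨i, bb⟩, rfl⟩ := exists_dv_of_adj h1.1
      cases bb with
      | true => exact θ.conn_cross i h1.2.1 h1.2.2
      | false =>
        apply conn_symm
        have e : b + dv (i, false) + dv (i, true) = b := by
          have : dv (i, false) = - dv (i, true) := dv_opp (i, true)
          rw [this]; abel
        have := θ.conn_cross (σ := σ) (B := b + dv (i, false)) i h1.2.2 (by rw [e]; exact h1.2.1)
        rwa [e] at this
  intro p hp q hq
  have h1 := θ.conn_in θ.box_zero _ p hp rfl
  have h2 := θ.conn_in θ.box_zero _ q hq rfl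
  exact (h1.trans (key _ _ (h _ hp _ hq))).trans (conn_symm h2)

theorem reg_finite {σ : Config 3} (h : (dom σ).Finite) : (θ.reg σ).Finite := by
  have hb : {y : Pt 3 | θ.box y}.Finite := by
    apply (Set.finite_Icc (0 : Pt 3) (fun _ => (θ.m : ℤ))).subset
    intro y hy
    exact ⟨fun i => (hy i).1, fun i => (hy i).2.le⟩
  refine ((h.prod hb).image (fun x => θ.pt x.1 x.2)).subset ?_
  intro p hp
  exact ⟨(θ.blk p, θ.lc p), ⟨hp, θ.box_lc p⟩, θ.pt_blk_lc p⟩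

theorem reg_nonempty {σ : Config 3} (h : (dom σ).Nonempty) : (θ.reg σ).Nonempty := by
  obtain ⟨B, hB⟩ := h
  exact ⟨_, (θ.mem_reg_pt θ.box_zero).2 hB⟩

/-! ## Representation function -/

abbrev UNSt := LRS.NSt Fd Ru QV

def repw (γ : Config 3) : St (Pt 3) ℤ := θ.win (LRS.offS (SU.absn γ))

theorem absn_block (α : Config 3) (B : Pt 3) {c : ℤ} (h0 : 0 ≤ c) (h1 : c < θ.m) :
    SU.absn (mblock (4000 * θ.m) α B) (θ.kp 0 c, .off .K) = SU.absn α (θ.kp B c, .off .K) := by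
  have hpx : SU.pX .K + 1 < 4000 := by decide
  have hin : ∀ i, 0 ≤ SU.loc (θ.kp 0 c, .off .K) i ∧ SU.loc (θ.kp 0 c, .off .K) i < ((4000 * θ.m : ℕ) : ℤ) := by
    intro i
    have hm := θ.mpos
    push_cast
    fin_cases i <;> simp [LRS.loc, LRS.abs, kp, pt, mk3] <;> omega
  have hloc : (fun i => ((4000 * θ.m : ℕ) : ℤ) * B i + SU.loc (θ.kp 0 c, .off .K) i) = SU.loc (θ.kp B c, .off .K) := by
    funext i
    simp only [LRS.loc, kp, pt, Pi.add_apply, Pi.smul_apply, smul_eq_mul, Pi.zero_apply]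
    push_cast
    ring
  have e : mblock (4000 * θ.m) α B (SU.loc (θ.kp 0 c, .off .K)) = α (SU.loc (θ.kp B c, .off .K)) := by
    unfold mblock
    rw [if_pos hin, hloc]
  apply Option.ext
  intro v
  rw [SU.absn_iff, SU.absn_iff, e]

theorem repw_block (α : Config 3) (B : Pt 3) : θ.repw (mblock (4000 * θ.m) α B) 0 = θ.repw α B := by
  apply Option.ext
  intro c
  unfold repw
  rw [win_iff, win_iff]
  have hh : ∀ c', 0 ≤ c' → c' < (θ.m : ℤ) →
      LRS.offS (SU.absn (mblock (4000 * θ.m) α B)) (θ.kp 0 c', .K) = LRS.offS (SU.absn α) (θ.kp B c', .K) := by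
    intro c' h0 h1
    simp only [LRS.offS, θ.absn_block α B h0 h1]
  constructor
  · rintro ⟨h0, h1, h2, h3⟩
    refine ⟨h0, h1, fun c' a b => ?_, ?_⟩
    · rw [← hh c' a (b.trans h1)]; exact h2 c' a b
    · rw [← hh c h0 h1]; exact h3
  · rintro ⟨h0, h1, h2, h3⟩
    refine ⟨h0, h1, fun c' a b => ?_, ?_⟩
    · rw [hh c' a (b.trans h1)]; exact h2 c' a b
    · rw [hh c h0 h1]; exact h3

theorem repw_mono {γ γ' : Config 3} (h : Le γ γ') : Le (θ.repw γ) (θ.repw γ') :=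
  θ.win_mono (LRS.offS_mono (SU.absn_mono h))

theorem repw_realize {ν : UNSt} (h : SU.WF ν) : θ.repw (SU.realize ν) = θ.win (LRS.offS ν) := by
  unfold repw
  rw [SU.absn_realize h]

end Par
end IU

namespace IU

/-! ## The simulation -/

section Main
variable (T : TAS 3) (hne : T.tileset.Nonempty)

abbrev θT : Par := par T.tileset T.temp T.temp_pos hne

abbrev w0 : St (Pt 3) ℤ := om0 T.tileset T.seed

abbrev s0T : Par.OSt := (θT T hne).seed0 (w0 T)

abbrev DT : Set (Pt 3) := (θT T hne).reg T.seed

theorem w0_ne {B : Pt 3} : w0 T B ≠ none ↔ T.seed B ≠ none := by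
  simp [om0]

theorem w0_range (B : Pt 3) (c : ℤ) (h : w0 T B = some c) : 0 ≤ c ∧ c < (θT T hne).m :=
  om0_range T.tileset T.temp T.temp_pos hne T.seed_tiles B c h

def UST : TAS 3 := SU.simTAS (DT T hne) (s0T T hne)
  (fun _ _ h => (w0_ne T).1 ((θT T hne).seed0_dom h))
  ((θT T hne).reg_conn T.seed_connected) ((θT T hne).reg_nonempty T.seed_nonempty)
  ((θT T hne).reg_finite T.seed_finite)

abbrev n0 : Par.UNSt := SU.seedN (DT T hne) (s0T T hne)

def RT : RepFn 3 := fun γ => ((θT T hne).repw γ 0).map (tyc T.tileset hne)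

abbrev scl : ℕ := 4000 * (θT T hne).m

theorem rep_eq (α : Config 3) : repStar (RT T hne) (scl T hne) α = ty T.tileset hne ((θT T hne).repw α) := by
  funext B
  simp only [repStar, RT, ty, (θT T hne).repw_block α B]

theorem valid_RT : ValidRep T.tileset (RT T hne) := by
  constructor
  · intro γ γ' h t ht
    simp only [RT, Option.map_eq_some_iff] at ht ⊢
    obtain ⟨c, h1, h2⟩ := ht
    exact ⟨c, (θT T hne).repw_mono h _ _ h1, h2⟩
  · intro γ t ht
    simp only [RT, Option.map_eq_some_iff] at ht
    obtain ⟨c, h1, rfl⟩ := ht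
    exact tyc_mem T.tileset hne c

/-- simulator states reachable from the seed -/
abbrev RN (ν : Par.UNSt) : Prop := SU.ngs.Reach (n0 T hne) ν

abbrev wn (ν : Par.UNSt) : Config 3 := ty T.tileset hne ((θT T hne).win (LRS.offS ν))

variable {T hne}

theorem RN.cl {ν : Par.UNSt} (h : RN T hne ν) : SU.Cl ν := SU.cl_of_reach (SU.seedLike _ _) h

theorem RN.rep {ν : Par.UNSt} (h : RN T hne ν) :
    repStar (RT T hne) (scl T hne) (SU.realize ν) = wn T hne ν := by
  rw [rep_eq, (θT T hne).repw_realize h.cl.1]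

theorem RN.off {ν : Par.UNSt} (h : RN T hne ν) : SU.gs.Reach (s0T T hne) (LRS.offS ν) := by
  have := SU.off_reach (RN.cl (T := T) (hne := hne) (GS.Reach.refl _)) h
  rwa [SU.offS_seed] at this

theorem RN.safe {ν : Par.UNSt} (h : RN T hne ν) : (θT T hne).Safe (LRS.offS ν) :=
  Par.Safe.reach _ ((θT T hne).seed0_safe (w0_range T hne)) h.off

theorem RN.wn_reach {ν ν' : Par.UNSt} (h : RN T hne ν) (h' : SU.ngs.Reach ν ν') :
    (tgs T.tileset T.temp).Reach (wn T hne ν) (wn T hne ν') :=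
  c_reach _ _ T.temp_pos hne ((θT T hne).win_reach h.safe (SU.off_reach h.cl h'))

theorem wn_seed : wn T hne (n0 T hne) = T.seed := by
  unfold wn n0
  rw [SU.offS_seed, (θT T hne).win_seed0 (w0_range T hne)]
  exact ty_om0 _ _ T.seed_tiles

theorem RN.seed_le {ν : Par.UNSt} (h : RN T hne ν) : (tgs T.tileset T.temp).Reach T.seed (wn T hne ν) := by
  have := RN.wn_reach (T := T) (hne := hne) (GS.Reach.refl _) h
  rwa [wn_seed] at this

theorem prod_T {α : Config 3} : ProducesFrom (Attach T) T.seed α ↔ (tgs T.tileset T.temp).Reach T.seed α :=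
  produces_iff T T.seed_nonempty T.seed_stable

theorem prod_T' {α β : Config 3} (h : (tgs T.tileset T.temp).Reach T.seed α) :
    ProducesFrom (Attach T) α β ↔ (tgs T.tileset T.temp).Reach α β :=
  produces_iff T (dom_nonempty_mono h.1 T.seed_nonempty) (reach_stable T T.seed_nonempty T.seed_stable h)

theorem term_T {α : Config 3} (h : (tgs T.tileset T.temp).Reach T.seed α) :
    Terminal (Attach T) α ↔ (tgs T.tileset T.temp).Term α :=
  term_iff T (dom_nonempty_mono h.1 T.seed_nonempty) (reach_stable T T.seed_nonempty T.seed_stable h)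

theorem prod_U {α : Config 3} : ProducesFrom (Attach (UST T hne)) (UST T hne).seed α ↔
    ∃ ν, RN T hne ν ∧ SU.realize ν = α := by
  rw [prod_T]
  constructor
  · intro h
    exact SU.u2 (SU.seedN_ok _ _) h
  · rintro ⟨ν, h, rfl⟩
    exact SU.u1 (LRS.SeedOk.wf SU (SU.seedN_ok _ _)) h

theorem RN.tg {ν : Par.UNSt} (h : RN T hne ν) :
    (tgs (UST T hne).tileset (UST T hne).temp).Reach (UST T hne).seed (SU.realize ν) :=
  prod_T.1 (prod_U.2 ⟨ν, h, rfl⟩)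

theorem RN.prod {ν : Par.UNSt} (h : RN T hne ν) {β : Config 3} :
    ProducesFrom (Attach (UST T hne)) (SU.realize ν) β ↔ ∃ ν', SU.ngs.Reach ν ν' ∧ SU.realize ν' = β := by
  rw [prod_T' h.tg]
  constructor
  · intro h1
    obtain ⟨ν', h2, rfl⟩ := prod_U.1 (prod_T.2 (h.tg.trans h1))
    exact ⟨ν', h2.mid h.1 (SU.realize_le h.cl.1 (RN.cl h2).1 h1.1), rfl⟩
  · rintro ⟨ν', h1, rfl⟩
    exact SU.u1 h.cl.1 h1

theorem RN.grow {ν : Par.UNSt} (h : RN T hne ν) (hg : SU.Good ν) (hk : (θT T hne).NoK (LRS.offS ν))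
    {β : Config 3} (hb : (tgs T.tileset T.temp).Reach (wn T hne ν) β) :
    ∃ ν', SU.ngs.Reach ν ν' ∧ wn T hne ν' = β := by
  obtain ⟨ω', h1, h2⟩ := c_lift _ _ T.temp_pos hne hb
  obtain ⟨s', h3, h4⟩ := (θT T hne).follow_win (w0_range T hne) h.off hk h1
  obtain ⟨h5, h6⟩ := SU.ext_reach h.cl hg h3
  refine ⟨_, h5, ?_⟩
  unfold wn
  rw [h6, h4, h2]

theorem good_seed : SU.Good (n0 T hne) := by
  intro n x h1 h2
  rw [SU.offS_seed] at h2
  by_contra hc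
  obtain ⟨v, hv⟩ := Option.ne_none_iff_exists'.1 hc
  exact SU.seed_owner hv x h1 h2

theorem grow_seed {β : Config 3} (hb : (tgs T.tileset T.temp).Reach T.seed β) :
    ∃ ν', RN T hne ν' ∧ wn T hne ν' = β := by
  refine RN.grow (GS.Reach.refl _) good_seed ?_ (by rw [wn_seed]; exact hb)
  rw [SU.offS_seed]
  exact (θT T hne).noK_seed (w0_range T hne)

theorem RN.trim {ν : Par.UNSt} (h : RN T hne ν) : ∃ ν', RN T hne ν' ∧ SU.ngs.Reach ν' ν ∧ SU.Good ν' ∧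
    (θT T hne).NoK (LRS.offS ν') ∧ wn T hne ν' = wn T hne ν := by
  have hoff : LRS.offS (SU.trim ((θT T hne).Zs (LRS.offS ν)) ν) = (θT T hne).cut (LRS.offS ν) := by
    funext x
    rw [SU.offS_trim]
    rfl
  have hr : RN T hne (SU.trim ((θT T hne).Zs (LRS.offS ν)) ν) := by
    refine SU.trim_reach h h.cl ?_ ((θT T hne).Zs_closed h.safe)
    intro n v hv x hx
    have h1 := SU.seed_owner hv x hx
    rintro (h2 | ⟨_, h2⟩)
    · exact h.off.1.ne h1 h2
    · have h3 := (θT T hne).win_mono h.off.1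
      rw [(θT T hne).win_seed0 (w0_range T hne)] at h3
      exact h3.ne ((θT T hne).seed0_dom h1) h2
  refine ⟨_, hr, h.mid hr.1 (SU.trim_le _ _), SU.trim_good (fun x hx => Or.inl hx), ?_, ?_⟩
  · rw [hoff]
    exact (θT T hne).noK_cut _
  · unfold wn
    rw [hoff, (θT T hne).win_cut]

theorem RN.rod {ν : Par.UNSt} (h : RN T hne ν) {p u v w val} (hv : ν (p, .rod u v w) = some val) :
    T.seed ((θT T hne).blk p) ≠ none := by
  have hval := (h.cl.1 _ _ _ hv).2
  have hsd : isSd val := by cases val <;> simp [LRS.valid, isSd] at hval ⊢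
  have h1 : n0 T hne (p, .rod u v w) ≠ none := by
    rw [SU.sd_base h.1 (h.2 (p, .rod u v w) (by rw [hv]; simp)) hv hsd]
    simp
  have := (SU.seedN_ne _ _ _).1 h1
  exact this.1

theorem RN.clean {ν : Par.UNSt} (h : RN T hne ν) : MapsCleanly (RT T hne) (scl T hne) (SU.realize ν) := by
  left
  rintro x ⟨y, hy⟩
  rw [h.rep]
  have hn : Par.near ((θT T hne).win (LRS.offS ν)) x := by
    unfold mblock at hy
    split_ifs at hy with hbox
    · obtain ⟨t, ht⟩ := Option.ne_none_iff_exists'.1 hy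
      obtain ⟨p, nd, v, h1, h2, h3, -⟩ := SU.realize_inv ht
      have hx : (θT T hne).blk (fun i => SU.loc (p, nd) i / 4000) = x := by
        funext i
        have hb := hbox i
        have hm := (θT T hne).mpos
        simp only [Par.blk]
        rw [← h3, Int.ediv_ediv_of_nonneg (by norm_num)]
        have e : ((scl T hne : ℕ) : ℤ) = 4000 * ((θT T hne).m : ℤ) := by push_cast; rfl
        rw [e] at hb ⊢
        beta_reduce
        rw [Int.add_comm, Int.add_mul_ediv_left _ _ (by omega), Int.ediv_eq_zero_of_lt hb.1 hb.2, zero_add]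
      rcases SU.cube_claim h.cl h2 _ (fun i => rfl) with ⟨f, hf⟩ | ⟨hc, u, v', w, rfl⟩
      · have := Par.Safe.clean _ h.safe hf
        rwa [hx] at this
      · rw [← hx, hc]
        left
        have h3 := (θT T hne).win_mono h.off.1
        rw [(θT T hne).win_seed0 (w0_range T hne)] at h3
        exact h3.ne ((w0_ne T).2 (h.rod h2))
    · exact absurd rfl hy
  have hw : ∀ B, (θT T hne).win (LRS.offS ν) B ≠ none → wn T hne ν B ≠ none := by
    intro B hB hc
    exact hB ((ty_none _ _).1 hc)
  rcases hn with hn | ⟨δ, hn⟩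
  · exact Or.inl (hw _ hn)
  · exact Or.inr ⟨x + dv δ, adj_dv x δ, hw _ hn⟩

theorem sim : Simulates (UST T hne) T (RT T hne) (scl T hne) where
  prod_eq α := by
    rw [prod_T]
    constructor
    · intro h
      obtain ⟨ν, h1, h2⟩ := grow_seed (hne := hne) h
      exact ⟨_, prod_U.2 ⟨ν, h1, rfl⟩, h1.rep.trans h2⟩
    · rintro ⟨α', h1, rfl⟩
      obtain ⟨ν, h2, rfl⟩ := prod_U.1 h1
      rw [h2.rep]
      exact h2.seed_le
  term_eq α := by
    constructor
    · rintro ⟨h1, h2⟩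
      rw [prod_T] at h1
      rw [term_T h1] at h2
      obtain ⟨ν, h3, rfl⟩ := grow_seed (hne := hne) h1
      obtain ⟨β', h4, h5⟩ := (tgs (UST T hne).tileset (UST T hne).temp).exists_sat (SU.realize ν)
      have h6 := h3.tg.trans h4
      obtain ⟨ν', h7, rfl⟩ := h3.prod.1 ((prod_T' h3.tg).2 h4)
      refine ⟨_, ⟨prod_T.2 h6, (term_T h6).2 h5⟩, ?_⟩
      rw [RN.rep (h3.trans h7)]
      exact h2.eq_of_reach (h3.wn_reach h7)
    · rintro ⟨α', ⟨h1, h2⟩, rfl⟩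
      obtain ⟨ν, h3, rfl⟩ := prod_U.1 h1
      rw [h3.rep, prod_T, term_T h3.seed_le]
      rw [term_T h3.tg] at h2
      refine ⟨h3.seed_le, ?_⟩
      exact c_term _ _ T.temp_pos hne
        ((θT T hne).term_win (w0_range T hne) h3.off (SU.off_term h3.cl (SU.u4 h3.cl.1 h2)))
  clean α' h := by
    obtain ⟨ν, h1, rfl⟩ := prod_U.1 h
    exact h1.clean
  follows α' β' h _ h2 := by
    obtain ⟨ν, h1, rfl⟩ := prod_U.1 h
    obtain ⟨ν', h3, rfl⟩ := h1.prod.1 h2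
    rw [h1.rep, RN.rep (h1.trans h3), prod_T' h1.seed_le]
    exact h1.wn_reach h3
  models α hα := by
    rw [prod_T] at hα
    refine ⟨{α' | ∃ ν, RN T hne ν ∧ SU.Good ν ∧ (θT T hne).NoK (LRS.offS ν) ∧ wn T hne ν = α ∧ SU.realize ν = α'}, ?_, ?_⟩
    · rintro _ ⟨ν, h1, h2, h3, h4, rfl⟩
      exact ⟨prod_U.2 ⟨ν, h1, rfl⟩, h1.rep.trans h4⟩
    · intro β hβ hαβ
      rw [prod_T' hα] at hαβ
      constructor
      · rintro _ ⟨ν, h1, h2, h3, rfl, rfl⟩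
        obtain ⟨ν', h5, h6⟩ := h1.grow h2 h3 hαβ
        exact ⟨_, h1.prod.2 ⟨ν', h5, rfl⟩, (RN.rep (h1.trans h5)).trans h6⟩
      · intro α'' β' h1 h2 _ _
        obtain ⟨ν, h3, rfl⟩ := prod_U.1 h1
        rw [h3.rep] at h2
        obtain ⟨ν', h4, h5, h6, h7, h8⟩ := h3.trim
        exact ⟨_, ⟨ν', h4, h6, h7, h8.trans h2, rfl⟩, h4.prod.2 ⟨ν, h5, rfl⟩⟩

end Main

theorem scale_bound {n τ : ℕ} (hn : 2 ≤ n) (hτ : 2 ≤ τ) :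
    ((4000 * (n * 64) : ℕ) : ℝ) ≤ 256000 * (n : ℝ) ^ 2 * Real.logb 2 ((n : ℝ) * (τ : ℝ)) := by
  have h1 : (2 : ℝ) ≤ n := by exact_mod_cast hn
  have h2 : (2 : ℝ) ≤ τ := by exact_mod_cast hτ
  have hl : (1 : ℝ) ≤ Real.logb 2 ((n : ℝ) * (τ : ℝ)) := by
    rw [Real.le_logb_iff_rpow_le (by norm_num) (by positivity)]
    rw [Real.rpow_one]
    nlinarith
  push_cast
  have h3 : (n : ℝ) ≤ (n : ℝ) ^ 2 := by nlinarith
  have h4 : (256000 : ℝ) * (n : ℝ) ^ 2 * 1 ≤ 256000 * (n : ℝ) ^ 2 * Real.logb 2 ((n : ℝ) * (τ : ℝ)) := by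
    apply mul_le_mul_of_nonneg_left hl
    positivity
  nlinarith

theorem main_thm : ∃ (U : Finset (TileType 3)) (c : ℝ), 0 < c ∧
      ∀ T : TAS 3, 2 ≤ T.tileset.card → 2 ≤ T.temp →
        ∃ (R : RepFn 3) (UT : TAS 3) (m : ℕ), 0 < m ∧
          (m : ℝ) ≤ c * (T.tileset.card : ℝ) ^ 2 *
            Real.logb 2 ((T.tileset.card : ℝ) * (T.temp : ℝ)) ∧
          UT.tileset = U ∧ UT.temp = 2 ∧
          ValidRep T.tileset R ∧ Simulates UT T R m := by
  refine ⟨SU.U, 256000, by norm_num, fun T hn hτ => ?_⟩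
  have hne : T.tileset.Nonempty := Finset.card_pos.1 (by omega)
  refine ⟨RT T hne, UST T hne, scl T hne, ?_, ?_, rfl, rfl, valid_RT T hne, sim⟩
  · have := (θT T hne).hm
    unfold scl
    omega
  · have e : (θT T hne).m = T.tileset.card * 64 := cm_eq T.tileset
    unfold scl
    rw [e]
    exact scale_bound hn hτ

end IU

/-- There exist a finite tile set `U` of 3-dimensional tile types and a
constant `c > 0` such that every 3D aTAM system `T` with at least two tile
types and temperature at least 2 is simulated, at temperature 2, by a system
`UT = (U, σ_T, 2)` at some scale `m ≤ c·|T|²·log₂(|T|·τ)` under some valid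
macrotile representation function `R`. -/
theorem threeD_aTAM_IU_temp_two_scale_bound :
    ∃ (U : Finset (TileType 3)) (c : ℝ), 0 < c ∧
      ∀ T : TAS 3, 2 ≤ T.tileset.card → 2 ≤ T.temp →
        ∃ (R : RepFn 3) (UT : TAS 3) (m : ℕ), 0 < m ∧
          (m : ℝ) ≤ c * (T.tileset.card : ℝ) ^ 2 *
            Real.logb 2 ((T.tileset.card : ℝ) * (T.temp : ℝ)) ∧
          UT.tileset = U ∧ UT.temp = 2 ∧
          ValidRep T.tileset R ∧ Simulates UT T R m := by
  exact IU.main_thm
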